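/- arXiv:2407.11331 — 5 statements merged into one kernel-verified Lean document; each statement's English description precedes it below -/
import Mathlib

section
/- Let n ≥ 3 and let B ∈ 𝒰^n. Suppose there exists i₀ ∈ {1,…,n} such that 𝟙 − e_{i₀} ∈ B (equivalently, on ∂B), and suppose B is not a parallelepiped. Then 𝕀(B) ≤ 2^n − 2; moreover, there exists a set D of nonzero directions with D = −D and |D| ≤ 2^n − 2 that illuminates B. -/
open Set

/-- A convex body in `ℝ^n`: a compact convex set with nonempty interior. -/
def IsConvexBody {n : ℕ} (K : Set (Fin n → ℝ)) : Prop :=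
  Convex ℝ K ∧ IsCompact K ∧ (interior K).Nonempty

/-- `K` is 1-unconditional: closed under sign changes of the coordinates. -/
def Unconditional {n : ℕ} (K : Set (Fin n → ℝ)) : Prop :=
  ∀ x ∈ K, ∀ ε : Fin n → ℝ, (∀ i, ε i = 1 ∨ ε i = -1) → (fun i => ε i * x i) ∈ K

/-- The direction `d` illuminates the (boundary) point `x` of `K`. -/
def Illuminates {n : ℕ} (K : Set (Fin n → ℝ)) (d x : Fin n → ℝ) : Prop :=
  ∃ ε : ℝ, 0 < ε ∧ x + ε • d ∈ interior K

/-- The set of directions `D` illuminates every boundary point of `K`. -/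
def IlluminatesSet {n : ℕ} (K : Set (Fin n → ℝ)) (D : Set (Fin n → ℝ)) : Prop :=
  ∀ x ∈ frontier K, ∃ d ∈ D, Illuminates K d x

/-- The illumination number: smallest cardinality of a set of nonzero directions
illuminating `K`. -/
noncomputable def illumNumber {n : ℕ} (K : Set (Fin n → ℝ)) : ℕ :=
  sInf {m | ∃ D : Finset (Fin n → ℝ), D.card = m ∧ (∀ d ∈ D, d ≠ 0) ∧
    IlluminatesSet K ↑D}

/-- A parallelepiped: an affine image of the cube `[-1,1]^n`. -/
def IsParallelepiped {n : ℕ} (K : Set (Fin n → ℝ)) : Prop :=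
  ∃ T : (Fin n → ℝ) ≃ᵃ[ℝ] (Fin n → ℝ),
    K = T '' (Set.Icc (fun _ => (-1 : ℝ)) (fun _ => 1))

/-- The standard basis vector `e i`. -/
def stdB {n : ℕ} (i : Fin n) : Fin n → ℝ := Pi.single i 1

/-- The class `𝒰^n`: 1-unconditional convex bodies all of whose standard basis
vectors lie on the boundary. -/
def memU {n : ℕ} (K : Set (Fin n → ℝ)) : Prop :=
  IsConvexBody K ∧ Unconditional K ∧ ∀ i : Fin n, stdB i ∈ frontier K

/-- A 1-unconditional body is cubelike if all its extreme points have all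
coordinates nonzero. -/
def Cubelike {n : ℕ} (K : Set (Fin n → ℝ)) : Prop :=
  ∀ x ∈ Set.extremePoints ℝ K, ∀ i, x i ≠ 0

/-- The all-ones vector `𝟙`. -/
def allOnes {n : ℕ} : Fin n → ℝ := fun _ => 1

/-- The cube `[-1,1]^ι`. -/
def QQ (ι : Type) : Set (ι → ℝ) := {y | ∀ i, |y i| ≤ 1}

/-- The sign vector. -/
def sv {ι : Type} (s : ι → Bool) : ι → ℝ := fun i => if s i then 1 else -1

/-- Profile functions. -/
structure Prof {ι : Type} (f : (ι → ℝ) → ℝ) : Prop where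
  conc : ConcaveOn ℝ (QQ ι) f
  mono : ∀ a b : ι → ℝ, b ∈ QQ ι → (∀ i, |a i| ≤ |b i|) → f b ≤ f a
  zero : f 0 = 1
  nonneg : ∀ y ∈ QQ ι, 0 ≤ f y
  rad : ∀ u ∈ QQ ι, ∀ c, f u < c → ∃ r : ℝ, 0 ≤ r ∧ r < 1 ∧ f (r • u) < c

/-- lit top point -/
def Lit {ι : Type} (f : (ι → ℝ) → ℝ) (y d : ι → ℝ) (h : ℝ) : Prop :=
  ∃ ε : ℝ, 0 < ε ∧ (∀ i, |y i + ε * d i| < 1) ∧ f y + ε * h < f (y + ε • d)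

/-- lit equator point -/
def LitZ {ι : Type} (f : (ι → ℝ) → ℝ) (y d : ι → ℝ) (h : ℝ) : Prop :=
  ∃ ε : ℝ, 0 < ε ∧ (∀ i, |y i + ε * d i| < 1) ∧ ε * |h| < f (y + ε • d)

/-- The abstract goal. -/
def AbsGoal {ι : Type} [Fintype ι] (f : (ι → ℝ) → ℝ) : Prop :=
  ∃ D : Finset ((ι → ℝ) × ℝ), (∀ p ∈ D, p ≠ 0) ∧ (∀ p ∈ D, -p ∈ D) ∧
    D.card ≤ 2 ^ (Fintype.card ι + 1) - 2 ∧
    (∀ y ∈ QQ ι, 0 < f y → ∃ p ∈ D, Lit f y p.1 p.2) ∧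
    (∀ y ∈ QQ ι, f y = 0 → ∃ p ∈ D, LitZ f y p.1 p.2)

section abs
set_option linter.unusedSectionVars false
variable {ι : Type} [Fintype ι] [DecidableEq ι] {f : (ι → ℝ) → ℝ}


lemma zero_mem_QQ : (0 : ι → ℝ) ∈ QQ ι := by intro i; simp

lemma sv_cases (s : ι → Bool) (i : ι) : sv s i = 1 ∨ sv s i = -1 := by
  unfold sv; split_ifs <;> simp

lemma sv_abs (s : ι → Bool) (i : ι) : |sv s i| = 1 := by
  rcases sv_cases s i with h | h <;> simp [h]

lemma Prof.le_one (hf : Prof f) {y : ι → ℝ} (hy : y ∈ QQ ι) : f y ≤ 1 := by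
  rw [← hf.zero]
  exact hf.mono _ _ hy (by intro i; simp)

lemma Prof.combo (hf : Prof f) {x y : ι → ℝ} (hx : x ∈ QQ ι) (hy : y ∈ QQ ι) {t : ℝ}
    (h0 : 0 ≤ t) (h1 : t ≤ 1) : (1 - t) * f x + t * f y ≤ f ((1 - t) • x + t • y) := by
  have := hf.conc.2 hx hy (by linarith : 0 ≤ 1 - t) h0 (by ring)
  simpa using this

lemma Prof.low2 (hf : Prof f) {ρ θ : ℝ} (hρ0 : 0 ≤ ρ) (hρ1 : ρ ≤ 1)
    (hρ : f (fun _ => ρ) = 1) (h0 : 0 ≤ θ) (h1 : θ ≤ 1) {y : ι → ℝ}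
    (hy : ∀ i, |y i| ≤ 1 - θ + θ * ρ) : θ ≤ f y := by
  have m1 : (fun _ => (1:ℝ)) ∈ QQ ι := by intro i; simp
  have m2 : (fun _ => ρ) ∈ QQ ι := by intro i; rw [abs_of_nonneg hρ0]; exact hρ1
  have h := hf.combo m1 m2 h0 h1
  rw [hρ] at h
  have h3 := hf.nonneg _ m1
  have h4 : 0 ≤ (1 - θ) * f (fun _ => (1:ℝ)) := mul_nonneg (by linarith) h3
  have h5 := hf.mono y ((1 - θ) • (fun _ => (1:ℝ)) + θ • (fun _ => ρ))
    (hf.conc.1 m1 m2 (by linarith) h0 (by ring)) (by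
      intro i
      simp only [Pi.add_apply, Pi.smul_apply, smul_eq_mul, mul_one]
      rw [abs_of_nonneg (a := 1 - θ + θ * ρ) (by nlinarith)]
      exact hy i)
  linarith

/-- The main slope criterion. -/
lemma Prof.lit (hf : Prof f) {y d p q : ι → ℝ} {K L h : ℝ} (hy : y ∈ QQ ι) (hp : p ∈ QQ ι)
    (hq : q ∈ QQ ι) (hK : 0 ≤ K) (hL : 0 ≤ L)
    (hin : ∀ i, |y i| = 1 → y i * d i < 0)
    (hc : ∀ i, y i * d i ≤ y i * (K * (p i - y i) + L * (q i - y i)))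
    (hz : ∀ i, y i = 0 → |d i| ≤ |K * p i + L * q i|)
    (hh : h < K * (f p - f y) + L * (f q - f y)) : Lit f y d h := by
  have e1 : ∀ᶠ ε in nhdsWithin (0:ℝ) (Set.Ioi 0), ∀ i, |y i + ε * d i| < 1 := by
    rw [Filter.eventually_all]
    intro i
    by_cases h1 : |y i| = 1
    · have hd := hin i h1
      have hd0 : 0 < |d i| := abs_pos.2 (by rintro h; simp [h] at hd)
      have : ∀ᶠ ε in nhdsWithin (0:ℝ) (Set.Ioi 0), ε ∈ Set.Ioo (0:ℝ) (1 / |d i|) :=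
        Ioo_mem_nhdsGT (by positivity)
      filter_upwards [this] with ε hε
      have h2 : ε * |d i| < 1 := by
        have := hε.2; rwa [lt_div_iff₀ hd0] at this
      have h3 := hε.1
      rcases (abs_eq (by norm_num : (0:ℝ) ≤ 1)).1 h1 with h4 | h4
      · rw [h4] at hd ⊢
        have : d i < 0 := by linarith
        rw [abs_of_neg this] at h2
        rw [abs_lt]; constructor <;> nlinarith
      · rw [h4] at hd ⊢
        have : 0 < d i := by linarith
        rw [abs_of_pos this] at h2
        rw [abs_lt]; constructor <;> nlinarith
    · have h2 : |y i| < 1 := lt_of_le_of_ne (hy i) h1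
      have hcont : Filter.Tendsto (fun ε : ℝ => |y i + ε * d i|) (nhdsWithin (0:ℝ) (Set.Ioi 0))
          (nhds (|y i + 0 * d i|)) :=
        ((by fun_prop : Continuous (fun ε : ℝ => |y i + ε * d i|)).tendsto 0).mono_left
          nhdsWithin_le_nhds
      exact hcont.eventually (gt_mem_nhds (by simpa using h2))
  have e2 : ∀ᶠ ε in nhdsWithin (0:ℝ) (Set.Ioi 0), ∀ i,
      |y i + ε * d i| ≤ |y i + ε * (K * (p i - y i) + L * (q i - y i))| := by
    rw [Filter.eventually_all]
    intro i
    have hcont : Filter.Tendsto (fun ε : ℝ => y i * (y i + ε * d i))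
        (nhdsWithin (0:ℝ) (Set.Ioi 0)) (nhds (y i * (y i + 0 * d i))) :=
      ((by fun_prop : Continuous (fun ε : ℝ => y i * (y i + ε * d i))).tendsto 0).mono_left
          nhdsWithin_le_nhds
    by_cases h0 : y i = 0
    · filter_upwards with ε
      have := hz i h0
      simp only [h0, zero_add, sub_zero, abs_mul]
      exact mul_le_mul_of_nonneg_left this (abs_nonneg _)
    · have hpos : ∀ᶠ ε in nhdsWithin (0:ℝ) (Set.Ioi 0), 0 < y i * (y i + ε * d i) :=
        hcont.eventually (lt_mem_nhds (by
          have : 0 < y i * y i := mul_self_pos.2 h0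
          simpa using this))
      filter_upwards [hpos, self_mem_nhdsWithin] with ε h1 h2
      have h2' : 0 < ε := h2
      have h3 := mul_le_mul_of_nonneg_left (hc i) h2'.le
      have h4 : y i * (y i + ε * d i) ≤
        y i * (y i + ε * (K * (p i - y i) + L * (q i - y i))) := by nlinarith
      have h5 : |y i| * |y i + ε * d i| ≤
          |y i| * |y i + ε * (K * (p i - y i) + L * (q i - y i))| := by
        rw [← abs_mul, ← abs_mul, abs_of_pos h1]
        exact h4.trans (le_abs_self _)
      exact le_of_mul_le_mul_left h5 (abs_pos.2 h0)
  have e3 : ∀ᶠ ε in nhdsWithin (0:ℝ) (Set.Ioi 0), ε ∈ Set.Ioo (0:ℝ) (1 / (K + L + 1)) :=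
        Ioo_mem_nhdsGT (by positivity)
  obtain ⟨ε, h1, h2, h3⟩ := (e1.and (e2.and e3)).exists
  have hε := h3.1
  refine ⟨ε, hε, h1, ?_⟩
  have h4 : ε * (K + L) ≤ 1 := by
    have := h3.2
    rw [lt_div_iff₀ (by positivity)] at this
    nlinarith
  set z : ι → ℝ := (1 - ε * (K + L)) • y + (ε * K) • p + (ε * L) • q with hzdef
  have hz1 : z ∈ QQ ι ∧ (1 - ε * (K + L)) * f y + (ε * K) * f p + (ε * L) * f q ≤ f z := by
    have hw : ∀ i ∈ (Finset.univ : Finset (Fin 3)), 0 ≤ (![1 - ε * (K + L), ε * K, ε * L]) i := by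
      intro i _
      fin_cases i
      · simp; linarith
      · simp; positivity
      · simp; positivity
    have hs : ∑ i, (![1 - ε * (K + L), ε * K, ε * L]) i = 1 := by
      simp [Fin.sum_univ_three]; ring
    have hm : ∀ i ∈ (Finset.univ : Finset (Fin 3)), (![y, p, q]) i ∈ QQ ι := by
      intro i _
      fin_cases i
      · exact hy
      · exact hp
      · exact hq
    have a1 := hf.conc.1.sum_mem hw hs hm
    have a2 := hf.conc.le_map_sum hw hs hm
    simp [Fin.sum_univ_three] at a1 a2
    exact ⟨a1, a2⟩
  have h5 := hf.mono (y + ε • d) z hz1.1 (by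
    intro i
    have := h2 i
    simp only [hzdef, Pi.add_apply, Pi.smul_apply, smul_eq_mul]
    convert this using 2
    ring)
  have := mul_lt_mul_of_pos_left hh hε
  linarith [hz1.2]

/-- completion of `-sgn y` -/
def Comp (y : ι → ℝ) (s : ι → Bool) : Prop := ∀ i, y i * sv s i = -|y i|

lemma Comp.in_ {y : ι → ℝ} {s : ι → Bool} (h : Comp y s) : ∀ i, |y i| = 1 → y i * sv s i < 0 := by
  intro i hi; rw [h i, hi]; norm_num

lemma abs_mul_self_le {a : ℝ} (h : |a| ≤ 1) : a * a ≤ |a| := by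
  rw [← abs_mul_abs_self a]; nlinarith [abs_nonneg a]

/-- the canonical completion -/
noncomputable def sgc (y : ι → ℝ) : ι → Bool := fun i => decide (y i < 0)

lemma comp_sgc (y : ι → ℝ) : Comp y (sgc y) := by
  intro i
  by_cases h : y i < 0
  · simp [sgc, sv, h, abs_of_neg h]
  · simp [sgc, sv, h, abs_of_nonneg (not_lt.1 h)]

lemma comp_update {y : ι → ℝ} {s : ι → Bool} (h : Comp y s) {j : ι} (hj : y j = 0) (b : Bool) :
    Comp y (Function.update s j b) := by
  intro i
  by_cases hij : i = j
  · subst hij; simp [hj]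
  · have := h i
    simpa [sv, hij] using this

/-- any completion, cost at most `f y` -/
lemma Prof.lit_comp (hf : Prof f) {y : ι → ℝ} (hy : y ∈ QQ ι) {s : ι → Bool} (hs : Comp y s)
    {H : ℝ} (hH : f y < H) : Lit f y (sv s) (-H) := by
  have hpm : (fun i => if y i = 0 then sv s i else 0) ∈ QQ ι := by
    intro i; dsimp only; split_ifs
    · rw [sv_abs]
    · simp
  refine hf.lit (p := fun i => if y i = 0 then sv s i else 0) (q := y) (K := 1) (L := 0)
    hy hpm hy zero_le_one le_rfl hs.in_ ?_ ?_ ?_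
  · intro i
    rw [hs i]
    by_cases h : y i = 0
    · simp [h]
    · simp [h]; exact abs_mul_self_le (hy i)
  · intro i h; simp [h]
  · have := hf.nonneg _ hpm
    linarith

/-- full support, positive height -/
lemma Prof.lit_full (hf : Prof f) {y : ι → ℝ} (hy : y ∈ QQ ι) {s : ι → Bool} (hs : Comp y s)
    (hfull : ∀ i, y i ≠ 0) {H : ℝ} (hH : 0 < H) : Lit f y (sv s) (-H) := by
  refine hf.lit (p := y) (q := y) (K := 0) (L := 0)
    hy hy hy le_rfl le_rfl hs.in_ ?_ ?_ ?_
  · intro i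
    rw [hs i]
    simp
  · intro i h; exact absurd h (hfull i)
  · linarith

lemma Prof.lit_full0 (hf : Prof f) {y : ι → ℝ} (hy : y ∈ QQ ι) {s : ι → Bool} (hs : Comp y s)
    (hfull : ∀ i, y i ≠ 0) (hH : f y < 1) : Lit f y (sv s) 0 := by
  refine hf.lit (p := 0) (q := y) (K := 1) (L := 0)
    hy zero_mem_QQ hy zero_le_one le_rfl hs.in_ ?_ ?_ ?_
  · intro i
    rw [hs i]
    simp; exact abs_mul_self_le (hy i)
  · intro i h; exact absurd h (hfull i)
  · rw [hf.zero]; linarith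

lemma comp_step {y d : ι → ℝ} (hy : y ∈ QQ ι) {a ε : ℝ} (ha : 0 < a) (hd : ∀ i, a ≤ |d i|)
    (hd1 : ∀ i, |d i| ≤ 1)
    (hs : ∀ i, y i * d i ≤ 0) (hε : 0 < ε) (hε1 : ε ≤ 1 / 2) : ∀ i, |y i + ε * d i| ≤ 1 - ε * a := by
  intro i
  have h1 := abs_le.1 (hy i)
  have h2 := hs i
  have h3 := hd i
  have h4 := hd1 i
  rcases le_total 0 (d i) with h | h
  · rw [abs_of_nonneg h] at h3 h4
    have h5 : y i ≤ 0 := by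
      by_contra hcon
      push Not at hcon
      nlinarith
    rw [abs_le]; constructor <;> nlinarith
  · rw [abs_of_nonpos h] at h3 h4
    have h5 : 0 ≤ y i := by
      by_contra hcon
      push Not at hcon
      nlinarith
    rw [abs_le]; constructor <;> nlinarith

lemma Prof.litZ (hf : Prof f) {y d : ι → ℝ} (hy : y ∈ QQ ι) {a ρ h : ℝ} (ha : 0 < a)
    (ha1 : a ≤ 1) (hρ0 : 0 ≤ ρ) (hρ1 : ρ < 1) (hρ : f (fun _ => ρ) = 1)
    (hd : ∀ i, a ≤ |d i|) (hd1 : ∀ i, |d i| ≤ 1)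
    (hs : ∀ i, y i * d i ≤ 0) (hh : |h| * (1 - ρ) < a) : LitZ f y d h := by
  have hε : 0 < (1 - ρ) / 2 := by linarith
  have hst := comp_step hy ha hd hd1 hs hε (by linarith)
  refine ⟨(1 - ρ) / 2, hε, ?_, ?_⟩
  · intro i
    have := hst i
    have : 0 < (1 - ρ) / 2 * a := by positivity
    linarith [hst i]
  · have := hf.low2 (θ := a / 2) hρ0 hρ1.le hρ (by linarith) (by linarith)
      (y := y + ((1 - ρ) / 2) • d) (by
        intro i
        have := hst i
        simp only [Pi.add_apply, Pi.smul_apply, smul_eq_mul]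
        linarith)
    linarith


lemma sv_not (s : ι → Bool) : sv (fun i => !s i) = -sv s := by
  funext i; cases h : s i <;> simp [sv, h]

/-- nonconstant sign vector -/
def NT (s : ι → Bool) : Prop := s ≠ (fun _ => true) ∧ s ≠ (fun _ => false)

lemma NT_of {s : ι → Bool} {i j : ι} (h : s i ≠ s j) : NT s := by
  constructor <;> (rintro rfl; exact h rfl)

lemma exists_ne_idx (hm : 2 ≤ Fintype.card ι) (j : ι) : ∃ i : ι, i ≠ j := by
  have : Nontrivial ι := Fintype.one_lt_card_iff_nontrivial.1 (by omega)
  exact exists_ne j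

lemma exists_NT_comp (hm : 2 ≤ Fintype.card ι) {y : ι → ℝ} {j : ι} (hj : y j = 0) :
    ∃ s, NT s ∧ Comp y s := by
  obtain ⟨i, hi⟩ := exists_ne_idx hm j
  refine ⟨Function.update (sgc y) j (!(sgc y i)), ?_, comp_update (comp_sgc y) hj _⟩
  apply NT_of (i := i) (j := j)
  simp [hi]

lemma NT_flip (hm : 2 ≤ Fintype.card ι) {s : ι → Bool} (hs : ¬ NT s) (j : ι) :
    NT (Function.update s j (!(s j))) := by
  obtain ⟨i, hi⟩ := exists_ne_idx hm j
  apply NT_of (i := i) (j := j)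
  have : s i = s j := by
    by_contra h
    exact hs (NT_of h)
  simp [hi, this]

lemma NT_iff_not {s : ι → Bool} (hs : ¬ NT s) : s = (fun _ => true) ∨ s = (fun _ => false) := by
  unfold NT at hs; tauto

lemma absGoal_of (hm : 2 ≤ Fintype.card ι) (a : (ι → Bool) → ℝ)
    (T : ∀ y ∈ QQ ι, 0 < f y → (∃ s, NT s ∧ Lit f y (sv s) (-a s)) ∨
      (∃ s, ¬ NT s ∧ Lit f y (sv s) 0))
    (Z : ∀ y ∈ QQ ι, f y = 0 → (∃ s, NT s ∧ LitZ f y (sv s) (-a s)) ∨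
      (∃ s, NT s ∧ LitZ f y (-sv s) (a s)) ∨
      (∃ s, ¬ NT s ∧ LitZ f y (sv s) 0)) : AbsGoal f := by
  classical
  have hne : Nonempty ι := Fintype.card_pos_iff.1 (by omega)
  obtain ⟨i0⟩ := hne
  set S : Finset (ι → Bool) := (Finset.univ.erase (fun _ => true)).erase (fun _ => false) with hS
  have memS : ∀ s, s ∈ S ↔ NT s := by
    intro s; simp only [hS, Finset.mem_erase, NT, Finset.mem_univ, and_true]; tauto
  have cardS : S.card = 2 ^ Fintype.card ι - 2 := by
    rw [hS, Finset.card_erase_of_mem, Finset.card_erase_of_mem (Finset.mem_univ _)]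
    · simp [Fintype.card_bool]; omega
    · simp only [Finset.mem_erase, Finset.mem_univ, and_true]
      intro h; simpa using congrFun h i0
  set D : Finset ((ι → ℝ) × ℝ) := S.image (fun s => (sv s, -a s)) ∪
    S.image (fun s => (-sv s, a s)) ∪
    ({(fun _ => true), (fun _ => false)} : Finset (ι → Bool)).image (fun s => (sv s, (0:ℝ))) with hD
  have m1 : ∀ s, NT s → (sv s, -a s) ∈ D := fun s hs =>
    Finset.mem_union_left _ (Finset.mem_union_left _ (Finset.mem_image_of_mem _ ((memS s).2 hs)))
  have m2 : ∀ s, NT s → (-sv s, a s) ∈ D := fun s hs =>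
    Finset.mem_union_left _ (Finset.mem_union_right _
      (Finset.mem_image_of_mem (fun s => (-sv s, a s)) ((memS s).2 hs)))
  have m3 : ∀ s, ¬ NT s → (sv s, (0:ℝ)) ∈ D := fun s hs =>
    Finset.mem_union_right _ (Finset.mem_image_of_mem (fun s => (sv s, (0:ℝ)))
      (by simpa using NT_iff_not hs))
  have hcases : ∀ p ∈ D, (∃ s, NT s ∧ p = (sv s, -a s)) ∨ (∃ s, NT s ∧ p = (-sv s, a s)) ∨
      (∃ s, ¬ NT s ∧ p = (sv s, (0:ℝ))) := by
    intro p hp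
    rcases Finset.mem_union.1 hp with hp | hp
    · rcases Finset.mem_union.1 hp with hp | hp
      · obtain ⟨s, hs, rfl⟩ := Finset.mem_image.1 hp
        exact Or.inl ⟨s, (memS s).1 hs, rfl⟩
      · obtain ⟨s, hs, rfl⟩ := Finset.mem_image.1 hp
        exact Or.inr (Or.inl ⟨s, (memS s).1 hs, rfl⟩)
    · obtain ⟨s, hs, rfl⟩ := Finset.mem_image.1 hp
      refine Or.inr (Or.inr ⟨s, ?_, rfl⟩)
      simp only [Finset.mem_insert, Finset.mem_singleton] at hs
      unfold NT; tauto
  have hsv : ∀ s : ι → Bool, sv s ≠ 0 := by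
    intro s h
    have := sv_abs s i0
    simp [h] at this
  refine ⟨D, ?_, ?_, ?_, ?_, ?_⟩
  · intro p hp h0
    rcases hcases p hp with ⟨s, hs, rfl⟩ | ⟨s, hs, rfl⟩ | ⟨s, hs, rfl⟩
    · exact hsv s (congrArg Prod.fst h0)
    · exact hsv s (neg_eq_zero.1 (congrArg Prod.fst h0))
    · exact hsv s (congrArg Prod.fst h0)
  · intro p hp
    rcases hcases p hp with ⟨s, hs, rfl⟩ | ⟨s, hs, rfl⟩ | ⟨s, hs, rfl⟩
    · simpa using m2 s hs
    · simpa using m1 s hs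
    · have := m3 (fun i => !s i) (by
        rcases NT_iff_not hs with rfl | rfl <;> simp [NT])
      rw [sv_not] at this
      simpa using this
  · have h2 : 2 ≤ 2 ^ Fintype.card ι := by
      calc 2 = 2 ^ 1 := by norm_num
        _ ≤ _ := Nat.pow_le_pow_right (by norm_num) (by omega)
    have c1 := Finset.card_image_le (s := S) (f := fun s => (sv s, -a s))
    have c2 := Finset.card_image_le (s := S) (f := fun s => (-sv s, a s))
    have c3 := Finset.card_image_le (s := ({(fun _ => true), (fun _ => false)} : Finset (ι → Bool)))
      (f := fun s => (sv s, (0:ℝ)))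
    have c4 : ({(fun _ => true), (fun _ => false)} : Finset (ι → Bool)).card ≤ 2 :=
      Finset.card_le_two
    have c5 := Finset.card_union_le (S.image (fun s => (sv s, -a s)) ∪
      S.image (fun s => (-sv s, a s)))
      (({(fun _ => true), (fun _ => false)} : Finset (ι → Bool)).image (fun s => (sv s, (0:ℝ))))
    have c6 := Finset.card_union_le (S.image (fun s => (sv s, -a s)))
      (S.image (fun s => (-sv s, a s)))
    have c7 : D.card ≤ _ := c5
    rw [pow_succ]
    omega
  · intro y hy hfy
    rcases T y hy hfy with ⟨s, hs, h⟩ | ⟨s, hs, h⟩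
    · exact ⟨_, m1 s hs, h⟩
    · exact ⟨_, m3 s hs, h⟩
  · intro y hy hfy
    rcases Z y hy hfy with ⟨s, hs, h⟩ | ⟨s, hs, h⟩ | ⟨s, hs, h⟩
    · exact ⟨_, m1 s hs, h⟩
    · exact ⟨_, m2 s hs, h⟩
    · exact ⟨_, m3 s hs, h⟩

lemma Prof.exists_rho (hf : Prof f) (h1 : f (fun _ => 1) < 1) :
    ∃ ρ : ℝ, 0 ≤ ρ ∧ ρ < 1 ∧ f (fun _ => ρ) = 1 ∧
      ∀ r : ℝ, 0 ≤ r → r ≤ 1 → f (fun _ => r) = 1 → r ≤ ρ := by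
  have hc : ∀ r : ℝ, 0 ≤ r → r ≤ 1 → (fun _ => r) ∈ QQ ι := by
    intro r h0 h1 i; rw [abs_of_nonneg h0]; exact h1
  have hmono : ∀ r r' : ℝ, 0 ≤ r → r ≤ r' → r' ≤ 1 → f (fun _ => r') ≤ f (fun _ => r) := by
    intro r r' a b c
    apply hf.mono _ _ (hc r' (a.trans b) c)
    intro i; rw [abs_of_nonneg a, abs_of_nonneg (a.trans b)]; exact b
  set R : Set ℝ := {r | 0 ≤ r ∧ r ≤ 1 ∧ f (fun _ => r) = 1} with hR
  have h0R : (0:ℝ) ∈ R := ⟨le_rfl, zero_le_one, hf.zero⟩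
  have hbdd : BddAbove R := ⟨1, fun r hr => hr.2.1⟩
  obtain ⟨r0, hr00, hr01, hr0⟩ := hf.rad _ (hc 1 zero_le_one le_rfl) 1 h1
  have hr0' : f (fun _ => r0) < 1 := by
    convert hr0 using 2; funext i; simp
  have hle : sSup R ≤ r0 := csSup_le ⟨0, h0R⟩ (by
    intro r hr
    by_contra hcon
    push Not at hcon
    have := hmono r0 r hr00 hcon.le hr.2.1
    rw [hr.2.2] at this
    linarith)
  have hs0 : 0 ≤ sSup R := le_csSup hbdd h0R
  refine ⟨sSup R, hs0, lt_of_le_of_lt hle hr01, ?_, fun r a b c => le_csSup hbdd ⟨a, b, c⟩⟩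
  by_contra hne
  have hlt : f (fun _ => sSup R) < 1 :=
    lt_of_le_of_ne (hf.le_one (hc _ hs0 (hle.trans hr01.le))) hne
  rcases hs0.eq_or_lt with h | h
  · rw [← h] at hlt
    have := hf.zero
    exact absurd this (ne_of_lt hlt)
  obtain ⟨r, a, b, c⟩ := hf.rad _ (hc _ hs0 (hle.trans hr01.le)) 1 hlt
  have c' : f (fun _ => r * sSup R) < 1 := c
  obtain ⟨r', hr', hlt'⟩ := exists_lt_of_lt_csSup ⟨0, h0R⟩ (by nlinarith : r * sSup R < sSup R)
  have := hmono (r * sSup R) r' (by positivity) hlt'.le hr'.2.1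
  rw [hr'.2.2] at this
  linarith

lemma Prof.const_case (hf : Prof f) (hm : 2 ≤ Fintype.card ι) {ρ H : ℝ} (hρ0 : 0 ≤ ρ)
    (hρ1 : ρ < 1) (hρ : f (fun _ => ρ) = 1)
    (hmax : ∀ r : ℝ, 0 ≤ r → r ≤ 1 → f (fun _ => r) = 1 → r ≤ ρ) (hH : 0 < H)
    (hzero : ∀ y ∈ QQ ι, ∀ s, Comp y s → Lit f y (sv s) (-H) )
    (hfull : ∀ y ∈ QQ ι, f y = 1 → (∀ i, y i ≠ 0) → ∀ j, |y j| ≤ ρ → ∀ s, Comp y s →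
      Lit f y (sv (Function.update s j (!(s j)))) (-H))
    (hz : 0 < f (fun _ => 1) ∨ H * (1 - ρ) < 1) : AbsGoal f := by
  have hne : Nonempty ι := Fintype.card_pos_iff.1 (by omega)
  refine absGoal_of hm (fun _ => H) ?_ ?_
  · intro y hy hfy
    by_cases hyz : ∃ j, y j = 0
    · obtain ⟨j, hj⟩ := hyz
      obtain ⟨s, hs, hc⟩ := exists_NT_comp hm hj
      exact Or.inl ⟨s, hs, hzero y hy s hc⟩
    push Not at hyz
    by_cases hNT : NT (sgc y)
    · exact Or.inl ⟨_, hNT, hf.lit_full hy (comp_sgc y) hyz hH⟩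
    rcases (hf.le_one hy).eq_or_lt with h1 | h1
    · left
      obtain ⟨j, hj⟩ := Finite.exists_min (fun i => |y i|)
      refine ⟨_, NT_flip hm hNT j, hfull y hy h1 hyz j ?_ _ (comp_sgc y)⟩
      apply hmax _ (abs_nonneg _) (hy j)
      apply le_antisymm
      · apply hf.le_one
        intro i; rw [abs_abs]; exact hy j
      · rw [← h1]
        apply hf.mono _ _ hy
        intro i; rw [abs_abs]; exact hj i
    · exact Or.inr ⟨_, hNT, hf.lit_full0 hy (comp_sgc y) hyz h1⟩
  · intro y hy hfy
    rcases hz with hz | hz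
    · exfalso
      have := hf.mono y (fun _ => 1) (by intro i; simp) (by intro i; simpa using hy i)
      linarith
    by_cases hNT : NT (sgc y)
    · refine Or.inl ⟨_, hNT, ?_⟩
      refine hf.litZ hy zero_lt_one le_rfl hρ0 hρ1 hρ (fun i => (sv_abs _ i).ge)
        (fun i => (sv_abs _ i).le) (fun i => ?_) ?_
      · rw [comp_sgc y i]; simp
      · rw [abs_neg, abs_of_pos hH]; exact hz
    · refine Or.inr (Or.inr ⟨_, hNT, ?_⟩)
      refine hf.litZ hy zero_lt_one le_rfl hρ0 hρ1 hρ (fun i => (sv_abs _ i).ge)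
        (fun i => (sv_abs _ i).le) (fun i => ?_) ?_
      · rw [comp_sgc y i]; simp
      · simp

/-- flipped coordinate: estimates -/
lemma sv_flip_ne (s : ι → Bool) {i j : ι} (h : i ≠ j) :
    sv (Function.update s j (!(s j))) i = sv s i := by
  simp [sv, h]

lemma sv_flip_self (s : ι → Bool) (j : ι) :
    sv (Function.update s j (!(s j))) j = - sv s j := by
  cases h : s j <;> simp [sv, h]

lemma Prof.case1 (hf : Prof f) (hm : 2 ≤ Fintype.card ι) (h1 : f (fun _ => 1) < 1)
    (h0 : 0 < f (fun _ => 1)) : AbsGoal f := by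
  obtain ⟨ρ, hρ0, hρ1, hρ, hmax⟩ := hf.exists_rho h1
  have hpos : 0 < 1 - ρ := by linarith
  refine hf.const_case hm (H := 1 / (1 - ρ) + 1) hρ0 hρ1 hρ hmax (by positivity) ?_ ?_ (Or.inl h0)
  · intro y hy s hs
    apply hf.lit_comp hy hs
    have := hf.le_one hy
    have : 0 < 1 / (1 - ρ) := by positivity
    linarith
  · intro y hy hfy hfull j hj s hs
    have hpm : Function.update y j (y j - (1 - ρ) * sv s j) ∈ QQ ι := by
      intro i
      by_cases hij : i = j
      · subst hij
        simp only [Function.update_self]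
        have := abs_sub (y i) ((1 - ρ) * sv s i)
        rw [abs_mul, sv_abs, abs_of_pos hpos] at this
        linarith
      · simpa [hij] using hy i
    refine hf.lit (p := Function.update y j (y j - (1 - ρ) * sv s j)) (q := y)
      (K := 1 / (1 - ρ)) (L := 0) hy hpm hy (by positivity) le_rfl ?_ ?_ ?_ ?_
    · intro i hi
      by_cases hij : i = j
      · subst hij; linarith
      · rw [sv_flip_ne _ hij]; exact hs.in_ i hi
    · intro i
      by_cases hij : i = j
      · subst hij
        rw [sv_flip_self]
        simp only [Function.update_self]
        apply le_of_eq
        field_simp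
        ring
      · rw [sv_flip_ne _ hij, hs i]; simp [hij]
    · intro i hi; exact absurd hi (hfull i)
    · have h2 := hf.nonneg _ hpm
      rw [hfy]
      have : 0 ≤ 1 / (1 - ρ) * f (Function.update y j (y j - (1 - ρ) * sv s j)) := by positivity
      linarith

lemma Prof.case2 (hf : Prof f) (hm : 2 ≤ Fintype.card ι) (h1 : f (fun _ => 1) < 1)
    (v : ι) (hv0 : 0 < f (Pi.single v 1)) (hv : ∀ j ≠ v, f (Pi.single j 1) = 1) : AbsGoal f := by
  obtain ⟨ρ, hρ0, hρ1, hρ, hmax⟩ := hf.exists_rho h1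
  have hpos : 0 < 1 - ρ := by linarith
  set μ := f (Pi.single v 1) with hμ
  set m : ℝ := (Fintype.card ι : ℝ) with hmdef
  have hm2 : (2:ℝ) ≤ m := by rw [hmdef]; exact_mod_cast hm
  have hsingle : ∀ (j : ι) (c : ℝ), |c| ≤ 1 → Pi.single j c ∈ QQ ι := by
    intro j c hc i
    by_cases hij : i = j
    · subst hij; simpa using hc
    · simp [hij]
  have hμ1 : μ ≤ 1 := hf.le_one (hsingle v 1 (by simp))
  have hsμ : ∀ (j : ι) (c : ℝ), |c| ≤ 1 → f (Pi.single j 1) ≤ f (Pi.single j c) := by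
    intro j c hc
    apply hf.mono _ _ (hsingle j 1 (by simp))
    intro i
    by_cases hij : i = j
    · subst hij; simpa using hc
    · simp [hij]
  have hμj : ∀ j, μ ≤ f (Pi.single j 1) := by
    intro j
    by_cases h : j = v
    · rw [h]
    · rw [hv j h]; exact hμ1
  have hge : 1 ≤ 1 / (1 - ρ) := by rw [le_div_iff₀ hpos]; linarith
  have hμm : 0 < μ / m := by positivity
  have hμm1 : μ / m ≤ μ / 2 := by gcongr
  refine hf.const_case hm (H := 1 / (1 - ρ) - μ / m / 2) hρ0 hρ1 hρ hmax (by linarith) ?_ ?_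
    (Or.inr ?_)
  · intro y hy s hs
    set q : ι → (ι → ℝ) := fun j => Pi.single j (if y j = 0 then sv s j else 0) with hq
    have hqm : ∀ j, q j ∈ QQ ι := by
      intro j; apply hsingle; split_ifs
      · rw [sv_abs]
      · simp
    set P : ι → ℝ := fun i => if y i = 0 then sv s i / m else 0 with hP
    have hsum : ∑ j, (1 / m) • q j = P := by
      funext i
      simp only [Finset.sum_apply, Pi.smul_apply, smul_eq_mul, hq, hP]
      rw [Finset.sum_eq_single i]
      · by_cases h : y i = 0
        · simp [h]; ring
        · simp [h]
      · intro j _ hj; simp [hj.symm]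
      · simp
    have hw : ∀ i ∈ (Finset.univ : Finset ι), 0 ≤ 1 / m := fun _ _ => by positivity
    have hw1 : ∑ _i : ι, 1 / m = 1 := by
      simp only [Finset.sum_const, Finset.card_univ, nsmul_eq_mul]
      rw [← hmdef]; field_simp
    have hPm : P ∈ QQ ι := by
      rw [← hsum]
      exact hf.conc.1.sum_mem hw hw1 (fun j _ => hqm j)
    have hPf : 1 - (1 - μ) / m ≤ f P := by
      have := hf.conc.le_map_sum hw hw1 (fun j _ => hqm j)
      rw [hsum] at this
      refine le_trans ?_ this
      have hterm : ∀ j ∈ (Finset.univ : Finset ι),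
          1 / m * (1 - if j = v then 1 - μ else 0) ≤ (1 / m) • f (q j) := by
        intro j _
        rw [smul_eq_mul]
        apply mul_le_mul_of_nonneg_left _ (by positivity)
        have h3 : f (Pi.single j 1) ≤ f (q j) := by
          apply hsμ; split_ifs
          · rw [sv_abs]
          · simp
        split_ifs with h
        · have := hμj j; linarith
        · have := hv j h; linarith
      refine le_trans ?_ (Finset.sum_le_sum hterm)
      rw [← Finset.mul_sum, Finset.sum_sub_distrib]
      simp only [Finset.sum_const, Finset.card_univ, nsmul_eq_mul, Finset.sum_ite_eq',
        Finset.mem_univ, if_true]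
      rw [← hmdef]
      apply le_of_eq
      field_simp
    have hp2 : (fun i => if y i = 0 then sv s i else y i) ∈ QQ ι := by
      intro i; dsimp only; split_ifs
      · rw [sv_abs]
      · exact hy i
    have hm1 : 0 ≤ 1 - 1 / m := by
      rw [sub_nonneg, div_le_one (by linarith)]; linarith
    refine hf.lit (p := P) (q := fun i => if y i = 0 then sv s i else y i) (K := 1)
      (L := 1 - 1 / m) hy hPm hp2 zero_le_one hm1 hs.in_ ?_ ?_ ?_
    · intro i
      rw [hs i]
      by_cases h : y i = 0
      · simp [h]
      · simp [h, hP]; exact abs_mul_self_le (hy i)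
    · intro i h
      simp only [hP, h, if_true]
      apply le_of_eq
      congr 1
      ring
    · have a1 := hf.nonneg _ hp2
      have a2 := hf.le_one hy
      have a3 := mul_nonneg hm1 a1
      have a4 : (1 - 1 / m) * f y ≤ (1 - 1 / m) := by nlinarith
      have a5 : (1 - μ) / m = 1 / m - μ / m := by ring
      nlinarith
  · intro y hy hfy hfull j hj s hs
    have hyj : |y j| < 1 := by linarith
    have hpj : 0 < 1 - |y j| := by linarith
    have hpm : Function.update y j (- sv s j) ∈ QQ ι := by
      intro i
      by_cases hij : i = j
      · subst hij
        simp [sv_abs]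
      · simpa [hij] using hy i
    have hp1 : Pi.single j (-sv s j) ∈ QQ ι := hsingle _ _ (by simp [sv_abs])
    have hyval : y j = - |y j| * sv s j := by
      have h := hs j
      rcases sv_cases s j with h' | h' <;> rw [h'] at h ⊢ <;> linarith
    have hsq : sv s j * sv s j = 1 := by
      rcases sv_cases s j with h' | h' <;> rw [h'] <;> norm_num
    refine hf.lit (p := Pi.single j (-sv s j)) (q := Function.update y j (- sv s j))
      (K := 1) (L := |y j| / (1 - |y j|)) hy hp1 hpm zero_le_one (by positivity) ?_ ?_ ?_ ?_
    · intro i hi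
      by_cases hij : i = j
      · subst hij; linarith
      · rw [sv_flip_ne _ hij]; exact hs.in_ i hi
    · intro i
      by_cases hij : i = j
      · subst hij
        rw [sv_flip_self]
        simp only [Function.update_self, Pi.single_eq_same]
        apply le_of_eq
        congr 1
        have : -sv s i - y i = -(1 - |y i|) * sv s i := by
          rw [hyval]; simp [abs_mul, sv_abs]; ring
        rw [this]
        field_simp
        ring
      · rw [sv_flip_ne _ hij, hs i]; simp [hij]; exact abs_mul_self_le (hy i)
    · intro i hi; exact absurd hi (hfull i)
    · have h2 := hf.nonneg _ hpm
      have h3 : μ ≤ f (Pi.single j (-sv s j)) := (hμj j).trans (hsμ j _ (by simp [sv_abs]))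
      rw [hfy]
      have h4 : 0 ≤ |y j| / (1 - |y j|) * f (Function.update y j (- sv s j)) :=
        mul_nonneg (by positivity) h2
      have h5 : |y j| / (1 - |y j|) = 1 / (1 - |y j|) - 1 := by field_simp; ring
      have h6 : 1 / (1 - |y j|) ≤ 1 / (1 - ρ) := by gcongr
      nlinarith
  · have : (1 / (1 - ρ) - μ / m / 2) * (1 - ρ) = 1 - μ / m / 2 * (1 - ρ) := by field_simp
    rw [this]
    have : 0 < μ / m / 2 * (1 - ρ) := by positivity
    linarith

lemma single_mem_QQ (j : ι) {c : ℝ} (hc : |c| ≤ 1) : Pi.single j c ∈ QQ ι := by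
  intro i
  by_cases hij : i = j
  · subst hij; simpa using hc
  · simp [hij]

lemma Prof.exists_gap (hf : Prof f) {j : ι} (hj : f (Pi.single j 1) < 1) :
    ∃ M : ℝ, 0 ≤ M ∧ M < 1 ∧ ∀ y ∈ QQ ι, M < f y → |y j| ≤ M := by
  obtain ⟨r, hr0, hr1, hr⟩ := hf.rad _ (single_mem_QQ j (by simp : |(1:ℝ)| ≤ 1))
    ((f (Pi.single j 1) + 1) / 2) (by linarith)
  refine ⟨max r ((f (Pi.single j 1) + 1) / 2), le_max_of_le_left hr0,
    max_lt hr1 (by linarith), ?_⟩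
  intro y hy hM
  by_contra hcon
  push Not at hcon
  have h1 : r ≤ |y j| := (le_max_left _ _).trans hcon.le
  have h2 : f y ≤ f (r • Pi.single j 1) := by
    apply hf.mono _ _ hy
    intro i
    by_cases hij : i = j
    · subst hij; simpa [abs_of_nonneg hr0] using h1
    · simp [hij]
  have h3 := (le_max_right r ((f (Pi.single j 1) + 1) / 2))
  linarith

lemma Prof.case3 (hf : Prof f) (hm : 2 ≤ Fintype.card ι) {v v' : ι} (hvv : v ≠ v')
    (hv : f (Pi.single v 1) < 1) (hv' : f (Pi.single v' 1) < 1) : AbsGoal f := by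
  obtain ⟨M1, hM10, hM11, hM1⟩ := hf.exists_gap hv
  obtain ⟨M2, hM20, hM21, hM2⟩ := hf.exists_gap hv'
  obtain ⟨M, hM0, hMl, hMv⟩ : ∃ M : ℝ, 0 ≤ M ∧ M < 1 ∧
      ∀ y ∈ QQ ι, M < f y → ∀ i, i = v ∨ i = v' → |y i| ≤ M := by
    refine ⟨max M1 M2, le_max_of_le_left hM10, max_lt hM11 hM21, ?_⟩
    rintro y hy h i (rfl | rfl)
    · exact (hM1 y hy (lt_of_le_of_lt (le_max_left _ _) h)).trans (le_max_left _ _)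
    · exact (hM2 y hy (lt_of_le_of_lt (le_max_right _ _) h)).trans (le_max_right _ _)
  have hpos : 0 < 1 - M := by linarith
  have hK : 1 ≤ 1 / (1 - M) := by rw [le_div_iff₀ hpos]; linarith
  set a : (ι → Bool) → ℝ := fun s => if s v then 1 / (1 - M) + 1 else (1 + M) / 2 with ha
  have haM : ∀ s, M < a s := by
    intro s; simp only [ha]; split_ifs <;> linarith
  refine absGoal_of hm a ?_ ?_
  · intro y hy hfy
    rcases le_or_gt (f y) M with hle | hgt
    · by_cases hyz : ∃ j, y j = 0
      · obtain ⟨j, hj⟩ := hyz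
        obtain ⟨s, hs, hc⟩ := exists_NT_comp hm hj
        exact Or.inl ⟨s, hs, hf.lit_comp hy hc (lt_of_le_of_lt hle (haM s))⟩
      push Not at hyz
      by_cases hNT : NT (sgc y)
      · exact Or.inl ⟨_, hNT, hf.lit_full hy (comp_sgc y) hyz (lt_of_le_of_lt hM0 (haM _))⟩
      · exact Or.inr ⟨_, hNT, hf.lit_full0 hy (comp_sgc y) hyz (by linarith)⟩
    · left
      have hyM := hMv y hy hgt
      set s : ι → Bool := fun i => if i = v then true else if i = v' then false else sgc y i
        with hs
      have hsv : s v = true := by simp [hs]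
      have hsv' : s v' = false := by simp [hs, hvv.symm]
      have hso : ∀ i, ¬ (i = v ∨ i = v') → y i * sv s i = - |y i| := by
        intro i hi
        push Not at hi
        rw [← comp_sgc y i]
        simp [sv, hs, hi.1, hi.2]
      refine ⟨s, NT_of (i := v) (j := v') (by simp [hsv, hsv']), ?_⟩
      have has : a s = 1 / (1 - M) + 1 := by simp [ha, hsv]
      rw [has]
      set p : ι → ℝ := fun i => if i = v ∨ i = v' then y i + (1 - M) * sv s i else
        if y i = 0 then sv s i else y i with hp
      have hpm : p ∈ QQ ι := by
        intro i
        simp only [hp]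
        split_ifs with h1 h2
        · have := abs_add_le (y i) ((1 - M) * sv s i)
          rw [abs_mul, sv_abs, abs_of_pos hpos] at this
          linarith [hyM i h1]
        · rw [sv_abs]
        · exact hy i
      refine hf.lit (p := p) (q := y) (K := 1 / (1 - M)) (L := 0) hy hpm hy (by positivity) le_rfl
        ?_ ?_ ?_ ?_
      · intro i hi
        by_cases hiv : i = v ∨ i = v'
        · have := hyM i hiv; linarith
        · rw [hso i hiv, hi]; norm_num
      · intro i
        by_cases hiv : i = v ∨ i = v'
        · simp only [hp, hiv, if_true]
          apply le_of_eq
          field_simp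
          ring
        · by_cases h0 : y i = 0
          · simp [h0]
          · rw [hso i hiv]; simp [hp, hiv, h0]
      · intro i h0
        by_cases hiv : i = v ∨ i = v'
        · simp only [hp, hiv, if_true, h0]
          apply le_of_eq
          congr 1
          field_simp
          ring
        · simp only [hp, hiv, if_false, h0, if_true, zero_mul, add_zero]
          rw [abs_mul, sv_abs, abs_of_nonneg (by positivity)]
          linarith
      · have h2 := hf.nonneg _ hpm
        have h3 := hf.le_one hy
        have : 0 ≤ 1 / (1 - M) * f p := by positivity
        have : 1 / (1 - M) * f y ≤ 1 / (1 - M) := by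
          have : 0 ≤ 1 / (1 - M) := by positivity
          nlinarith
        linarith
  · intro y hy hfy
    have key : ∀ h : ℝ, |h| < 1 → LitZ f y (sv (sgc y)) h := by
      intro h hh
      refine hf.litZ hy zero_lt_one le_rfl le_rfl zero_lt_one hf.zero (fun i => (sv_abs _ i).ge)
        (fun i => (sv_abs _ i).le) (fun i => ?_) (by simpa using hh)
      rw [comp_sgc y i]; simp
    by_cases hNT : NT (sgc y)
    · cases hb : sgc y v
      · refine Or.inl ⟨_, hNT, key _ ?_⟩
        simp only [ha, hb]
        rw [abs_neg, abs_of_nonneg] <;> simp <;> linarith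
      · refine Or.inr (Or.inl ⟨fun i => !(sgc y i), ?_, ?_⟩)
        · constructor
          · intro h; apply hNT.2; funext i; simpa using congrFun h i
          · intro h; apply hNT.1; funext i; simpa using congrFun h i
        · rw [sv_not, neg_neg]
          apply key
          simp only [ha, hb]
          rw [abs_of_nonneg] <;> simp <;> linarith
    · exact Or.inr (Or.inr ⟨_, hNT, key 0 (by simp)⟩)


/-- direction with weight `a` at `v` -/
def vd (v : ι) (a : ℝ) (s : ι → Bool) : ι → ℝ := fun i => sv s i * (if i = v then a else 1)

/-- direction vanishing at `v` -/
def dW (v : ι) (s : ι → Bool) : ι → ℝ := fun i => if i = v then 0 else sv s i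

open Classical in
/-- heights -/
noncomputable def hgt (v : ι) (η : ℝ) (s : ι → Bool) : ℝ :=
  if ∀ i, i ≠ v → s i = false then -η else if ∀ i, i ≠ v → s i = true then η else 0

lemma hgt_not (hm : 2 ≤ Fintype.card ι) (v : ι) (η : ℝ) (s : ι → Bool) :
    hgt v η (fun i => !s i) = - hgt v η s := by
  obtain ⟨j, hj⟩ := exists_ne_idx hm v
  unfold hgt
  simp only [Bool.not_eq_false', Bool.not_eq_true']
  by_cases h1 : ∀ i, i ≠ v → s i = false
  · have h2 : ¬ ∀ i, i ≠ v → s i = true := by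
      intro h; have := h1 j hj; rw [h j hj] at this; cases this
    rw [if_neg h2, if_pos h1, if_pos h1, neg_neg]
  · simp only [h1, if_false]
    split_ifs <;> simp

lemma abs_hgt (v : ι) {η : ℝ} (hη : 0 ≤ η) (s : ι → Bool) : |hgt v η s| ≤ η := by
  unfold hgt
  split_ifs <;> simp [abs_of_nonneg hη, hη]

lemma abs_vd (v : ι) {a : ℝ} (ha : 0 < a) (s : ι → Bool) (i : ι) :
    |vd v a s i| = if i = v then a else 1 := by
  unfold vd
  rw [abs_mul, sv_abs, one_mul]
  split_ifs
  · exact abs_of_pos ha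
  · simp

lemma Prof.absGoal4 (hf : Prof f) (hm : 2 ≤ Fintype.card ι) (v : ι) {a η M : ℝ}
    (ha : 0 < a) (ha1 : a ≤ 1) (hη : 0 ≤ η) (hηa : η < a)
    (T : ∀ y ∈ QQ ι, 0 < f y → (∃ s, (∃ j, j ≠ v ∧ s j = true) ∧ Lit f y (dW v s) (-M)) ∨
      (∃ s, (∀ j, j ≠ v → s j = false) ∧ Lit f y (vd v a s) (-η))) : AbsGoal f := by
  classical
  obtain ⟨j0, hj0⟩ := exists_ne_idx hm v
  set ex : ({i : ι // i ≠ v} → Bool) → (ι → Bool) :=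
    fun σ i => if h : i ≠ v then σ ⟨i, h⟩ else false with hex
  set S : Finset ({i : ι // i ≠ v} → Bool) := Finset.univ.erase (fun _ => false) with hS
  have cardS : S.card = 2 ^ (Fintype.card ι - 1) - 1 := by
    rw [hS, Finset.card_erase_of_mem (Finset.mem_univ _)]
    simp [Fintype.card_subtype_compl]
  set D : Finset ((ι → ℝ) × ℝ) := (Finset.univ : Finset (ι → Bool)).image
      (fun s => (vd v a s, hgt v η s)) ∪
    (S.image (fun σ => (dW v (ex σ), -M)) ∪ S.image (fun σ => (-dW v (ex σ), M))) with hD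
  have m1 : ∀ s, (vd v a s, hgt v η s) ∈ D := fun s =>
    Finset.mem_union_left _ (Finset.mem_image_of_mem (fun s => (vd v a s, hgt v η s))
      (Finset.mem_univ s))
  have m2 : ∀ s : ι → Bool, (∃ j, j ≠ v ∧ s j = true) → (dW v s, -M) ∈ D := by
    rintro s ⟨j, hj, hsj⟩
    apply Finset.mem_union_right
    apply Finset.mem_union_left
    rw [Finset.mem_image]
    refine ⟨fun i => s i, ?_, ?_⟩
    · simp only [hS, Finset.mem_erase, Finset.mem_univ, and_true]
      intro h
      have := congrFun h ⟨j, hj⟩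
      simp [hsj] at this
    · congr 1
      funext i
      by_cases h : i = v
      · simp [dW, h]
      · simp [dW, sv, hex, h]
  have hcases : ∀ p ∈ D, (∃ s, p = (vd v a s, hgt v η s)) ∨
      (∃ σ ∈ S, p = (dW v (ex σ), -M)) ∨ (∃ σ ∈ S, p = (-dW v (ex σ), M)) := by
    intro p hp
    rcases Finset.mem_union.1 hp with hp | hp
    · obtain ⟨s, _, rfl⟩ := Finset.mem_image.1 hp
      exact Or.inl ⟨s, rfl⟩
    · rcases Finset.mem_union.1 hp with hp | hp
      · obtain ⟨s, hs, rfl⟩ := Finset.mem_image.1 hp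
        exact Or.inr (Or.inl ⟨s, hs, rfl⟩)
      · obtain ⟨s, hs, rfl⟩ := Finset.mem_image.1 hp
        exact Or.inr (Or.inr ⟨s, hs, rfl⟩)
  have hdW : ∀ s, dW v s ≠ 0 := by
    intro s h
    have h1 := congrFun h j0
    have h2 := sv_abs s j0
    simp only [dW, hj0, if_false, Pi.zero_apply] at h1
    simp [h1] at h2
  refine ⟨D, ?_, ?_, ?_, ?_, ?_⟩
  · intro p hp h0
    rcases hcases p hp with ⟨s, rfl⟩ | ⟨s, hs, rfl⟩ | ⟨s, hs, rfl⟩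
    · have h1 := congrFun (congrArg Prod.fst h0) v
      have h2 := abs_vd v ha s v
      simp only [Prod.fst_zero, Pi.zero_apply] at h1
      rw [h1] at h2
      simp at h2
      linarith
    · exact hdW _ (congrArg Prod.fst h0)
    · exact hdW _ (neg_eq_zero.1 (congrArg Prod.fst h0))
  · intro p hp
    rcases hcases p hp with ⟨s, rfl⟩ | ⟨s, hs, rfl⟩ | ⟨s, hs, rfl⟩
    · have := m1 (fun i => !s i)
      rw [hgt_not hm] at this
      convert this using 1
      simp only [Prod.neg_mk, Prod.mk.injEq, and_true]
      funext i
      have := congrFun (sv_not s) i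
      simp only [vd, Pi.neg_apply] at this ⊢
      rw [this]; ring
    · rw [Prod.neg_mk, neg_neg]
      exact Finset.mem_union_right _ (Finset.mem_union_right _
        (Finset.mem_image_of_mem (fun σ => (-dW v (ex σ), M)) hs))
    · rw [Prod.neg_mk, neg_neg]
      exact Finset.mem_union_right _ (Finset.mem_union_left _
        (Finset.mem_image_of_mem (fun σ => (dW v (ex σ), -M)) hs))
  · have c1 := Finset.card_image_le (s := S) (f := fun σ => (dW v (ex σ), -M))
    have c2 := Finset.card_image_le (s := S) (f := fun σ => (-dW v (ex σ), M))
    have c3 := Finset.card_image_le (s := (Finset.univ : Finset (ι → Bool)))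
      (f := fun s => (vd v a s, hgt v η s))
    have c4 : (Finset.univ : Finset (ι → Bool)).card = 2 ^ Fintype.card ι := by simp
    have c5 := Finset.card_union_le (S.image (fun σ => (dW v (ex σ), -M)))
      (S.image (fun σ => (-dW v (ex σ), M)))
    have c6 := Finset.card_union_le ((Finset.univ : Finset (ι → Bool)).image
      (fun s => (vd v a s, hgt v η s)))
      (S.image (fun σ => (dW v (ex σ), -M)) ∪ S.image (fun σ => (-dW v (ex σ), M)))
    have c7 : D.card ≤ _ := c6
    obtain ⟨k, hk⟩ : ∃ k, Fintype.card ι = k + 1 := ⟨Fintype.card ι - 1, by omega⟩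
    rw [hk] at c4 cardS ⊢
    simp only [Nat.add_sub_cancel] at cardS
    have : 1 ≤ 2 ^ k := Nat.one_le_two_pow
    rw [pow_succ] at c4
    rw [pow_succ, pow_succ]
    omega
  · intro y hy hfy
    rcases T y hy hfy with ⟨s, hs, h⟩ | ⟨s, hs, h⟩
    · exact ⟨_, m2 s hs, h⟩
    · refine ⟨_, m1 s, ?_⟩
      have : hgt v η s = -η := by
        unfold hgt; rw [if_pos hs]
      dsimp only
      rw [this]; exact h
  · intro y hy hfy
    refine ⟨_, m1 (sgc y), ?_⟩
    refine hf.litZ hy ha ha1 le_rfl zero_lt_one hf.zero ?_ ?_ ?_ ?_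
    · intro i; rw [abs_vd v ha]; split_ifs <;> linarith
    · intro i; rw [abs_vd v ha]; split_ifs <;> linarith
    · intro i
      have h1 := comp_sgc y i
      have h2 : 0 ≤ (if i = v then a else 1) := by split_ifs <;> linarith
      simp only [vd]
      rw [← mul_assoc, h1]
      have := mul_nonneg (abs_nonneg (y i)) h2
      linarith
    · have := abs_hgt v hη (sgc y)
      simp only [sub_zero, mul_one]
      linarith

lemma Prof.case4 (hf : Prof f) (hm : 2 ≤ Fintype.card ι) (v : ι)
    (hv : f (Pi.single v 1) = 0) (hnp : ¬ ∀ y ∈ QQ ι, f y = 1 - |y v|) : AbsGoal f := by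
  have hlt : ∀ y ∈ QQ ι, 0 < f y → |y v| < 1 := by
    intro y hy hfy
    refine lt_of_le_of_ne (hy v) ?_
    intro h
    have := hf.mono (Pi.single v 1) y hy (by
      intro i
      by_cases hi : i = v
      · subst hi; simp [h]
      · simp [hi])
    linarith
  -- the reductions
  have red : ∀ (a η M : ℝ), 0 < a → a ≤ 1 → 0 < η → η < a → 2 ≤ M →
      (∀ y ∈ QQ ι, 0 < f y → (∀ j, j ≠ v → 0 < y j) → y v = 0 →
        (∃ s, (∃ j, j ≠ v ∧ s j = true) ∧ Lit f y (dW v s) (-M)) ∨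
        Lit f y (vd v a (sgc y)) (-η)) → AbsGoal f := by
    intro a η M ha ha1 hη hηa hM hT
    refine hf.absGoal4 hm v (M := M) ha ha1 hη.le hηa ?_
    intro y hy hfy
    have hyv := hlt y hy hfy
    by_cases hex : ∃ j, j ≠ v ∧ y j ≤ 0
    · left
      obtain ⟨j, hj, hyj⟩ := hex
      set s : ι → Bool := fun i => decide (y i ≤ 0) with hs
      have hcs : Comp y s := by
        intro i
        by_cases h : y i ≤ 0
        · simp [hs, sv, h, abs_of_nonpos h]
        · simp [hs, sv, h, abs_of_pos (not_le.1 h)]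
      refine ⟨s, ⟨j, hj, by simp [hs, hyj]⟩, ?_⟩
      set p : ι → ℝ := fun i => if i ≠ v ∧ y i = 0 then sv s i else y i with hp
      have hpm : p ∈ QQ ι := by
        intro i; simp only [hp]; split_ifs
        · rw [sv_abs]
        · exact hy i
      refine hf.lit (p := p) (q := y) (K := 1) (L := 0) hy hpm hy zero_le_one le_rfl ?_ ?_ ?_ ?_
      · intro i hi
        have hiv : i ≠ v := by rintro rfl; linarith
        simp only [dW, hiv, if_false]
        exact hcs.in_ i hi
      · intro i
        by_cases hiv : i = v
        · simp [dW, hiv, hp]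
        · by_cases h0 : y i = 0
          · simp [h0]
          · simp only [dW, hiv, if_false]
            rw [hcs i]; simp [hp, h0]
      · intro i h0
        by_cases hiv : i = v
        · simp [dW, hiv]
        · simp [dW, hiv, hp, h0]
      · have := hf.nonneg _ hpm
        have := hf.le_one hy
        linarith
    · push Not at hex
      by_cases h0 : y v = 0
      · rcases hT y hy hfy hex h0 with h | h
        · exact Or.inl h
        · refine Or.inr ⟨_, ?_, h⟩
          intro j hj
          simp [sgc, (hex j hj).le]
      · right
        refine ⟨sgc y, ?_, ?_⟩
        · intro j hj
          simp [sgc, (hex j hj).le]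
        have h2 : ∀ i, 0 < (if i = v then a else 1) := by intro i; split_ifs <;> linarith
        refine hf.lit (p := y) (q := y) (K := 0) (L := 0) hy hy hy le_rfl le_rfl ?_ ?_ ?_ ?_
        · intro i hi
          simp only [vd]
          rw [← mul_assoc, comp_sgc y i, hi]
          linarith [h2 i]
        · intro i
          simp only [vd]
          rw [← mul_assoc, comp_sgc y i]
          have := mul_nonneg (abs_nonneg (y i)) (h2 i).le
          linarith
        · intro i hi
          exfalso
          by_cases hiv : i = v
          · subst hiv; exact h0 hi
          · have := hex i hiv; linarith
        · linarith
  set w : ι → ℝ := fun i => if i = v then 0 else 1 with hw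
  have hwm : w ∈ QQ ι := by
    intro i; simp only [hw]; split_ifs <;> simp
  rcases (hf.le_one hwm).eq_or_lt with hw1 | hw1
  · -- flat case
    push Not at hnp
    obtain ⟨y, hy, hyne⟩ := hnp
    have m1 : (fun _ => (1:ℝ)) ∈ QQ ι := by intro i; simp
    have hge : 1 - |y v| ≤ f y := by
      have h1 := hf.combo hwm m1 (abs_nonneg (y v)) (hy v)
      have h2 := hf.nonneg _ m1
      have h3 := mul_nonneg (abs_nonneg (y v)) h2
      have h4 := hf.mono y ((1 - |y v|) • w + |y v| • (fun _ => (1:ℝ)))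
        (hf.conc.1 hwm m1 (by linarith [hy v]) (abs_nonneg _) (by ring)) (by
          intro i
          by_cases hi : i = v
          · subst hi; simp [hw]
          · simp [hw, hi]; exact hy i)
      rw [hw1] at h1
      linarith
    have hgt : 1 - |y v| < f y := lt_of_le_of_ne hge (Ne.symm hyne)
    have hy1 := hf.le_one hy
    set a := |y v| with ha
    have ha0 : 0 < a := by linarith
    have haa : |a| = a := abs_of_pos ha0
    have hφ : f y ≤ f (Pi.single v a) := by
      apply hf.mono _ _ hy
      intro i
      by_cases hi : i = v
      · subst hi; simp [haa, ha]
      · simp [hi]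
    have hφ1 : f (Pi.single v a) ≤ 1 := hf.le_one (single_mem_QQ v (by rw [haa]; exact hy v))
    refine red a ((1 - f (Pi.single v a) + a) / 2) 2 ha0 (hy v) (by linarith) (by linarith) le_rfl ?_
    intro z hz hfz hzp hz0
    right
    have hpm : Pi.single v (a * sv (sgc z) v) ∈ QQ ι := single_mem_QQ v (by
      rw [abs_mul, sv_abs, haa, mul_one]; exact hy v)
    have hpf : f (Pi.single v a) ≤ f (Pi.single v (a * sv (sgc z) v)) := by
      apply hf.mono _ _ (single_mem_QQ v (by rw [haa]; exact hy v))
      intro i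
      by_cases hi : i = v
      · subst hi; simp [abs_mul, sv_abs]
      · simp [hi]
    refine hf.lit (p := Pi.single v (a * sv (sgc z) v)) (q := z) (K := 1) (L := 0) hz hpm hz
      zero_le_one le_rfl ?_ ?_ ?_ ?_
    · intro i hi
      have hiv : i ≠ v := by rintro rfl; rw [hz0] at hi; simp at hi
      simp only [vd, hiv, if_false, mul_one]
      exact (comp_sgc z).in_ i hi
    · intro i
      by_cases hiv : i = v
      · subst hiv; simp [hz0]
      · simp only [vd, hiv, if_false, mul_one]
        rw [comp_sgc z i]; simp [hiv]
        exact abs_mul_self_le (hz i)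
    · intro i hi
      have hiv : i = v := by
        by_contra h
        have := hzp i h
        linarith
      subst hiv
      simp [vd, abs_mul, mul_comm]
    · have := hf.le_one hz
      linarith
  · obtain ⟨r, hr0, hr1, hr⟩ := hf.rad w hwm ((1 + f w) / 2) (by linarith)
    have hw0 := hf.nonneg w hwm
    have hc : 0 < 1 - r := by linarith
    refine red 1 ((1 + f w) / 2) (max 2 (1 / (1 - r)) + 1) zero_lt_one le_rfl (by linarith)
      (by linarith) (by linarith [le_max_left 2 (1 / (1 - r))]) ?_
    intro y hy hfy hyp hy0
    rcases lt_or_ge (f y) ((1 + f w) / 2) with hlt1 | hge1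
    · right
      have : vd v 1 (sgc y) = sv (sgc y) := by
        funext i; simp [vd]
      rw [this]
      exact hf.lit_comp hy (comp_sgc y) hlt1
    · left
      have hj : ∃ j, j ≠ v ∧ y j < r := by
        by_contra hcon
        push Not at hcon
        have := hf.mono (r • w) y hy (by
          intro i
          by_cases hi : i = v
          · simp [hw, hi]
          · simp [hw, hi, abs_of_nonneg hr0]
            exact (hcon i hi).trans (le_abs_self _))
        linarith
      obtain ⟨j, hjv, hjr⟩ := hj
      have hyj := hyp j hjv
      refine ⟨fun i => decide (i = j), ⟨j, hjv, by simp⟩, ?_⟩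
      have hpm : Function.update y j (y j + (1 - r)) ∈ QQ ι := by
        intro i
        by_cases hij : i = j
        · subst hij
          simp only [Function.update_self]
          rw [abs_of_pos (by linarith)]; linarith
        · simpa [hij] using hy i
      refine hf.lit (p := Function.update y j (y j + (1 - r))) (q := y) (K := 1 / (1 - r)) (L := 0)
        hy hpm hy (by positivity) le_rfl ?_ ?_ ?_ ?_
      · intro i hi
        have hiv : i ≠ v := by rintro rfl; rw [hy0] at hi; simp at hi
        have hp := hyp i hiv
        have hij : i ≠ j := by rintro rfl; rw [abs_of_pos hp] at hi; linarith
        simp [dW, hiv, sv, hij, hp]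
      · intro i
        by_cases hiv : i = v
        · subst hiv; simp [hy0]
        · by_cases hij : i = j
          · subst hij
            simp [dW, hiv, sv]
            field_simp
            simp
          · have := hyp i hiv
            simp [dW, hiv, sv, hij, this.le]
      · intro i hi
        have hiv : i = v := by
          by_contra h
          have := hyp i h
          linarith
        simp [dW, hiv]
        positivity
      · have h2 := hf.nonneg _ hpm
        have h3 := hf.le_one hy
        have hk : 0 < 1 / (1 - r) := by positivity
        have h4 := le_max_right 2 (1 / (1 - r))
        have h5 := mul_nonneg hk.le h2
        nlinarith

lemma Prof.main (hf : Prof f) (hm : 2 ≤ Fintype.card ι) (h1 : f (fun _ => 1) < 1)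
    (hnp : ∀ v, ¬ ∀ y ∈ QQ ι, f y = 1 - |y v|) : AbsGoal f := by
  have hne : Nonempty ι := Fintype.card_pos_iff.1 (by omega)
  have hs : ∀ j : ι, Pi.single j (1:ℝ) ∈ QQ ι := fun j => single_mem_QQ j (by simp)
  by_cases h4 : ∃ v, f (Pi.single v 1) = 0
  · obtain ⟨v, hv⟩ := h4
    exact hf.case4 hm v hv (hnp v)
  push Not at h4
  by_cases h3 : ∃ v v', v ≠ v' ∧ f (Pi.single v 1) < 1 ∧ f (Pi.single v' 1) < 1
  · obtain ⟨v, v', h, a, b⟩ := h3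
    exact hf.case3 hm h a b
  push Not at h3
  have hpos : ∀ v, 0 < f (Pi.single v 1) := fun v =>
    lt_of_le_of_ne (hf.nonneg _ (hs v)) (Ne.symm (h4 v))
  by_cases h2 : ∃ v, f (Pi.single v 1) < 1
  · obtain ⟨v, hv⟩ := h2
    exact hf.case2 hm h1 v (hpos v) (fun j hj => le_antisymm (hf.le_one (hs j))
      (h3 v j hj.symm hv))
  · push Not at h2
    obtain ⟨v⟩ := hne
    exact hf.case2 hm h1 v (hpos v) (fun j _ => le_antisymm (hf.le_one (hs j)) (h2 j))

end abs

section trans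
variable {n : ℕ} {B : Set (Fin n → ℝ)}

/-- embedding of graph coordinates -/
def emb {n : ℕ} (i₀ : Fin n) (y : {j : Fin n // j ≠ i₀} → ℝ) (t : ℝ) : Fin n → ℝ :=
  fun j => if h : j = i₀ then t else y ⟨j, h⟩

/-- the profile of the body -/
noncomputable def prf (B : Set (Fin n → ℝ)) (i₀ : Fin n) (y : {j : Fin n // j ≠ i₀} → ℝ) : ℝ :=
  sSup {t | emb i₀ y t ∈ B}

lemma emb_self (i₀ : Fin n) (y : {j : Fin n // j ≠ i₀} → ℝ) (t : ℝ) : emb i₀ y t i₀ = t := by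
  simp [emb]

lemma emb_ne (i₀ : Fin n) (y : {j : Fin n // j ≠ i₀} → ℝ) (t : ℝ) (j : {j : Fin n // j ≠ i₀}) :
    emb i₀ y t j = y j := by
  simp [emb, j.2]

lemma emb_eta (i₀ : Fin n) (x : Fin n → ℝ) : emb i₀ (fun j => x j) (x i₀) = x := by
  funext j
  by_cases h : j = i₀
  · subst h; simp [emb]
  · simp [emb, h]

lemma emb_combo (i₀ : Fin n) (y z : {j : Fin n // j ≠ i₀} → ℝ) (t u a b : ℝ) :
    a • emb i₀ y t + b • emb i₀ z u = emb i₀ (a • y + b • z) (a * t + b * u) := by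
  funext j
  by_cases h : j = i₀
  · subst h; simp [emb]
  · simp [emb, h]

lemma emb_abs {i₀ : Fin n} {y z : {j : Fin n // j ≠ i₀} → ℝ} {t u : ℝ}
    (h1 : ∀ j, |y j| ≤ |z j|) (h2 : |t| ≤ |u|) : ∀ j, |emb i₀ y t j| ≤ |emb i₀ z u j| := by
  intro j
  by_cases h : j = i₀
  · subst h; simpa [emb] using h2
  · simpa [emb, h] using h1 ⟨j, h⟩

lemma dom_mem (hc : Convex ℝ B) (hu : Unconditional B) {a b : Fin n → ℝ} (hb : b ∈ B)
    (hab : ∀ i, |a i| ≤ |b i|) : a ∈ B := by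
  have h1 : (Set.univ.pi (fun i => ({b i, -b i} : Set ℝ))) ⊆ B := by
    intro x hx
    have hx' : ∀ i, x i = b i ∨ x i = -b i := by
      intro i; simpa using hx i (Set.mem_univ i)
    have := hu b hb (fun i => if x i = b i then 1 else -1) (by intro i; split_ifs <;> simp)
    convert this using 1
    funext i
    by_cases h : x i = b i
    · simp [h]
    · rcases hx' i with h' | h'
      · exact absurd h' h
      · rw [if_neg h, h']; ring
  have h2 := convexHull_min h1 hc
  rw [convexHull_pi] at h2
  apply h2
  intro i _
  change a i ∈ convexHull ℝ ({b i, -b i} : Set ℝ)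
  rw [convexHull_pair, segment_eq_uIcc, Set.mem_uIcc]
  have h3 := abs_le.1 (hab i)
  rcases abs_cases (b i) with ⟨h, _⟩ | ⟨h, _⟩
  · right; rw [h] at h3; exact h3
  · left; rw [h] at h3; constructor <;> linarith [h3.1, h3.2]

lemma zero_int (hB : memU B) : (0 : Fin n → ℝ) ∈ interior B := by
  obtain ⟨⟨hc, _, z, hz⟩, hu, _⟩ := hB
  have h1 : -z ∈ B := dom_mem hc hu (interior_subset hz) (by intro i; simp)
  have := hc.combo_interior_self_mem_interior hz h1 (by norm_num : (0:ℝ) < 1/2)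
    (by norm_num : (0:ℝ) ≤ 1/2) (by norm_num)
  simpa using this

lemma scale_int (hB : memU B) {x : Fin n → ℝ} {c : ℝ} (hc : 1 < c) (hx : c • x ∈ B) :
    x ∈ interior B := by
  have hpos : 0 < c := by linarith
  have h1 : 0 < 1 - c⁻¹ := by
    rw [sub_pos]; exact inv_lt_one_of_one_lt₀ hc
  have := hB.1.1.combo_self_interior_mem_interior hx (zero_int hB) (inv_nonneg.2 hpos.le) h1
    (by ring)
  rw [smul_smul, inv_mul_cancel₀ hpos.ne'] at this
  simpa using this

lemma cube (hB : memU B) {x : Fin n → ℝ} (hx : x ∈ B) (i : Fin n) : |x i| ≤ 1 := by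
  by_contra hcon
  push Not at hcon
  have h1 : |x i| • stdB i ∈ B := dom_mem hB.1.1 hB.2.1 hx (by
    intro j
    by_cases h : j = i
    · subst h; simp [stdB]
    · simp [stdB, h])
  have h2 := scale_int hB hcon h1
  exact (hB.2.2 i).2 h2

lemma Bclosed (hB : memU B) : IsClosed B := hB.1.2.1.isClosed

section
variable {i₀ : Fin n}

lemma emb_zero_mem (hB : memU B) (hi : allOnes - stdB i₀ ∈ B) {y : {j : Fin n // j ≠ i₀} → ℝ}
    (hy : y ∈ QQ _) : emb i₀ y 0 ∈ B := by
  apply dom_mem hB.1.1 hB.2.1 hi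
  intro j
  by_cases h : j = i₀
  · subst h; simp [emb]
  · simpa [emb, h, allOnes, stdB] using hy ⟨j, h⟩

lemma emb_QQ (hB : memU B) {y : {j : Fin n // j ≠ i₀} → ℝ} {t : ℝ} (h : emb i₀ y t ∈ B) :
    y ∈ QQ _ := by
  intro j
  have := cube hB h j
  rwa [emb_ne] at this

lemma prf_bdd (hB : memU B) (y : {j : Fin n // j ≠ i₀} → ℝ) : BddAbove {t | emb i₀ y t ∈ B} := by
  refine ⟨1, fun t ht => ?_⟩
  have := cube hB ht i₀
  rw [emb_self] at this
  exact (le_abs_self _).trans this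

lemma emb_cont (i₀ : Fin n) : Continuous (fun p : ({j : Fin n // j ≠ i₀} → ℝ) × ℝ =>
    emb i₀ p.1 p.2) := by
  apply continuous_pi
  intro j
  by_cases h : j = i₀
  · subst h; simp [emb]; fun_prop
  · simp [emb, h]; fun_prop

lemma emb_prf_mem (hB : memU B) (hi : allOnes - stdB i₀ ∈ B) {y : {j : Fin n // j ≠ i₀} → ℝ}
    (hy : y ∈ QQ _) : emb i₀ y (prf B i₀ y) ∈ B := by
  have hcl : IsClosed {t | emb i₀ y t ∈ B} := by
    have : Continuous (fun t : ℝ => emb i₀ y t) :=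
      (emb_cont i₀).comp (by fun_prop : Continuous (fun t : ℝ => (y, t)))
    exact (Bclosed hB).preimage this
  exact hcl.csSup_mem ⟨0, emb_zero_mem hB hi hy⟩ (prf_bdd hB y)

lemma emb_mem_iff (hB : memU B) (hi : allOnes - stdB i₀ ∈ B) {y : {j : Fin n // j ≠ i₀} → ℝ}
    {t : ℝ} : emb i₀ y t ∈ B ↔ y ∈ QQ _ ∧ |t| ≤ prf B i₀ y := by
  constructor
  · intro h
    refine ⟨emb_QQ hB h, ?_⟩
    apply le_csSup (prf_bdd hB y)
    exact dom_mem hB.1.1 hB.2.1 h (emb_abs (fun _ => le_rfl) (by simp))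
  · rintro ⟨hy, ht⟩
    exact dom_mem hB.1.1 hB.2.1 (emb_prf_mem hB hi hy)
      (emb_abs (fun _ => le_rfl) (ht.trans (le_abs_self _)))

lemma prf_le (hB : memU B) (hi : allOnes - stdB i₀ ∈ B) {y : {j : Fin n // j ≠ i₀} → ℝ}
    {t : ℝ} (h : emb i₀ y t ∈ B) : t ≤ prf B i₀ y :=
  (le_abs_self t).trans ((emb_mem_iff hB hi).1 h).2

lemma prof_prf (hB : memU B) (hi : allOnes - stdB i₀ ∈ B) : Prof (prf B i₀) := by
  have hnn : ∀ y ∈ QQ {j : Fin n // j ≠ i₀}, 0 ≤ prf B i₀ y := fun y hy =>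
    prf_le hB hi (emb_zero_mem hB hi hy)
  refine ⟨⟨?_, ?_⟩, ?_, ?_, hnn, ?_⟩
  · intro y hy z hz a b ha hb hab i
    have h1 := abs_le.1 (hy i)
    have h2 := abs_le.1 (hz i)
    simp only [Pi.add_apply, Pi.smul_apply, smul_eq_mul]
    rw [abs_le]; constructor <;> nlinarith
  · intro y hy z hz a b ha hb hab
    have h := hB.1.1 (emb_prf_mem hB hi hy) (emb_prf_mem hB hi hz) ha hb hab
    rw [emb_combo] at h
    exact prf_le hB hi h
  · intro a b hb hab
    exact prf_le hB hi (dom_mem hB.1.1 hB.2.1 (emb_prf_mem hB hi hb) (emb_abs hab le_rfl))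
  · apply le_antisymm
    · have := cube hB (emb_prf_mem hB hi (y := 0) (by intro i; simp)) i₀
      rw [emb_self] at this
      exact (le_abs_self _).trans this
    · apply prf_le hB hi
      have h1 : stdB i₀ ∈ B := (Bclosed hB).frontier_subset (hB.2.2 i₀)
      convert h1 using 1
      funext j
      by_cases h : j = i₀
      · subst h; simp [emb, stdB]
      · simp [emb, stdB, h]
  · intro u hu c hc
    by_contra hcon
    push Not at hcon
    have hc0 : 0 ≤ c := (hnn u hu).trans hc.le
    have hcl : IsClosed {r : ℝ | emb i₀ (r • u) c ∈ B} := by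
      have : Continuous (fun r : ℝ => emb i₀ (r • u) c) :=
        (emb_cont i₀).comp (by fun_prop : Continuous (fun r : ℝ => (r • u, c)))
      exact (Bclosed hB).preimage this
    have hsub : Set.Ico (0:ℝ) 1 ⊆ {r : ℝ | emb i₀ (r • u) c ∈ B} := by
      intro r hr
      refine (emb_mem_iff hB hi).2 ⟨?_, ?_⟩
      · intro i
        simp only [Pi.smul_apply, smul_eq_mul, abs_mul, abs_of_nonneg hr.1]
        nlinarith [hu i, hr.1, hr.2, abs_nonneg (u i)]
      · rw [abs_of_nonneg hc0]; exact hcon r hr.1 hr.2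
    have h1 := closure_minimal hsub hcl
    rw [closure_Ico (by norm_num)] at h1
    have h2 := h1 (⟨zero_le_one, le_rfl⟩ : (1:ℝ) ∈ Set.Icc (0:ℝ) 1)
    simp only [Set.mem_setOf_eq, one_smul] at h2
    have := prf_le hB hi h2
    linarith

lemma int_of (hB : memU B) (hi : allOnes - stdB i₀ ∈ B) {z : {j : Fin n // j ≠ i₀} → ℝ} {τ : ℝ}
    (hz : ∀ i, |z i| < 1) (hτ : |τ| < prf B i₀ z) : emb i₀ z τ ∈ interior B := by
  have hf := prof_prf hB hi
  have hzm : z ∈ QQ _ := fun i => (hz i).le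
  have hN : ‖z‖ < 1 := (pi_norm_lt_iff zero_lt_one).2 hz
  have hN0 := norm_nonneg z
  have hzi : ∀ i, |z i| ≤ ‖z‖ := fun i => norm_le_pi_norm z i
  set θ := (prf B i₀ z - |τ|) / 2 with hθ
  have h1 := hf.le_one hzm
  have hτ0 := abs_nonneg τ
  have hθ0 : 0 < θ := by rw [hθ]; linarith
  have hθ1 : θ ≤ 1 := by rw [hθ]; linarith
  have hwm : (2 - ‖z‖) • z ∈ QQ _ := by
    intro i
    simp only [Pi.smul_apply, smul_eq_mul, abs_mul]
    rw [abs_of_pos (by linarith)]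
    nlinarith [hzi i, abs_nonneg (z i)]
  have h2 := hf.combo hzm hwm hθ0.le hθ1
  have hcm := hf.conc.1 hzm hwm (by linarith : 0 ≤ 1 - θ) hθ0.le (by ring)
  have h3 := hf.nonneg _ hwm
  have hc : (1 - θ) • z + θ • (2 - ‖z‖) • z = (1 + θ * (1 - ‖z‖)) • z := by
    funext i; simp; ring
  rw [hc] at h2 hcm
  have hpos : 0 < θ * (1 - ‖z‖) := mul_pos hθ0 (by linarith)
  refine scale_int hB (c := 1 + θ * (1 - ‖z‖)) (by linarith) ?_
  have h4 : (1 + θ * (1 - ‖z‖)) • emb i₀ z τ =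
      emb i₀ ((1 + θ * (1 - ‖z‖)) • z) ((1 + θ * (1 - ‖z‖)) * τ) := by
    have := emb_combo i₀ z z τ τ (1 + θ * (1 - ‖z‖)) 0
    simpa using this
  rw [h4, emb_mem_iff hB hi]
  refine ⟨hcm, ?_⟩
  rw [abs_mul, abs_of_pos (by linarith)]
  have h5 := mul_nonneg hθ0.le h3
  have h6 : θ * (1 - ‖z‖) * |τ| ≤ θ * |τ| := by
    have := mul_nonneg (mul_nonneg hθ0.le hN0) hτ0
    nlinarith
  have h7 : 2 * θ = prf B i₀ z - |τ| := by rw [hθ]; ring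
  have h8 : θ * |τ| ≤ θ := by nlinarith
  have h9 : θ * prf B i₀ z ≤ θ := by nlinarith
  nlinarith

/-- illumination in graph coordinates -/
def LitD {ι : Type} (f : (ι → ℝ) → ℝ) (y d : ι → ℝ) (t h : ℝ) : Prop :=
  ∃ ε : ℝ, 0 < ε ∧ (∀ i, |y i + ε * d i| < 1) ∧ |t + ε * h| < f (y + ε • d)

lemma Prof.litD {ι : Type} [Fintype ι] [DecidableEq ι] {f : (ι → ℝ) → ℝ} (hf : Prof f)
    {y d : ι → ℝ} {t h : ℝ} (hy : y ∈ QQ ι)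
    (hfy : 0 < f y) (ht0 : 0 ≤ t) (ht : t ≤ f y) (hl : Lit f y d h) : LitD f y d t h := by
  obtain ⟨ε, hε, h1, h2⟩ := hl
  have hden : 0 < f y + ε * |h| + 1 := by positivity
  obtain ⟨θ, hθ⟩ : ∃ θ, θ = f y / (f y + ε * |h| + 1) := ⟨_, rfl⟩
  have hθ0 : 0 < θ := by rw [hθ]; positivity
  have hθe : θ * (f y + ε * |h| + 1) = f y := by rw [hθ]; field_simp
  have hθ1 : θ < 1 := by
    rw [hθ, div_lt_one hden]
    have : 0 ≤ ε * |h| := by positivity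
    linarith
  have hwm : y + ε • d ∈ QQ ι := fun i => by simpa using (h1 i).le
  have h3 := hf.combo hy hwm hθ0.le hθ1.le
  have hz : (1 - θ) • y + θ • (y + ε • d) = y + (θ * ε) • d := by
    funext i; simp; ring
  rw [hz] at h3
  refine ⟨θ * ε, by positivity, ?_, ?_⟩
  · intro i
    have a1 := abs_le.1 (hy i)
    have a2 := abs_lt.1 (h1 i)
    rw [abs_lt]
    constructor <;> nlinarith
  · have h4 := mul_lt_mul_of_pos_left h2 hθ0
    have h5 := hf.nonneg _ hwm
    have h6 := mul_nonneg hθ0.le h5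
    have h7 : -(θ * ε * h) ≤ θ * (ε * |h|) := by
      have := mul_le_mul_of_nonneg_left (neg_abs_le h) (by positivity : 0 ≤ θ * ε)
      nlinarith
    rw [abs_lt]
    constructor <;> nlinarith

lemma par_cube (hB : memU B) (hi : allOnes - stdB i₀ ∈ B) (h : prf B i₀ (fun _ => 1) = 1) :
    IsParallelepiped B := by
  refine ⟨AffineEquiv.refl ℝ _, ?_⟩
  ext x
  simp only [AffineEquiv.coe_refl, Set.image_id, Set.mem_Icc, Pi.le_def]
  constructor
  · intro hx
    exact ⟨fun i => (abs_le.1 (cube hB hx i)).1, fun i => (abs_le.1 (cube hB hx i)).2⟩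
  · rintro ⟨h1, h2⟩
    have h3 := emb_prf_mem hB hi (y := fun _ => 1) (by intro i; simp)
    rw [h] at h3
    apply dom_mem hB.1.1 hB.2.1 h3
    intro i
    have : emb i₀ (fun _ => 1) 1 i = 1 := by simp [emb]
    rw [this, abs_one, abs_le]
    exact ⟨h1 i, h2 i⟩

/-- the rotation in the plane of `v`, `i₀` -/
noncomputable def rotE {n : ℕ} (i₀ v : Fin n) (hv : v ≠ i₀) : (Fin n → ℝ) ≃ₗ[ℝ] (Fin n → ℝ) where
  toFun x := fun j => if j = v then (x v + x i₀) / 2 else if j = i₀ then (x v - x i₀) / 2 else x j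
  invFun x := fun j => if j = v then x v + x i₀ else if j = i₀ then x v - x i₀ else x j
  map_add' x y := by
    funext j; simp only [Pi.add_apply]; split_ifs <;> ring
  map_smul' c x := by
    funext j; simp only [Pi.smul_apply, smul_eq_mul, RingHom.id_apply]; split_ifs <;> ring
  left_inv x := by
    funext j
    by_cases h : j = v
    · subst h; simp [hv.symm]; ring
    · by_cases h' : j = i₀
      · subst h'; simp [h]; ring
      · simp [h, h']
  right_inv x := by
    funext j
    by_cases h : j = v
    · subst h; simp [hv.symm]
    · by_cases h' : j = i₀
      · subst h'; simp [h]
      · simp [h, h']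

lemma rot_abs {a b : ℝ} : (|a + b| ≤ 1 ∧ |a - b| ≤ 1) ↔ |a| + |b| ≤ 1 := by
  constructor
  · rintro ⟨h1, h2⟩
    rw [abs_le] at h1 h2
    rcases abs_cases a with ⟨h, _⟩ | ⟨h, _⟩ <;> rcases abs_cases b with ⟨h', _⟩ | ⟨h', _⟩ <;>
      rw [h, h'] <;> linarith [h1.1, h1.2, h2.1, h2.2]
  · intro h
    exact ⟨(abs_add_le _ _).trans h, (abs_sub _ _).trans h⟩

lemma par_rot (hB : memU B) (hi : allOnes - stdB i₀ ∈ B) (v : {j : Fin n // j ≠ i₀})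
    (h : ∀ y ∈ QQ _, prf B i₀ y = 1 - |y v|) : IsParallelepiped B := by
  refine ⟨(rotE i₀ v v.2).toAffineEquiv, ?_⟩
  have hmem : ∀ x, x ∈ B ↔ (∀ j, j ≠ i₀ → |x j| ≤ 1) ∧ |x v| + |x i₀| ≤ 1 := by
    intro x
    have := emb_mem_iff hB hi (y := fun j => x j) (t := x i₀)
    rw [emb_eta] at this
    rw [this]
    constructor
    · rintro ⟨h1, h2⟩
      rw [h _ h1] at h2
      exact ⟨fun j hj => h1 ⟨j, hj⟩, by linarith⟩
    · rintro ⟨h1, h2⟩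
      have h3 : (fun j : {j : Fin n // j ≠ i₀} => x j) ∈ QQ _ := fun j => h1 j j.2
      refine ⟨h3, ?_⟩
      rw [h _ h3]; linarith
  have hv := v.2
  ext x
  rw [hmem, Set.mem_image]
  constructor
  · rintro ⟨h1, h2⟩
    refine ⟨(rotE i₀ v v.2).symm x, ?_, (rotE i₀ v v.2).apply_symm_apply x⟩
    have h3 := rot_abs.2 h2
    have key : ∀ j, |(rotE i₀ v v.2).symm x j| ≤ 1 := by
      intro j
      change |if j = v then x v + x i₀ else if j = i₀ then x v - x i₀ else x j| ≤ 1
      split_ifs with a b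
      · exact h3.1
      · exact h3.2
      · exact h1 j b
    exact ⟨fun j => (abs_le.1 (key j)).1, fun j => (abs_le.1 (key j)).2⟩
  · rintro ⟨w, hw, rfl⟩
    have hw' : ∀ j, |w j| ≤ 1 := fun j => abs_le.2 ⟨hw.1 j, hw.2 j⟩
    have e : ∀ j, (rotE i₀ v v.2).toAffineEquiv w j =
        if j = v then (w v + w i₀) / 2 else if j = i₀ then (w v - w i₀) / 2 else w j := fun j => rfl
    have ev : (rotE i₀ v v.2).toAffineEquiv w v = (w v + w i₀) / 2 := by rw [e]; simp
    have ei : (rotE i₀ v v.2).toAffineEquiv w i₀ = (w v - w i₀) / 2 := by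
      rw [e]; simp [hv.symm]
    have h4 : |(w v + w i₀) / 2| + |(w v - w i₀) / 2| ≤ 1 := by
      apply rot_abs.1
      constructor
      · convert hw' v using 2; ring
      · convert hw' i₀ using 2; ring
    constructor
    · intro j hj
      by_cases hjv : j = v
      · rw [hjv, ev]
        linarith [abs_nonneg ((w v - w i₀) / 2)]
      · rw [e]; simp only [hjv, hj, if_false]; exact hw' j
    · rw [ev, ei]; exact h4

end
end trans

/-- If `B ∈ 𝒰^n`, `n ≥ 3`, contains `𝟙 - e_{i₀}` for some `i₀`,
and `B` is not a parallelepiped, then `𝕀(B) ≤ 2^n - 2`, witnessed by a symmetric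
set of nonzero directions. -/
theorem stmt1 (n : ℕ) (hn : 3 ≤ n) (B : Set (Fin n → ℝ)) (hB : memU B)
    (hsub : ∃ i₀ : Fin n, allOnes - stdB i₀ ∈ B)
    (hpar : ¬ IsParallelepiped B) :
    illumNumber B ≤ 2 ^ n - 2 ∧
      ∃ D : Finset (Fin n → ℝ), (∀ d ∈ D, d ≠ 0) ∧ (∀ d ∈ D, -d ∈ D) ∧
        D.card ≤ 2 ^ n - 2 ∧ IlluminatesSet B ↑D := by
  classical
  suffices hD : ∃ D : Finset (Fin n → ℝ), (∀ d ∈ D, d ≠ 0) ∧ (∀ d ∈ D, -d ∈ D) ∧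
        D.card ≤ 2 ^ n - 2 ∧ IlluminatesSet B ↑D by
    refine ⟨?_, hD⟩
    obtain ⟨D, h1, _, h3, h4⟩ := hD
    refine le_trans (Nat.sInf_le (m := D.card) ?_) h3
    exact ⟨D, rfl, h1, h4⟩
  obtain ⟨i₀, hi⟩ := hsub
  have hf := prof_prf hB hi
  have hcard : Fintype.card {j : Fin n // j ≠ i₀} = n - 1 := by
    simp [Fintype.card_subtype_compl]
  have m1 : (fun _ => (1:ℝ)) ∈ QQ {j : Fin n // j ≠ i₀} := by intro i; simp
  have h1 : prf B i₀ (fun _ => 1) < 1 :=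
    lt_of_le_of_ne (hf.le_one m1) (fun h => hpar (par_cube hB hi h))
  obtain ⟨D, hD0, hDn, hDc, hDT, hDZ⟩ := hf.main (by omega) h1
    (fun v h => hpar (par_rot hB hi v h))
  have hneg : ∀ (y : {j : Fin n // j ≠ i₀} → ℝ) (t : ℝ), -emb i₀ y t = emb i₀ (-y) (-t) := by
    intro y t
    have := emb_combo i₀ y y t t (-1) 0
    simpa using this
  refine ⟨D.image (fun p => emb i₀ p.1 p.2), ?_, ?_, ?_, ?_⟩
  · intro d hd h0
    obtain ⟨p, hp, rfl⟩ := Finset.mem_image.1 hd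
    apply hD0 p hp
    ext j
    · have := congrFun h0 j
      rw [emb_ne] at this
      simpa using this
    · have := congrFun h0 i₀
      rw [emb_self] at this
      simpa using this
  · intro d hd
    obtain ⟨p, hp, rfl⟩ := Finset.mem_image.1 hd
    rw [hneg]
    exact Finset.mem_image.2 ⟨-p, hDn p hp, rfl⟩
  · refine Finset.card_image_le.trans (hDc.trans ?_)
    rw [hcard, Nat.sub_add_cancel (by omega)]
  · intro x hx
    have hxB : x ∈ B := (Bclosed hB).frontier_subset hx
    have hxe := emb_eta i₀ x
    set y : {j : Fin n // j ≠ i₀} → ℝ := fun j => x j with hy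
    set t := x i₀ with ht
    rw [← hxe] at hxB
    obtain ⟨hyQ, hty⟩ := (emb_mem_iff hB hi).1 hxB
    suffices hs : ∃ p ∈ D, LitD (prf B i₀) y p.1 t p.2 by
      obtain ⟨p, hp, ε, hε, a1, a2⟩ := hs
      refine ⟨emb i₀ p.1 p.2, ?_, ε, hε, ?_⟩
      · exact Finset.mem_coe.2 (Finset.mem_image.2 ⟨p, hp, rfl⟩)
      · rw [← hxe]
        have := emb_combo i₀ y p.1 t p.2 1 ε
        rw [one_smul, one_smul, one_mul] at this
        rw [this]
        exact int_of hB hi (by intro i; simpa using a1 i) a2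
    rcases (hf.nonneg y hyQ).eq_or_lt with h0 | h0
    · obtain ⟨p, hp, ε, hε, a1, a2⟩ := hDZ y hyQ h0.symm
      refine ⟨p, hp, ε, hε, a1, ?_⟩
      rw [← h0] at hty
      have : t = 0 := abs_eq_zero.1 (le_antisymm hty (abs_nonneg _))
      rw [this, zero_add, abs_mul, abs_of_pos hε]
      exact a2
    · rcases le_total 0 t with ht0 | ht0
      · obtain ⟨p, hp, hl⟩ := hDT y hyQ h0
        rw [abs_of_nonneg ht0] at hty
        exact ⟨p, hp, hf.litD hyQ h0 ht0 hty hl⟩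
      · have hev : ∀ z ∈ QQ {j : Fin n // j ≠ i₀}, prf B i₀ z ≤ prf B i₀ (-z) := fun z hz =>
          hf.mono _ _ hz (by intro i; simp)
        have hnQ : -y ∈ QQ {j : Fin n // j ≠ i₀} := by intro i; simpa using hyQ i
        obtain ⟨p, hp, hl⟩ := hDT (-y) hnQ (lt_of_lt_of_le h0 (hev y hyQ))
        rw [abs_of_nonpos ht0] at hty
        obtain ⟨ε, hε, a1, a2⟩ := hf.litD (t := -t) hnQ (lt_of_lt_of_le h0 (hev y hyQ))
          (by linarith) (hty.trans (hev y hyQ)) hl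
        refine ⟨-p, hDn p hp, ε, hε, ?_, ?_⟩
        · intro i
          have := a1 i
          rw [← abs_neg] at this
          convert this using 2
          simp; ring
        · have h5 := hev (-y + ε • p.1) (fun i => by simpa using (a1 i).le)
          have h6 : -(-y + ε • p.1) = y + ε • (-p).1 := by
            simp only [Prod.fst_neg]
            funext i; simp; ring
          rw [h6] at h5
          refine lt_of_lt_of_le ?_ h5
          rw [← abs_neg] at a2
          have h7 : t + ε * (-p).2 = -(-t + ε * p.2) := by
            rw [Prod.snd_neg]; ring
          rw [h7]; exact a2
end

section
/- Let n ≥ 4 and let B ∈ 𝒰^n. Suppose that for all 1 ≤ i < j ≤ n the point 𝟙 − e_i − e_j lies in B (equivalently, on ∂B), and suppose B is not a parallelepiped. Then 𝕀(B) ≤ 2^n − 2; moreover, there exists a set D of nonzero directions with D = −D and |D| ≤ 2^n − 2 that illuminates B. -/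
open Set

/-- the sign attached to a boolean -/
def sgn2 (b : Bool) : ℝ := if b then 1 else -1

lemma sgn2_cases (b : Bool) : sgn2 b = 1 ∨ sgn2 b = -1 := by cases b <;> simp [sgn2]

lemma sgn2_not (b : Bool) : sgn2 (!b) = - sgn2 b := by cases b <;> simp [sgn2]

/-- weight -/
def wt {n : ℕ} (t : ℝ) (o : Option (Fin n)) (k : Fin n) : ℝ := if o = some k then t else 1

/-- direction -/
def dirn {n : ℕ} (t : ℝ) (m : (Fin n → Bool) → Option (Fin n)) (s : Fin n → Bool) : Fin n → ℝ :=
  fun k => - (sgn2 (s k) * wt t (m s) k)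

/-- properties of the choice of the scaled coordinate -/
def GoodChoice (n : ℕ) (m : (Fin n → Bool) → Option (Fin n)) : Prop :=
  (∀ s, m (fun k => !(s k)) = m s) ∧
  (∀ i b, m (fun k => if k = i then !b else b) = some i) ∧
  (∀ i j, i ≠ j → ∀ s : Fin n → Bool, ∃ s' : Fin n → Bool,
    (∀ k, k ≠ i → k ≠ j → s' k = s k) ∧ (∃ k l, s' k ≠ s' l) ∧
    (m s' = some i ∨ m s' = some j ∨ (m s' = none ∧ 5 ≤ n)))

/-- the choice in dimension four -/
def m4 (s : Fin 4 → Bool) : Option (Fin 4) :=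
  match (s 0 == s 1), (s 0 == s 2), (s 0 == s 3) with
  | true, true, true => none
  | false, false, false => some 0
  | false, true, true => some 1
  | true, false, true => some 2
  | true, true, false => some 3
  | true, false, false => some 1
  | false, true, false => some 0
  | false, false, true => some 2

lemma good4 : GoodChoice 4 m4 := by
  refine ⟨?_, ?_, ?_⟩
  · intro s
    have e : ∀ a b : Bool, ((!a) == !b) = (a == b) := by decide
    simp only [m4, e]
  · decide
  · intro i j hij s
    have key : ∀ i j : Fin 4, i ≠ j → ∀ a b c d : Bool, ∃ x y : Bool,
        (∃ k l, (fun k => if k = i then x else if k = j then y else ![a,b,c,d] k) k ≠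
          (fun k => if k = i then x else if k = j then y else ![a,b,c,d] k) l) ∧
        (m4 (fun k => if k = i then x else if k = j then y else ![a,b,c,d] k) = some i ∨
         m4 (fun k => if k = i then x else if k = j then y else ![a,b,c,d] k) = some j) := by
      decide
    have hs : ![s 0, s 1, s 2, s 3] = s := by
      ext k; fin_cases k <;> rfl
    obtain ⟨x, y, h1, h2⟩ := key i j hij (s 0) (s 1) (s 2) (s 3)
    rw [hs] at h1 h2
    refine ⟨_, ?_, h1, ?_⟩
    · intro k hki hkj
      simp [hki, hkj]
    · tauto

lemma exists_two_avoid {n : ℕ} (hn : 4 ≤ n) (i j : Fin n) :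
    ∃ p q : Fin n, p ≠ q ∧ p ≠ i ∧ p ≠ j ∧ q ≠ i ∧ q ≠ j := by
  have h : 1 < (({i, j} : Finset (Fin n))ᶜ).card := by
    rw [Finset.card_compl, Fintype.card_fin]
    have := Finset.card_le_two (a := i) (b := j)
    omega
  obtain ⟨p, hp, q, hq, hpq⟩ := Finset.one_lt_card.1 h
  simp at hp hq
  exact ⟨p, q, hpq, hp.1, hp.2, hq.1, hq.2⟩

lemma exists_three_avoid {n : ℕ} (hn : 5 ≤ n) (i j : Fin n) :
    ∃ p q r : Fin n, p ≠ q ∧ p ≠ r ∧ q ≠ r ∧ p ≠ i ∧ p ≠ j ∧ q ≠ i ∧ q ≠ j ∧ r ≠ i ∧ r ≠ j := by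
  have h : 2 < (({i, j} : Finset (Fin n))ᶜ).card := by
    rw [Finset.card_compl, Fintype.card_fin]
    have := Finset.card_le_two (a := i) (b := j)
    omega
  obtain ⟨p, q, r, hp, hq, hr, h1, h2, h3⟩ := Finset.two_lt_card_iff.1 h
  simp at hp hq hr
  exact ⟨p, q, r, h1, h2, h3, hp.1, hp.2, hq.1, hq.2, hr.1, hr.2⟩

lemma exists_good (n : ℕ) (hn : 4 ≤ n) : ∃ m, GoodChoice n m := by
  classical
  rcases hn.eq_or_lt with h | h
  · subst h; exact ⟨m4, good4⟩
  · have h5 : 5 ≤ n := h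
    let P : (Fin n → Bool) → Fin n → Prop := fun s i => ∀ k, k ≠ i → s k ≠ s i
    have uniq : ∀ s i j, P s i → P s j → i = j := by
      intro s i j hi hj
      by_contra hij
      obtain ⟨p, q, hpq, hpi, hpj, hqi, hqj⟩ := exists_two_avoid hn i j
      have h1 := hi p hpi
      have h2 := hj p hpj
      have h3 := hi j (Ne.symm hij)
      revert h1 h2 h3
      cases s p <;> cases s i <;> cases s j <;> simp
    let m : (Fin n → Bool) → Option (Fin n) := fun s =>
      if h : ∃ i, P s i then some h.choose else none
    have m_some : ∀ s i, P s i → m s = some i := by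
      intro s i hi
      have hex : ∃ i, P s i := ⟨i, hi⟩
      simp only [m, dif_pos hex]
      rw [uniq s _ _ hex.choose_spec hi]
    have m_none : ∀ s, (¬ ∃ i, P s i) → m s = none := by
      intro s hs
      simp only [m, dif_neg hs]
    have Pnot : ∀ s i, P (fun k => !(s k)) i ↔ P s i := by
      intro s i
      simp [P]
    refine ⟨m, ?_, ?_, ?_⟩
    · intro s
      by_cases hs : ∃ i, P s i
      · obtain ⟨i, hi⟩ := hs
        rw [m_some s i hi, m_some _ i ((Pnot s i).2 hi)]
      · rw [m_none s hs, m_none]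
        rintro ⟨i, hi⟩
        exact hs ⟨i, (Pnot s i).1 hi⟩
    · intro i b
      apply m_some
      intro k hk
      simp [hk]
    · intro i j hij s
      by_cases hc : ∃ p, (p ≠ i ∧ p ≠ j) ∧ ∃ q, (q ≠ i ∧ q ≠ j) ∧ s p ≠ s q
      · obtain ⟨p, ⟨hpi, hpj⟩, q, ⟨hqi, hqj⟩, hpq⟩ := hc
        let s' : Fin n → Bool := fun k => if k = i then true else if k = j then false else s k
        have ei : s' i = true := by simp [s']
        have ej : s' j = false := by simp [s', hij.symm]
        have ep : s' p = s p := by simp [s', hpi, hpj]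
        have eq : s' q = s q := by simp [s', hqi, hqj]
        refine ⟨s', ?_, ⟨i, j, by simp [ei, ej]⟩, Or.inr (Or.inr ⟨?_, h5⟩)⟩
        · intro k hki hkj
          simp [s', hki, hkj]
        · apply m_none
          rintro ⟨c, hc⟩
          have hne : p ≠ q := fun h => hpq (by rw [h])
          have h1 := hc i
          have h2 := hc j
          have h3 := hc p
          have h4 := hc q
          rw [ei] at h1
          rw [ej] at h2
          rw [ep] at h3
          rw [eq] at h4
          by_cases c1 : i = c
          · subst c1
            have h3 := h3 hpi
            have h4 := h4 hqi
            rw [ei] at h3 h4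
            simp at h3 h4
            rw [h3, h4] at hpq; exact hpq rfl
          · by_cases c2 : j = c
            · subst c2
              have h3 := h3 hpj
              have h4 := h4 hqj
              rw [ej] at h3 h4
              simp at h3 h4
              rw [h3, h4] at hpq; exact hpq rfl
            · have h1 := h1 c1
              have h2 := h2 c2
              revert h1 h2
              cases s' c <;> simp
      · push Not at hc
        obtain ⟨p, q, hpq, hpi, hpj, hqi, hqj⟩ := exists_two_avoid hn i j
        have hcon : ∀ k, k ≠ i → k ≠ j → s k = s p := fun k hki hkj => hc k ⟨hki, hkj⟩ p ⟨hpi, hpj⟩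
        refine ⟨fun k => if k = i then !(s p) else s p, ?_, ⟨p, i, by simp [hpi]⟩, Or.inl ?_⟩
        · intro k hki hkj
          simp [hki, hcon k hki hkj]
        · apply m_some
          intro k hk
          simp [hk]

lemma fun_rep {n : ℕ} (f : StrongDual ℝ (Fin n → ℝ)) :
    ∃ u : Fin n → ℝ, ∀ x, f x = ∑ k, u k * x k := by
  refine ⟨fun k => f (Pi.single k 1), fun x => ?_⟩
  have := f.toLinearMap.pi_apply_eq_sum_univ x
  simp only [ContinuousLinearMap.coe_coe] at this
  rw [this]
  refine Finset.sum_congr rfl fun k _ => ?_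
  rw [smul_eq_mul, mul_comm]
  congr 2
  ext j
  simp [Pi.single_apply, eq_comm]

/-- dual criterion for illumination -/
lemma illum_of_normals {n : ℕ} {B : Set (Fin n → ℝ)} (hB : IsConvexBody B) {x d : Fin n → ℝ}
    (hx : x ∈ B)
    (h : ∀ u : Fin n → ℝ, u ≠ 0 → (∀ b ∈ B, ∑ k, u k * b k ≤ ∑ k, u k * x k) →
      ∑ k, u k * d k < 0) : Illuminates B d x := by
  obtain ⟨hc, hcomp, hint⟩ := hB
  by_contra hcon
  have hcl : closure (interior B) = B := by
    rw [hc.closure_interior_eq_closure_of_nonempty_interior hint, hcomp.isClosed.closure_eq]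
  let R : Set (Fin n → ℝ) := (fun ε : ℝ => x + ε • d) '' Set.Ioi 0
  have hR : Convex ℝ R := by
    rintro _ ⟨a, ha, rfl⟩ _ ⟨b, hb, rfl⟩ p q hp hq hpq
    refine ⟨p * a + q * b, ?_, ?_⟩
    · have := (convex_Ioi (0:ℝ)) ha hb hp hq hpq
      simpa using this
    · ext k
      simp
      linear_combination (-x k) * hpq
  have hdisj : Disjoint (interior B) R := by
    rw [Set.disjoint_right]
    rintro _ ⟨a, ha, rfl⟩ hmem
    exact hcon ⟨a, ha, hmem⟩
  obtain ⟨f, c, hf1, hf2⟩ := geometric_hahn_banach_open hc.interior isOpen_interior hR hdisj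
  have hle : ∀ b ∈ B, f b ≤ c := by
    intro b hb
    rw [← hcl] at hb
    have : closure (interior B) ⊆ {y | f y ≤ c} :=
      closure_minimal (fun y hy => (hf1 y hy).le) (isClosed_le f.continuous continuous_const)
    exact this hb
  have hray : ∀ ε : ℝ, 0 < ε → c ≤ f x + ε * f d := by
    intro ε hε
    have := hf2 _ ⟨ε, hε, rfl⟩
    simpa using this
  have hfd : 0 ≤ f d := by
    have h1 := hray 1 one_pos
    have h2 := hle x hx
    linarith
  have hcx : c ≤ f x := by
    by_contra hlt
    push Not at hlt
    have h1 := hray ((c - f x) / (2 * (f d + 1))) (by apply div_pos <;> linarith)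
    have h2 : (c - f x) / (2 * (f d + 1)) * f d ≤ (c - f x) / 2 := by
      rw [div_mul_eq_mul_div, div_le_div_iff₀ (by linarith) (by norm_num)]
      nlinarith
    linarith
  obtain ⟨u, hu⟩ := fun_rep f
  have hu0 : u ≠ 0 := by
    rintro rfl
    obtain ⟨b, hb⟩ := hint
    have h1 := hf1 b hb
    rw [hu] at h1 hcx
    simp at h1 hcx
    linarith
  have := h u hu0 (fun b hb => by rw [← hu, ← hu]; exact (hle b hb).trans hcx)
  rw [← hu] at this
  linarith

section
variable {n : ℕ} {B : Set (Fin n → ℝ)}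

lemma abs_point (hU : Unconditional B) {x : Fin n → ℝ} (hx : x ∈ B) (v : Fin n → ℝ) :
    ∃ y ∈ B, ∑ k, v k * y k = ∑ k, |v k| * |x k| := by
  refine ⟨_, hU x hx (fun k => if 0 ≤ v k * x k then 1 else -1) (fun k => ?_), ?_⟩
  · by_cases h : 0 ≤ v k * x k <;> simp [h]
  · refine Finset.sum_congr rfl fun k _ => ?_
    rw [← abs_mul]
    by_cases h : 0 ≤ v k * x k
    · simp [h, abs_of_nonneg h]
    · simp only [h, if_false]
      rw [abs_of_neg (not_le.1 h)]; ring

lemma normal_abs (hU : Unconditional B) {x u : Fin n → ℝ}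
    (hu : ∀ b ∈ B, ∑ k, u k * b k ≤ ∑ k, u k * x k) {y : Fin n → ℝ} (hy : y ∈ B) :
    ∑ k, |u k| * |y k| ≤ ∑ k, u k * x k := by
  obtain ⟨z, hz, h⟩ := abs_point hU hy u
  rw [← h]; exact hu z hz

lemma normal_sum (hU : Unconditional B) {x u : Fin n → ℝ} (hx : x ∈ B)
    (hu : ∀ b ∈ B, ∑ k, u k * b k ≤ ∑ k, u k * x k) :
    ∀ k, u k * x k = |u k| * |x k| := by
  have h1 := normal_abs hU hu hx
  have h2 : ∀ k ∈ Finset.univ, u k * x k ≤ |u k| * |x k| := fun k _ => by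
    rw [← abs_mul]; exact le_abs_self _
  have h3 := (Finset.sum_eq_sum_iff_of_le h2).1 (le_antisymm (Finset.sum_le_sum h2) h1)
  exact fun k => h3 k (Finset.mem_univ k)

lemma sum_pair (a : Fin n → ℝ) {i j : Fin n} (hij : i ≠ j) :
    ∑ k, a k * |(allOnes - stdB i - stdB j : Fin n → ℝ) k| = ∑ k, a k - a i - a j := by
  have : ∀ k, a k * |(allOnes - stdB i - stdB j : Fin n → ℝ) k|
      = a k - (if k = i then a k else 0) - (if k = j then a k else 0) := by
    intro k
    by_cases h1 : k = i
    · subst h1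
      simp [allOnes, stdB, hij]
    · by_cases h2 : k = j
      · subst h2
        simp [allOnes, stdB, h1]
      · simp [allOnes, stdB, h1, h2]
  simp_rw [this]
  simp

lemma abs_le_one (hn : 4 ≤ n) (hB : memU B)
    (hsub : ∀ i j : Fin n, i ≠ j → allOnes - stdB i - stdB j ∈ B) {x : Fin n → ℝ} (hx : x ∈ B)
    (k : Fin n) : |x k| ≤ 1 := by
  obtain ⟨⟨hc, hcomp, hint⟩, hU, hfr⟩ := hB
  have hcl : closure (interior B) = B := by
    rw [hc.closure_interior_eq_closure_of_nonempty_interior hint, hcomp.isClosed.closure_eq]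
  obtain ⟨f, hf⟩ := geometric_hahn_banach_open_point hc.interior isOpen_interior (hfr k).2
  have hle : ∀ b ∈ B, f b ≤ f (stdB k) := by
    intro b hb
    rw [← hcl] at hb
    have : closure (interior B) ⊆ {y | f y ≤ f (stdB k)} :=
      closure_minimal (fun y hy => (hf y hy).le) (isClosed_le f.continuous continuous_const)
    exact this hb
  obtain ⟨u, hu⟩ := fun_rep f
  have hle' : ∀ b ∈ B, ∑ l, u l * b l ≤ ∑ l, u l * (stdB k : Fin n → ℝ) l := by
    intro b hb; rw [← hu, ← hu]; exact hle b hb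
  have hk : ∑ l, u l * (stdB k : Fin n → ℝ) l = u k := by
    simp [stdB, Pi.single_apply]
  have hz : ∀ l, l ≠ k → u l = 0 := by
    intro l hl
    obtain ⟨p, q, hpq, hpk, hpl, hqk, hql⟩ := exists_two_avoid hn k l
    have h1 := normal_abs hU hle' (hsub p q hpq)
    rw [sum_pair (fun l => |u l|) hpq, hk] at h1
    have h2 : ∑ l ∈ ({k, l, p, q} : Finset (Fin n)), |u l| ≤ ∑ l, |u l| :=
      Finset.sum_le_sum_of_subset_of_nonneg (Finset.subset_univ _) (fun _ _ _ => abs_nonneg _)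
    rw [Finset.sum_insert (by simp [hl.symm, hpk.symm, hqk.symm]),
      Finset.sum_insert (by simp [hpl.symm, hql.symm]), Finset.sum_pair hpq] at h2
    have h3 := le_abs_self (u k)
    have h4 := abs_nonneg (u l)
    exact abs_eq_zero.1 (by linarith)
  have hx1 := normal_abs hU hle' hx
  rw [hk, Finset.sum_eq_single k (fun l _ hl => by simp [hz l hl]) (by simp)] at hx1
  have hpos : 0 < |u k| := by
    rw [abs_pos]
    intro h0
    obtain ⟨b, hb⟩ := hint
    have := hf b hb
    rw [hu, hu] at this
    have hall : ∀ l, u l = 0 := fun l => by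
      by_cases h : l = k
      · rw [h, h0]
      · exact hz l h
    simp [hall] at this
  have := le_abs_self (u k)
  by_contra hcon
  push Not at hcon
  nlinarith

lemma exists_delta (hn : 4 ≤ n) (hB : memU B)
    (hsub : ∀ i j : Fin n, i ≠ j → allOnes - stdB i - stdB j ∈ B)
    (hpar : ¬ IsParallelepiped B) :
    ∃ δ : ℝ, 0 < δ ∧ δ < 1 ∧ ∀ x ∈ B, ∃ i, |x i| ≤ 1 - δ := by
  have hcube := fun x (hx : x ∈ B) k => abs_le_one hn hB hsub hx k
  obtain ⟨⟨hc, hcomp, hint⟩, hU, hfr⟩ := hB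
  have h1 : (allOnes : Fin n → ℝ) ∉ B := by
    intro h1
    apply hpar
    refine ⟨AffineEquiv.refl ℝ _, ?_⟩
    simp only [AffineEquiv.coe_refl, Set.image_id]
    apply Set.Subset.antisymm
    · intro x hx
      exact ⟨fun k => (abs_le.1 (hcube x hx k)).1, fun k => (abs_le.1 (hcube x hx k)).2⟩
    · intro y hy
      by_contra hyB
      obtain ⟨f, c, hf1, hf2⟩ := geometric_hahn_banach_closed_point hc hcomp.isClosed hyB
      obtain ⟨u, hu⟩ := fun_rep f
      obtain ⟨z, hz, hzs⟩ := abs_point hU h1 u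
      have h2 := hf1 z hz
      rw [hu, hzs] at h2
      rw [hu] at hf2
      have h3 : ∑ k, u k * y k ≤ ∑ k, |u k| * |(allOnes : Fin n → ℝ) k| := by
        refine Finset.sum_le_sum fun k _ => ?_
        have : |y k| ≤ 1 := abs_le.2 ⟨hy.1 k, hy.2 k⟩
        calc u k * y k ≤ |u k * y k| := le_abs_self _
          _ = |u k| * |y k| := abs_mul _ _
          _ ≤ |u k| * 1 := mul_le_mul_of_nonneg_left this (abs_nonneg _)
          _ = _ := by simp [allOnes]
      linarith
  obtain ⟨f, c, hf1, hf2⟩ := geometric_hahn_banach_closed_point hc hcomp.isClosed h1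
  obtain ⟨u, hu⟩ := fun_rep f
  have hS : c < ∑ k, |u k| := by
    rw [hu] at hf2
    refine hf2.trans_le (Finset.sum_le_sum fun k _ => ?_)
    simp [allOnes, le_abs_self]
  have hSnn : 0 ≤ ∑ k, |u k| := Finset.sum_nonneg fun _ _ => abs_nonneg _
  set S := ∑ k, |u k| with hSdef
  obtain ⟨δ, h0, h1', h2⟩ : ∃ δ : ℝ, 0 < δ ∧ δ < 1 ∧ c < (1 - δ) * S := by
    refine ⟨min (1/2) ((S - c) / (2 * (S + 1))), ?_, ?_, ?_⟩
    · apply lt_min (by norm_num)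
      apply div_pos <;> linarith
    · exact (min_le_left _ _).trans_lt (by norm_num)
    · have hm := min_le_right (1/2 : ℝ) ((S - c) / (2 * (S + 1)))
      have h3 : (S - c) / (2 * (S + 1)) * S ≤ (S - c) / 2 := by
        rw [div_mul_eq_mul_div, div_le_div_iff₀ (by linarith) (by norm_num)]
        nlinarith
      have h4 := mul_le_mul_of_nonneg_right hm hSnn
      linarith
  refine ⟨δ, h0, h1', fun x hx => ?_⟩
  by_contra hcon
  push Not at hcon
  obtain ⟨z, hz, hzs⟩ := abs_point hU hx u
  have h3 := hf1 z hz
  rw [hu, hzs] at h3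
  have h4 : (1 - δ) * S ≤ ∑ k, |u k| * |x k| := by
    rw [hSdef, Finset.mul_sum]
    refine Finset.sum_le_sum fun k _ => ?_
    rw [mul_comm]
    exact mul_le_mul_of_nonneg_left (hcon k).le (abs_nonneg _)
  linarith

/-- the main combinatorial criterion -/
lemma illum_crit (hn : 4 ≤ n) (hB : memU B)
    (hsub : ∀ i j : Fin n, i ≠ j → allOnes - stdB i - stdB j ∈ B)
    {x : Fin n → ℝ} (hx : x ∈ B) (s : Fin n → Bool) (w : Fin n → ℝ) (hw : ∀ k, 0 < w k)
    (hs : ∀ k, x k ≠ 0 → 0 < sgn2 (s k) * x k)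
    (Z : Finset (Fin n)) (hZ : ∀ k, k ∈ Z ↔ x k = 0)
    (H : ∀ a : Fin n → ℝ, (∀ k, 0 ≤ a k) → (∀ i j, i ≠ j → ∑ k ∈ Z, a k ≤ a i + a j) →
      ∑ k ∈ Zᶜ, w k * a k ≤ ∑ k ∈ Z, w k * a k → ∑ k ∈ Z, a k ≤ 0) :
    Illuminates B (fun k => -(sgn2 (s k) * w k)) x := by
  apply illum_of_normals hB.1 hx
  intro u hu0 hu
  by_contra hcon
  push Not at hcon
  have hU := hB.2.1
  have hNs := normal_sum hU hx hu
  have hpair : ∀ i j, i ≠ j → ∑ k ∈ Z, |u k| ≤ |u i| + |u j| := by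
    intro i j hij
    have h1 := normal_abs hU hu (hsub i j hij)
    rw [sum_pair (fun l => |u l|) hij] at h1
    have h2 : ∑ k, u k * x k ≤ ∑ k ∈ Zᶜ, |u k| := by
      rw [← Finset.sum_add_sum_compl Z (fun k => u k * x k),
        Finset.sum_eq_zero (s := Z) (fun k hk => by rw [(hZ k).1 hk, mul_zero]), zero_add]
      refine Finset.sum_le_sum fun k _ => ?_
      rw [hNs k]
      have := abs_le_one hn hB hsub hx k
      exact mul_le_of_le_one_right (abs_nonneg _) this
    have h3 := Finset.sum_add_sum_compl Z (fun k => |u k|)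
    linarith
  have hle : ∑ k, u k * -(sgn2 (s k) * w k) ≤ ∑ k ∈ Z, w k * |u k| - ∑ k ∈ Zᶜ, w k * |u k| := by
    rw [← Finset.sum_add_sum_compl Z (fun k => u k * -(sgn2 (s k) * w k)), sub_eq_add_neg,
      ← Finset.sum_neg_distrib]
    refine add_le_add (Finset.sum_le_sum fun k _ => ?_) (Finset.sum_le_sum fun k hk => ?_)
    · have := hw k
      have h1 := neg_abs_le (u k)
      have h2 := le_abs_self (u k)
      rcases sgn2_cases (s k) with h | h <;> rw [h] <;> nlinarith
    · have hk' : x k ≠ 0 := fun h => by simp [(hZ k).2 h] at hk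
      have h1 := hs k hk'
      have h2 := hNs k
      have h3 : 0 < |x k| := abs_pos.2 hk'
      have h4 : u k * sgn2 (s k) = |u k| := by
        rcases sgn2_cases (s k) with h | h <;> rw [h] at h1 ⊢
        · rw [abs_of_pos (a := x k) (by linarith)] at h2
          have := mul_right_cancel₀ hk' h2
          linarith
        · rw [abs_of_neg (a := x k) (by linarith)] at h2
          have : (u k * -1) * x k = |u k| * x k := by linarith
          exact mul_right_cancel₀ hk' this
      rw [← h4]
      exact le_of_eq (by ring)
  have hZ0 := H (fun k => |u k|) (fun k => abs_nonneg _) hpair (by linarith)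
  have hz1 : ∀ k ∈ Z, |u k| = 0 := by
    rw [← Finset.sum_eq_zero_iff_of_nonneg (fun k _ => abs_nonneg _)]
    exact le_antisymm hZ0 (Finset.sum_nonneg fun k _ => abs_nonneg _)
  have hz2 : ∑ k ∈ Z, w k * |u k| = 0 :=
    Finset.sum_eq_zero fun k hk => by rw [hz1 k hk, mul_zero]
  have hz3 : ∀ k ∈ Zᶜ, w k * |u k| = 0 := by
    rw [← Finset.sum_eq_zero_iff_of_nonneg (fun k _ => mul_nonneg (hw k).le (abs_nonneg _))]
    exact le_antisymm (by linarith)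
      (Finset.sum_nonneg fun k _ => mul_nonneg (hw k).le (abs_nonneg _))
  apply hu0
  ext k
  by_cases hk : k ∈ Z
  · exact abs_eq_zero.1 (hz1 k hk)
  · have := hz3 k (by simp [hk])
    rcases mul_eq_zero.1 this with h | h
    · exact absurd h (hw k).ne'
    · exact abs_eq_zero.1 h

/-- the case of a point with all coordinates of the same sign -/
lemma illum_same (hB : memU B) {δ : ℝ} (h0 : 0 < δ)
    {x : Fin n → ℝ} (hx : x ∈ B) (b : Bool) (i : Fin n) (hi : |x i| ≤ 1 - δ)
    (hcube : ∀ k, |x k| ≤ 1)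
    (hs : ∀ k, 0 < sgn2 b * x k) (d : Fin n → ℝ) (hdi : d i = sgn2 b * (δ / 2))
    (hd : ∀ k, k ≠ i → d k = - sgn2 b) : Illuminates B d x := by
  apply illum_of_normals hB.1 hx
  intro u hu0 hu
  have hU := hB.2.1
  have hNs := normal_sum hU hx hu
  have ha : ∀ k, u k * sgn2 b = |u k| := by
    intro k
    have h1 := hs k
    have h2 := hNs k
    have hk' : x k ≠ 0 := fun h => by simp [h] at h1
    rcases sgn2_cases b with h | h <;> rw [h] at h1 ⊢
    · rw [abs_of_pos (a := x k) (by linarith)] at h2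
      have := mul_right_cancel₀ hk' h2
      linarith
    · rw [abs_of_neg (a := x k) (by linarith)] at h2
      have : (u k * -1) * x k = |u k| * x k := by linarith
      exact mul_right_cancel₀ hk' this
  have hcl : IsClosed B := hB.1.2.1.isClosed
  have hei : stdB i ∈ B := hcl.frontier_subset (hB.2.2 i)
  have h1 := normal_abs hU hu hei
  have h2 : ∑ k, |u k| * |(stdB i : Fin n → ℝ) k| = |u i| := by
    rw [Finset.sum_eq_single i]
    · simp [stdB]
    · intro k _ hk; simp [stdB, hk]
    · simp
  rw [h2, ← Finset.add_sum_erase _ _ (Finset.mem_univ i)] at h1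
  have h3 : ∑ k ∈ Finset.univ.erase i, u k * x k ≤ ∑ k ∈ Finset.univ.erase i, |u k| := by
    refine Finset.sum_le_sum fun k _ => ?_
    rw [hNs k]
    exact mul_le_of_le_one_right (abs_nonneg _) (hcube k)
  have h4 : u i * x i ≤ |u i| * (1 - δ) := by
    rw [hNs i]; exact mul_le_mul_of_nonneg_left hi (abs_nonneg _)
  have h5 : ∑ k, u k * d k = |u i| * (δ / 2) - ∑ k ∈ Finset.univ.erase i, |u k| := by
    rw [← Finset.add_sum_erase _ _ (Finset.mem_univ i), hdi, ← mul_assoc, ha i, sub_eq_add_neg,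
      ← Finset.sum_neg_distrib]
    congr 1
    refine Finset.sum_congr rfl fun k hk => ?_
    rw [hd k (Finset.ne_of_mem_erase hk), ← ha k]; ring
  rw [h5]
  by_contra hcon
  push Not at hcon
  have h6 : |u i| = 0 := by
    have := abs_nonneg (u i)
    by_contra hne
    have : 0 < |u i| := lt_of_le_of_ne this (Ne.symm hne)
    nlinarith
  rw [h6] at hcon
  have h7 : ∀ k ∈ Finset.univ.erase i, |u k| = 0 := by
    rw [← Finset.sum_eq_zero_iff_of_nonneg (fun k _ => abs_nonneg _)]
    exact le_antisymm (by linarith) (Finset.sum_nonneg fun k _ => abs_nonneg _)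
  apply hu0
  ext k
  by_cases hk : k = i
  · subst hk; exact abs_eq_zero.1 h6
  · exact abs_eq_zero.1 (h7 k (by simp [hk]))

lemma wt_pos {t : ℝ} (ht : 0 < t) (o : Option (Fin n)) (k : Fin n) : 0 < wt t o k := by
  unfold wt; split_ifs <;> linarith

lemma wt_le {t : ℝ} (ht : t < 1) (o : Option (Fin n)) (k : Fin n) : wt t o k ≤ 1 := by
  unfold wt; split_ifs <;> linarith

lemma exists_illum (hn : 4 ≤ n) (hB : memU B)
    (hsub : ∀ i j : Fin n, i ≠ j → allOnes - stdB i - stdB j ∈ B)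
    {δ : ℝ} (h0 : 0 < δ) (h1 : δ < 1) (hδ : ∀ x ∈ B, ∃ i, |x i| ≤ 1 - δ)
    (m : (Fin n → Bool) → Option (Fin n)) (hm : GoodChoice n m)
    {x : Fin n → ℝ} (hx : x ∈ B) :
    ∃ s : Fin n → Bool, (∃ k l, s k ≠ s l) ∧ Illuminates B (dirn (δ / 2) m s) x := by
  classical
  have ht0 : 0 < δ / 2 := by linarith
  have ht1 : δ / 2 < 1 := by linarith
  obtain ⟨hm1, hm2, hm3⟩ := hm
  let Z : Finset (Fin n) := Finset.univ.filter fun k => x k = 0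
  have hZ : ∀ k, k ∈ Z ↔ x k = 0 := fun k => by simp [Z]
  let s0 : Fin n → Bool := fun k => decide (0 < x k)
  have hs0 : ∀ k, x k ≠ 0 → 0 < sgn2 (s0 k) * x k := by
    intro k hk
    rcases lt_or_gt_of_ne hk with h | h
    · simp [s0, sgn2, not_lt.2 h.le, h]
    · simp [s0, sgn2, h]
  have comp : ∀ s : Fin n → Bool, (∀ k, k ∉ Z → s k = s0 k) →
      ∀ k, x k ≠ 0 → 0 < sgn2 (s k) * x k := by
    intro s hs k hk
    rw [hs k (fun h => hk ((hZ k).1 h))]; exact hs0 k hk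
  rcases Nat.lt_or_ge 2 Z.card with hc | hc
  · -- at least three zeros
    obtain ⟨p, q, r, hp, hq, hr, hpq, hpr, hqr⟩ := Finset.two_lt_card_iff.1 hc
    refine ⟨fun k => if k = p then true else if k = q then false else s0 k,
      ⟨p, q, by simp [hpq.symm]⟩, ?_⟩
    refine illum_crit hn hB hsub hx _ _ (wt_pos ht0 _) (comp _ ?_) Z hZ ?_
    · intro k hk
      have h1 : k ≠ p := fun h => hk (h ▸ hp)
      have h2 : k ≠ q := fun h => hk (h ▸ hq)
      simp [h1, h2]
    · intro a ha hpair _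
      have hle : a p + (a q + a r) ≤ ∑ k ∈ Z, a k := by
        have : ∑ k ∈ ({p, q, r} : Finset (Fin n)), a k ≤ ∑ k ∈ Z, a k :=
          Finset.sum_le_sum_of_subset_of_nonneg
            (by intro k; simp only [Finset.mem_insert, Finset.mem_singleton]
                rintro (rfl | rfl | rfl) <;> assumption)
            (fun _ _ _ => ha _)
        rwa [Finset.sum_insert (by simp [hpq, hpr]), Finset.sum_pair hqr] at this
      have := hpair p q hpq
      have := hpair p r hpr
      have := hpair q r hqr
      have := ha p
      have := ha q
      have := ha r
      linarith
  · obtain hc0 | hc1 | hc2 : Z.card = 0 ∨ Z.card = 1 ∨ Z.card = 2 := by omega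
    · -- no zeros
      have hZe : Z = ∅ := Finset.card_eq_zero.1 hc0
      have hne : ∀ k, x k ≠ 0 := fun k h => by
        have := (hZ k).2 h
        simp [hZe] at this
      by_cases hcon : ∃ k l, s0 k ≠ s0 l
      · refine ⟨s0, hcon, ?_⟩
        refine illum_crit hn hB hsub hx _ _ (wt_pos ht0 _) hs0 Z hZ ?_
        intro a _ _ _
        simp [hZe]
      · push Not at hcon
        obtain ⟨i, hi⟩ := hδ x hx
        obtain ⟨p, q, hpq, hpi, -⟩ := exists_two_avoid hn i i
        refine ⟨fun k => if k = i then !(s0 i) else s0 i, ⟨p, i, by simp [hpi]⟩, ?_⟩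
        refine illum_same hB h0 hx (s0 i) i hi (fun k => abs_le_one hn hB hsub hx k)
          (fun k => ?_) _ ?_ ?_
        · rw [hcon i k]; exact hs0 k (hne k)
        · simp [dirn, hm2, wt, sgn2_not]
        · intro k hk
          simp [dirn, hm2, wt, hk, Ne.symm hk]
    · -- one zero
      obtain ⟨i, hZi⟩ := Finset.card_eq_one.1 hc1
      obtain ⟨p0, _, _, hp0, -⟩ := exists_two_avoid hn i i
      let s : Fin n → Bool := fun k => if k = i then !(s0 p0) else s0 k
      refine ⟨s, ⟨p0, i, by simp [s, hp0]⟩, ?_⟩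
      refine illum_crit hn hB hsub hx _ _ (wt_pos ht0 _) (comp _ ?_) Z hZ ?_
      · intro k hk
        have h1 : k ≠ i := fun h => hk (by simp [hZi, h])
        simp [s, h1]
      · intro a ha hpair hle
        obtain ⟨r, hri, hr⟩ : ∃ r, r ≠ i ∧ ∀ k, k ≠ i → k ≠ r → wt (δ / 2) (m s) k = 1 := by
          rcases hms : m s with _ | c
          · exact ⟨p0, hp0, fun k _ _ => by simp [wt]⟩
          · by_cases hci : c = i
            · exact ⟨p0, hp0, fun k hk _ => by simp [wt, hci, Ne.symm hk]⟩
            · exact ⟨c, hci, fun k _ hk => by simp [wt, Ne.symm hk]⟩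
        obtain ⟨p, q, hpq, hpi, hpr, hqi, hqr⟩ := exists_two_avoid hn i r
        rw [hZi] at hle hpair ⊢
        simp only [Finset.sum_singleton] at hle hpair ⊢
        have hsum : a p + (a q + wt (δ / 2) (m s) r * a r)
            ≤ ∑ k ∈ ({i} : Finset (Fin n))ᶜ, wt (δ / 2) (m s) k * a k := by
          have : ∑ k ∈ ({p, q, r} : Finset (Fin n)), wt (δ / 2) (m s) k * a k
              ≤ ∑ k ∈ ({i} : Finset (Fin n))ᶜ, wt (δ / 2) (m s) k * a k :=
            Finset.sum_le_sum_of_subset_of_nonneg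
              (by intro k; simp only [Finset.mem_insert, Finset.mem_singleton, Finset.mem_compl]
                  rintro (rfl | rfl | rfl) <;> assumption)
              (fun _ _ _ => mul_nonneg (wt_pos ht0 _ _).le (ha _))
          rwa [Finset.sum_insert (by simp [hpq, hpr]), Finset.sum_pair hqr, hr p hpi hpr,
            hr q hqi hqr, one_mul, one_mul] at this
        have hwi : wt (δ / 2) (m s) i * a i ≤ a i :=
          mul_le_of_le_one_left (ha i) (wt_le ht1 _ _)
        have e1 := hpair p q hpq
        have e2 := hpair p r hpr
        have e3 := hpair q r hqr
        have hwr := wt_pos ht0 (m s) r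
        have hr0 : a r = 0 := by
          by_contra hne
          have : 0 < a r := lt_of_le_of_ne (ha r) (Ne.symm hne)
          have := mul_pos hwr this
          linarith
        rw [hr0] at hsum e2 e3
        have := ha p
        have := ha q
        linarith
    · -- two zeros
      obtain ⟨i, j, hij, hZij⟩ := Finset.card_eq_two.1 hc2
      obtain ⟨s, hs1, hs2, hs3⟩ := hm3 i j hij s0
      refine ⟨s, hs2, ?_⟩
      refine illum_crit hn hB hsub hx _ _ (wt_pos ht0 _) (comp _ ?_) Z hZ ?_
      · intro k hk
        rw [hZij] at hk
        simp at hk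
        exact hs1 k hk.1 hk.2
      · intro a ha hpair hle
        rw [hZij] at hle hpair ⊢
        simp only [Finset.sum_pair hij] at hle hpair ⊢
        have hsub : ∀ T : Finset (Fin n), (∀ k ∈ T, k ≠ i ∧ k ≠ j) →
            ∑ k ∈ T, wt (δ / 2) (m s) k * a k
              ≤ ∑ k ∈ ({i, j} : Finset (Fin n))ᶜ, wt (δ / 2) (m s) k * a k := by
          intro T hT
          refine Finset.sum_le_sum_of_subset_of_nonneg ?_
              (fun _ _ _ => mul_nonneg (wt_pos ht0 _ _).le (ha _))
          intro k hk
          simp [hT k hk]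
        have hai := ha i
        have haj := ha j
        have hone : ∀ c, m s = some c → ∀ k, k ≠ c → wt (δ / 2) (m s) k = 1 := by
          intro c hc k hk; simp [wt, hc, Ne.symm hk]
        have hself : ∀ c, m s = some c → wt (δ / 2) (m s) c = δ / 2 := by
          intro c hc; simp [wt, hc]
        rcases hs3 with hc | hc | ⟨hc, h5⟩
        · obtain ⟨p, q, hpq, hpi, hpj, hqi, hqj⟩ := exists_two_avoid hn i j
          have h2 := hsub {p, q} (by simp [hpi, hpj, hqi, hqj])
          rw [Finset.sum_pair hpq, hone i hc p hpi, hone i hc q hqi] at h2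
          rw [hself i hc, hone i hc j hij.symm] at hle
          have e1 := hpair p q hpq
          have hz : a i = 0 := by
            by_contra hne
            have : 0 < a i := lt_of_le_of_ne hai (Ne.symm hne)
            nlinarith
          have e2 := hpair i p hpi.symm
          have e3 := hpair i q hqi.symm
          rw [hz] at hle e1 e2 e3
          linarith
        · obtain ⟨p, q, hpq, hpi, hpj, hqi, hqj⟩ := exists_two_avoid hn i j
          have h2 := hsub {p, q} (by simp [hpi, hpj, hqi, hqj])
          rw [Finset.sum_pair hpq, hone j hc p hpj, hone j hc q hqj] at h2
          rw [hself j hc, hone j hc i hij] at hle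
          have e1 := hpair p q hpq
          have hz : a j = 0 := by
            by_contra hne
            have : 0 < a j := lt_of_le_of_ne haj (Ne.symm hne)
            nlinarith
          have e2 := hpair j p hpj.symm
          have e3 := hpair j q hqj.symm
          rw [hz] at hle e1 e2 e3
          linarith
        · obtain ⟨p, q, r, hpq, hpr, hqr, hpi, hpj, hqi, hqj, hri, hrj⟩ := exists_three_avoid h5 i j
          have h2 := hsub {p, q, r} (by simp [hpi, hpj, hqi, hqj, hri, hrj])
          have hw1 : ∀ k, wt (δ / 2) (m s) k = 1 := fun k => by simp [wt, hc]
          rw [Finset.sum_insert (by simp [hpq, hpr]), Finset.sum_pair hqr] at h2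
          simp only [hw1, one_mul] at h2 hle
          have e1 := hpair p q hpq
          have e2 := hpair p r hpr
          have e3 := hpair q r hqr
          linarith
end

/-- If `B ∈ 𝒰^n`, `n ≥ 4`, contains `𝟙 - e_i - e_j` for all `i ≠ j`,
and `B` is not a parallelepiped, then `𝕀(B) ≤ 2^n - 2`, witnessed by a symmetric
set of nonzero directions. -/
theorem stmt2 (n : ℕ) (hn : 4 ≤ n) (B : Set (Fin n → ℝ)) (hB : memU B)
    (hsub : ∀ i j : Fin n, i ≠ j → allOnes - stdB i - stdB j ∈ B)
    (hpar : ¬ IsParallelepiped B) :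
    illumNumber B ≤ 2 ^ n - 2 ∧
      ∃ D : Finset (Fin n → ℝ), (∀ d ∈ D, d ≠ 0) ∧ (∀ d ∈ D, -d ∈ D) ∧
        D.card ≤ 2 ^ n - 2 ∧ IlluminatesSet B ↑D := by
  classical
  obtain ⟨m, hm⟩ := exists_good n hn
  obtain ⟨δ, h0, h1, hδ⟩ := exists_delta hn hB hsub hpar
  have hcl : IsClosed B := hB.1.2.1.isClosed
  have hpos : 0 < n := by omega
  let F : Finset (Fin n → Bool) := (Finset.univ.erase (fun _ => true)).erase (fun _ => false)
  have hF : ∀ s : Fin n → Bool, s ∈ F ↔ s ≠ (fun _ => false) ∧ s ≠ (fun _ => true) := by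
    intro s; simp [F]
  have hFc : F.card = 2 ^ n - 2 := by
    have hne : (fun _ => false : Fin n → Bool) ≠ (fun _ => true) := fun h => by
      have := congrFun h ⟨0, hpos⟩
      simp at this
    rw [Finset.card_erase_of_mem (by simp [hne]), Finset.card_erase_of_mem (by simp)]
    simp
    omega
  let D : Finset (Fin n → ℝ) := F.image (dirn (δ / 2) m)
  have hD0 : ∀ d ∈ D, d ≠ 0 := by
    intro d hd h
    obtain ⟨s, -, rfl⟩ := Finset.mem_image.1 hd
    have h2 := congrFun h ⟨0, hpos⟩
    have h3 := wt_pos (t := δ / 2) (by linarith) (m s) ⟨0, hpos⟩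
    simp only [dirn, Pi.zero_apply, neg_eq_zero, mul_eq_zero] at h2
    rcases h2 with h2 | h2
    · rcases sgn2_cases (s ⟨0, hpos⟩) with h | h <;> rw [h] at h2 <;> norm_num at h2
    · exact h3.ne' h2
  have hDneg : ∀ d ∈ D, -d ∈ D := by
    intro d hd
    obtain ⟨s, hs, rfl⟩ := Finset.mem_image.1 hd
    refine Finset.mem_image.2 ⟨fun k => !(s k), ?_, ?_⟩
    · rw [hF] at hs ⊢
      refine ⟨fun h => hs.2 ?_, fun h => hs.1 ?_⟩
      · ext k; have := congrFun h k; simpa using this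
      · ext k; have := congrFun h k; simpa using this
    · ext k
      simp [dirn, hm.1, sgn2_not]
  have hDc : D.card ≤ 2 ^ n - 2 := Finset.card_image_le.trans hFc.le
  have hDi : IlluminatesSet B (D : Set (Fin n → ℝ)) := by
    intro x hx
    obtain ⟨s, ⟨k, l, hkl⟩, hs⟩ := exists_illum hn hB hsub h0 h1 hδ m hm (hcl.frontier_subset hx)
    refine ⟨_, Finset.mem_coe.2 (Finset.mem_image_of_mem _ ((hF s).2 ⟨?_, ?_⟩)), hs⟩
    · rintro rfl; exact hkl rfl
    · rintro rfl; exact hkl rfl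
  have hI : illumNumber B ≤ D.card := Nat.sInf_le ⟨D, rfl, hD0, hDi⟩
  exact ⟨hI.trans hDc, D, hD0, hDneg, hDc, hDi⟩
end

section
/- Let n ≥ 3 and let K be a cubelike 1-unconditional convex body in ℝ^n that is not a parallelepiped. Then 𝕀(K) ≤ 2^n − 2; moreover, there exists a set D of nonzero directions with D = −D and |D| ≤ 2^n − 2 that illuminates K. -/
open Set

/-- The subspace of directions along which one can move both ways from `x` inside `K`. -/
def faceDir {n : ℕ} (K : Set (Fin n → ℝ)) (hK : Convex ℝ K) (x : Fin n → ℝ) (hx : x ∈ K) :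
    Submodule ℝ (Fin n → ℝ) where
  carrier := {v | ∃ s : ℝ, 0 < s ∧ ∀ r : ℝ, |r| ≤ s → x + r • v ∈ K}
  zero_mem' := ⟨1, one_pos, fun r _ => by simpa using hx⟩
  add_mem' := by
    rintro v w ⟨s, hs, hv⟩ ⟨s', hs', hw⟩
    refine ⟨min s s' / 2, by positivity, fun r hr => ?_⟩
    have h2 : |2 * r| ≤ min s s' := by
      rw [abs_mul, abs_two]; linarith
    have h := hK (hv (2 * r) (h2.trans (min_le_left _ _)))
      (hw (2 * r) (h2.trans (min_le_right _ _)))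
      (by norm_num : (0 : ℝ) ≤ 1 / 2) (by norm_num : (0 : ℝ) ≤ 1 / 2) (by norm_num)
    convert h using 1
    module
  smul_mem' := by
    rintro c v ⟨s, hs, hv⟩
    refine ⟨s / (|c| + 1), by positivity, fun r hr => ?_⟩
    rw [smul_smul]
    apply hv
    rw [abs_mul]
    have : |r| * (|c| + 1) ≤ s := by
      rwa [le_div_iff₀ (by positivity)] at hr
    nlinarith [abs_nonneg r]

lemma illum_combo {n : ℕ} {K : Set (Fin n → ℝ)} (hK : Convex ℝ K) {x z w d : Fin n → ℝ} {a : ℝ}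
    (ha : 0 < a) (ha1 : a < 1) (hw : w ∈ K) (hx : x = a • z + (1 - a) • w)
    (h : Illuminates K d z) : Illuminates K d x := by
  obtain ⟨ε, hε, hi⟩ := h
  refine ⟨a * ε, by positivity, ?_⟩
  have := hK.combo_interior_self_mem_interior hi hw ha (by linarith : 0 ≤ 1 - a) (by ring)
  convert this using 1
  rw [hx]; module

lemma exists_extreme_aux {n : ℕ} {K : Set (Fin n → ℝ)} (hK : Convex ℝ K) (hc : IsCompact K)
    (k : ℕ) : ∀ (x : Fin n → ℝ) (hx : x ∈ K), Module.finrank ℝ (faceDir K hK x hx) ≤ k →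
    ∃ e ∈ Set.extremePoints ℝ K, ∀ d, Illuminates K d e → Illuminates K d x := by
  induction k using Nat.strong_induction_on with
  | _ k ih =>
  intro x hx hk
  by_cases hext : x ∈ Set.extremePoints ℝ K
  · exact ⟨x, hext, fun _ h => h⟩
  -- find a nonzero direction
  have hv : ∃ v ∈ faceDir K hK x hx, v ≠ 0 := by
    by_contra hcon
    push Not at hcon
    apply hext
    rw [mem_extremePoints]
    refine ⟨hx, ?_⟩
    rintro p hp q hq ⟨a, b, ha, hb, hab, hpq⟩
    have hmem : q - p ∈ faceDir K hK x hx := by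
      refine ⟨min a b, by positivity, fun r hr => ?_⟩
      have h1 := (abs_le.1 (hr.trans (min_le_left _ _)))
      have h2 := (abs_le.1 (hr.trans (min_le_right _ _)))
      have := hK hp hq (by linarith : 0 ≤ a - r) (by linarith : 0 ≤ b + r) (by linarith)
      convert this using 1
      rw [← hpq]; module
    have h0 := hcon _ hmem
    have hqp : q = p := sub_eq_zero.1 h0
    subst hqp
    have : q = x := by rw [← hpq, ← add_smul, hab, one_smul]
    exact ⟨this, this⟩
  obtain ⟨v, hv, hv0⟩ := hv
  obtain ⟨s, hs, hsv⟩ := id hv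
  set S : Set ℝ := (fun t : ℝ => x + t • v) ⁻¹' K with hS
  have hScl : IsClosed S := hc.isClosed.preimage (by fun_prop)
  obtain ⟨R, hR⟩ := hc.isBounded.exists_norm_le
  have hSb : Bornology.IsBounded S := by
    rw [isBounded_iff_forall_norm_le]
    refine ⟨(R + R) / ‖v‖, fun t ht => ?_⟩
    rw [le_div_iff₀ (norm_pos_iff.2 hv0), ← norm_smul]
    have h1 := hR _ ht
    have h2 := hR _ hx
    calc ‖t • v‖ = ‖(x + t • v) - x‖ := by congr 1; abel
      _ ≤ _ := norm_sub_le _ _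
      _ ≤ _ := add_le_add h1 h2
  have hsS : s ∈ S := hsv s (by rw [abs_of_pos hs])
  obtain ⟨t, htS, htmax⟩ := (Metric.isCompact_of_isClosed_isBounded hScl hSb).exists_isGreatest
    ⟨s, hsS⟩
  have hts : s ≤ t := htmax hsS
  have ht : 0 < t := lt_of_lt_of_le hs hts
  set z := x + t • v with hz
  have hzK : z ∈ K := htS
  have hwK : x + (-s) • v ∈ K := hsv (-s) (by rw [abs_neg, abs_of_pos hs])
  set w := x + (-s) • v with hw
  have hst : 0 < s + t := by linarith
  have ha : 0 < s / (s + t) := by positivity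
  have ha1 : s / (s + t) < 1 := by rw [div_lt_one hst]; linarith
  have hxz : x = (s / (s + t)) • z + (1 - s / (s + t)) • w := by
    rw [hz, hw]
    ext i
    simp only [Pi.add_apply, Pi.smul_apply, smul_eq_mul]
    field_simp
    ring
  have hle : faceDir K hK z hzK < faceDir K hK x hx := by
    refine lt_of_le_of_ne ?_ ?_
    · rintro u ⟨s', hs', hu⟩
      refine ⟨s' * (s / (s + t)), by positivity, fun r hr => ?_⟩
      have h1 : |r / (s / (s + t))| ≤ s' := by
        rw [abs_div, abs_of_pos ha, div_le_iff₀ ha]; exact hr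
      have h2 := hK (hu _ h1) hwK ha.le (by linarith : 0 ≤ 1 - s / (s + t)) (by ring)
      convert h2 using 1
      rw [smul_add, smul_smul, mul_div_cancel₀ _ ha.ne']
      nth_rewrite 1 [hxz]
      abel
    · intro heq
      have hvz : v ∈ faceDir K hK z hzK := heq ▸ hv
      obtain ⟨s', hs', hu⟩ := hvz
      have h1 := hu s' (by rw [abs_of_pos hs'])
      have h2 : t + s' ∈ S := by
        change x + (t + s') • v ∈ K
        convert h1 using 1
        rw [hz]; module
      have := htmax h2
      linarith
  have hlt := Submodule.finrank_lt_finrank_of_lt hle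
  obtain ⟨e, he, hed⟩ := ih _ (lt_of_lt_of_le hlt hk) z hzK le_rfl
  exact ⟨e, he, fun d hd => illum_combo hK ha ha1 hwK hxz (hed d hd)⟩

lemma box_mem {n : ℕ} {K : Set (Fin n → ℝ)} (hK : Convex ℝ K) (hu : Unconditional K)
    {x y : Fin n → ℝ} (hx : x ∈ K) (h : ∀ i, |y i| ≤ |x i|) : y ∈ K := by
  have h1 : y ∈ convexHull ℝ (Set.pi Set.univ (fun i => ({-x i, x i} : Set ℝ))) := by
    rw [convexHull_pi]
    intro i _
    change y i ∈ convexHull ℝ {-x i, x i}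
    rw [convexHull_pair, segment_eq_uIcc, Set.mem_uIcc]
    have := h i
    rcases abs_cases (x i) with ⟨h1, h2⟩ | ⟨h1, h2⟩
    · left; rw [h1] at this; exact abs_le.1 this
    · right; rw [h1] at this
      have := abs_le.1 this
      constructor <;> linarith
  refine convexHull_min ?_ hK h1
  intro z hz
  have hz' : ∀ i, z i = -x i ∨ z i = x i := fun i => hz i (Set.mem_univ i)
  have := hu x hx (fun i => if z i = x i then 1 else -1) (fun i => by
    by_cases h : z i = x i <;> simp [h])
  convert this using 1
  ext i
  by_cases h : z i = x i
  · simp [h]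
  · simp only [h, if_false]
    rcases hz' i with h' | h'
    · rw [h']; ring
    · exact absurd h' h

lemma box_int {n : ℕ} {K : Set (Fin n → ℝ)} (hK : Convex ℝ K) (hu : Unconditional K)
    {x y : Fin n → ℝ} (hx : x ∈ K) (h : ∀ i, |y i| < |x i|) : y ∈ interior K := by
  rw [mem_interior]
  refine ⟨{z | ∀ i, |z i| < |x i|}, fun z hz => box_mem hK hu hx fun i => (hz i).le, ?_, h⟩
  rw [Set.ext (fun z => by simp : ∀ z, z ∈ {z : Fin n → ℝ | ∀ i, |z i| < |x i|} ↔
    z ∈ ⋂ i, {z : Fin n → ℝ | |z i| < |x i|})]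
  exact isOpen_iInter_of_finite fun i => isOpen_lt (by fun_prop) (by fun_prop)

/-- A common small scale. -/
lemma exists_small {n : ℕ} (f : Fin n → ℝ) (hf : ∀ i, 0 < f i) :
    ∃ l : ℝ, 0 < l ∧ l < 1 ∧ ∀ i, l < f i := by
  have h1 : ∀ᶠ l in nhdsWithin (0 : ℝ) (Set.Ioi 0), l < 1 :=
    nhdsWithin_le_nhds (gt_mem_nhds one_pos)
  have h2 : ∀ᶠ l in nhdsWithin (0 : ℝ) (Set.Ioi 0), ∀ i, l < f i :=
    Filter.eventually_all.2 fun i => nhdsWithin_le_nhds (gt_mem_nhds (hf i))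
  obtain ⟨l, ⟨h1, h2⟩, h3⟩ := ((h1.and h2).and self_mem_nhdsWithin).exists
  exact ⟨l, h3, h1, h2⟩

lemma illum_opposite {n : ℕ} {K : Set (Fin n → ℝ)} (hK : Convex ℝ K) (hu : Unconditional K)
    {x d : Fin n → ℝ} (hx : x ∈ K) (hd1 : ∀ i, |d i| ≤ 1) (h : ∀ i, d i * x i < 0) :
    Illuminates K d x := by
  have hx0 : ∀ i, 0 < |x i| := fun i => abs_pos.2 fun h0 => by
    have := h i; rw [h0] at this; simp at this
  obtain ⟨l, hl, -, hlx⟩ := exists_small _ hx0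
  refine ⟨l, hl, box_int hK hu hx fun i => ?_⟩
  simp only [Pi.add_apply, Pi.smul_apply, smul_eq_mul]
  have h1 := hlx i
  have h2 := h i
  have h3 := abs_le.1 (hd1 i)
  rcases lt_or_gt_of_ne (abs_pos.1 (hx0 i)) with h4 | h4
  · have h5 : 0 < d i := by nlinarith
    rw [abs_of_neg h4] at h1 ⊢
    rw [abs_lt]; constructor <;> nlinarith
  · have h5 : d i < 0 := by nlinarith
    rw [abs_of_pos h4] at h1 ⊢
    rw [abs_lt]; constructor <;> nlinarith

lemma illum_tilt {n : ℕ} {K : Set (Fin n → ℝ)} (hK : Convex ℝ K) (hu : Unconditional K)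
    {x d p : Fin n → ℝ} {i : Fin n} {σ R η : ℝ} (hσ : σ = 1 ∨ σ = -1) (hx : x ∈ K)
    (hp : p ∈ K) (hxs : ∀ j, 0 < σ * x j) (hxR : ∀ j, |x j| < R) (hη : 0 < η)
    (hpi : |x i| + R * η < p i) (hdi : d i = σ * η) (hdj : ∀ j, j ≠ i → d j = -σ) :
    Illuminates K d x := by
  have hσ1 : |σ| = 1 := by rcases hσ with h | h <;> simp [h]
  have hσ2 : σ * σ = 1 := by rcases hσ with h | h <;> simp [h]
  have habs : ∀ j, |x j| = σ * x j := fun j => by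
    rw [← abs_of_pos (hxs j), abs_mul, hσ1, one_mul]
  have hR : 0 < R := (abs_nonneg _).trans_lt (hxR i)
  obtain ⟨l, hl, hl1, hlx⟩ := exists_small (fun j => |x j| / R) (fun j => by
    have := hxs j
    rw [habs]; positivity)
  have hax : (fun j => |x j|) ∈ K := box_mem hK hu hx fun j => by simp
  have hq : Pi.single i (p i) ∈ K := box_mem hK hu hp fun j => by
    by_cases h : j = i
    · subst h; simp
    · simp [h]
  have hy := hK hax hq (by linarith : 0 ≤ 1 - l) hl.le (by ring)
  refine ⟨l * R, by positivity, box_int hK hu hy fun j => ?_⟩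
  have h1 : l * R < |x j| := by have := hlx j; rwa [lt_div_iff₀ hR] at this
  have h0 : |(x + (l * R) • d) j| = |σ * x j + (l * R) * (σ * d j)| := by
    rw [show σ * x j + (l * R) * (σ * d j) = σ * (x j + (l * R) * d j) by ring, abs_mul, hσ1,
      one_mul]
    simp
  rw [h0]
  refine lt_of_lt_of_le ?_ (le_abs_self _)
  simp only [Pi.add_apply, Pi.smul_apply, smul_eq_mul]
  have h3 := hxR j
  rw [← habs j]
  by_cases h : j = i
  · subst h
    rw [hdi, ← mul_assoc σ, hσ2, one_mul, abs_of_pos (by positivity)]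
    simp only [Pi.single_eq_same]
    nlinarith
  · rw [hdj j h, mul_neg, hσ2]
    simp only [Pi.single_eq_of_ne h]
    rw [abs_lt]; constructor <;> nlinarith [abs_nonneg (x j)]

/-- The direction attached to a set `P` of positive coordinates. -/
noncomputable def tiltDir {n : ℕ} (η : ℝ) (P : Finset (Fin n)) : Fin n → ℝ := fun i =>
  if i ∈ P then (if P.card = 1 then η else 1) else -(if Pᶜ.card = 1 then η else 1)

lemma tiltDir_compl {n : ℕ} (η : ℝ) (P : Finset (Fin n)) : tiltDir η Pᶜ = -tiltDir η P := by
  ext i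
  by_cases h : i ∈ P <;> simp [tiltDir, h]

lemma isParallelepiped_of_box {n : ℕ} (M : Fin n → ℝ) (hM : ∀ i, 0 < M i) {K : Set (Fin n → ℝ)}
    (hK : ∀ x, x ∈ K ↔ ∀ i, |x i| ≤ M i) : IsParallelepiped K := by
  refine ⟨(LinearEquiv.piCongrRight
    (fun i => LinearEquiv.smulOfNeZero ℝ ℝ (M i) (hM i).ne')).toAffineEquiv, ?_⟩
  ext x
  rw [hK]
  constructor
  · intro h
    refine ⟨fun i => x i / M i, ⟨fun i => ?_, fun i => ?_⟩, ?_⟩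
    · have := (abs_le.1 (h i)).1
      change -1 ≤ x i / M i
      rw [le_div_iff₀ (hM i)]; linarith
    · have := (abs_le.1 (h i)).2
      change x i / M i ≤ 1
      rw [div_le_iff₀ (hM i)]; linarith
    · ext i
      change M i * (x i / M i) = x i
      have := (hM i).ne'
      field_simp
  · rintro ⟨y, ⟨h1, h2⟩, rfl⟩ i
    change |M i * y i| ≤ M i
    have h1 := h1 i
    have h2 := h2 i
    have := hM i
    simp only at h1 h2
    rw [abs_le]; constructor <;> nlinarith

/-- Every cubelike 1-unconditional convex body in `ℝ^n`, `n ≥ 3`,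
that is not a parallelepiped satisfies `𝕀(K) ≤ 2^n - 2`, witnessed by a symmetric
set of nonzero directions. -/
theorem stmt3 (n : ℕ) (hn : 3 ≤ n) (K : Set (Fin n → ℝ))
    (hbody : IsConvexBody K) (huncond : Unconditional K) (hcube : Cubelike K)
    (hpar : ¬ IsParallelepiped K) :
    illumNumber K ≤ 2 ^ n - 2 ∧
      ∃ D : Finset (Fin n → ℝ), (∀ d ∈ D, d ≠ 0) ∧ (∀ d ∈ D, -d ∈ D) ∧
        D.card ≤ 2 ^ n - 2 ∧ IlluminatesSet K ↑D := by
  obtain ⟨hconv, hcomp, hint⟩ := hbody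
  suffices hD : ∃ D : Finset (Fin n → ℝ), (∀ d ∈ D, d ≠ 0) ∧ (∀ d ∈ D, -d ∈ D) ∧
        D.card ≤ 2 ^ n - 2 ∧ IlluminatesSet K ↑D by
    refine ⟨?_, hD⟩
    obtain ⟨D, h0, -, hcard, hill⟩ := hD
    have h : illumNumber K ≤ D.card := Nat.sInf_le ⟨D, rfl, h0, hill⟩
    exact h.trans hcard
  have hne : K.Nonempty := hint.mono interior_subset
  obtain ⟨e₀, he₀⟩ := hcomp.extremePoints_nonempty hne
  have hmax : ∀ i : Fin n, ∃ p ∈ K, ∀ x ∈ K, |x i| ≤ p i := by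
    intro i
    obtain ⟨p, hp, hpm⟩ := hcomp.exists_isMaxOn hne
      (f := fun x : Fin n → ℝ => x i) (by fun_prop)
    refine ⟨p, hp, fun x hx => ?_⟩
    exact hpm (box_mem hconv huncond hx (fun j => by simp) : (fun j => |x j|) ∈ K)
  choose p hpK hpmax using hmax
  have hMpos : ∀ i, 0 < p i i := fun i =>
    (abs_pos.2 (hcube e₀ he₀ i)).trans_le (hpmax i e₀ (extremePoints_subset he₀))
  have hm : (fun i => p i i) ∉ K := by
    intro hmK
    apply hpar
    refine isParallelepiped_of_box (fun i => p i i) hMpos fun x => ⟨fun hx i => hpmax i x hx,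
      fun h => box_mem hconv huncond hmK fun i => (h i).trans (le_abs_self _)⟩
  obtain ⟨δ, hδ, hball⟩ := Metric.isOpen_iff.1 hcomp.isClosed.isOpen_compl _ hm
  have hgap : ∀ x ∈ K, ∃ i, |x i| + δ ≤ p i i := by
    intro x hx
    by_contra hcon
    push Not at hcon
    have hax : (fun j => |x j|) ∈ K := box_mem hconv huncond hx fun j => by simp
    refine hball ?_ hax
    rw [Metric.mem_ball, dist_pi_lt_iff hδ]
    intro i
    have h1 := hcon i
    have h2 := hpmax i x hx
    rw [Real.dist_eq, abs_lt]
    constructor <;> linarith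
  obtain ⟨R₀, hR₀⟩ := hcomp.isBounded.exists_norm_le
  obtain ⟨R, hR, hR1⟩ : ∃ R : ℝ, (∀ x ∈ K, ∀ i, |x i| < R) ∧ 0 < R := by
    refine ⟨|R₀| + 1, fun x hx i => ?_, by positivity⟩
    have h1 := norm_le_pi_norm x i
    have h2 := hR₀ x hx
    have h3 := le_abs_self R₀
    rw [Real.norm_eq_abs] at h1
    linarith
  obtain ⟨η, hη, hη1, hηR⟩ : ∃ η : ℝ, 0 < η ∧ η ≤ 1 ∧ R * η < δ := by
    refine ⟨min 1 (δ / (2 * R)), by positivity, min_le_left _ _, ?_⟩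
    have h1 : R * min 1 (δ / (2 * R)) ≤ R * (δ / (2 * R)) :=
      mul_le_mul_of_nonneg_left (min_le_right _ _) hR1.le
    have h2 : R * (δ / (2 * R)) = δ / 2 := by field_simp
    linarith
  have hpos : ∀ (P : Finset (Fin n)) i, i ∈ P → 0 < tiltDir η P i := by
    intro P i hi
    simp only [tiltDir, hi, if_true]
    split_ifs <;> linarith
  have hneg : ∀ (P : Finset (Fin n)) i, i ∉ P → tiltDir η P i < 0 := by
    intro P i hi
    simp only [tiltDir, hi, if_false]
    split_ifs <;> linarith
  have hle : ∀ (P : Finset (Fin n)) i, |tiltDir η P i| ≤ 1 := by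
    intro P i
    simp only [tiltDir]
    rw [abs_le]
    split_ifs <;> constructor <;> linarith
  have hi0 : Nonempty (Fin n) := ⟨⟨0, by omega⟩⟩
  have hcard1 : ∀ i : Fin n, (({i} : Finset (Fin n))ᶜ).card = n - 1 := by
    intro i; rw [Finset.card_compl]; simp
  have hcompl_ne : ∀ i : Fin n, (({i} : Finset (Fin n))ᶜ) ≠ ∅ := by
    intro i h
    have := hcard1 i
    rw [h] at this
    simp at this
    omega
  have hsing_ne : ∀ i : Fin n, ({i} : Finset (Fin n)) ≠ Finset.univ := by
    intro i h
    apply hcompl_ne i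
    rw [h, Finset.compl_univ]
  classical
  set F : Finset (Finset (Fin n)) := (Finset.univ.erase ∅).erase Finset.univ with hF
  have hFmem : ∀ P : Finset (Fin n), P ∈ F ↔ P ≠ Finset.univ ∧ P ≠ ∅ := by
    intro P; simp [hF]
  refine ⟨F.image (tiltDir η), ?_, ?_, ?_, ?_⟩
  · intro d hd h0
    obtain ⟨P, -, rfl⟩ := Finset.mem_image.1 hd
    obtain ⟨i⟩ := hi0
    have h1 : tiltDir η P i = 0 := by rw [h0]; rfl
    by_cases hi : i ∈ P
    · exact (hpos P i hi).ne' h1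
    · exact (hneg P i hi).ne h1
  · intro d hd
    obtain ⟨P, hP, rfl⟩ := Finset.mem_image.1 hd
    rw [← tiltDir_compl]
    refine Finset.mem_image_of_mem _ ?_
    rw [hFmem] at hP ⊢
    refine ⟨fun h => hP.2 ?_, fun h => hP.1 ?_⟩
    · rw [← compl_compl P, h, Finset.compl_univ]
    · rw [← compl_compl P, h, Finset.compl_empty]
  · refine Finset.card_image_le.trans ?_
    rw [hF, Finset.card_erase_of_mem, Finset.card_erase_of_mem (Finset.mem_univ _)]
    · simp [Finset.card_univ]
      omega
    · simp [Finset.univ_nonempty.ne_empty]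
  · intro x hx
    have hxK : x ∈ K := hcomp.isClosed.frontier_subset hx
    obtain ⟨e, he, hed⟩ := exists_extreme_aux hconv hcomp _ x hxK le_rfl
    have heK := extremePoints_subset he
    have he0 := hcube e he
    suffices h : ∃ P ∈ F, Illuminates K (tiltDir η P) e by
      obtain ⟨P, hP, h⟩ := h
      exact ⟨_, Finset.mem_coe.2 (Finset.mem_image_of_mem _ hP), hed _ h⟩
    obtain ⟨i, hi⟩ := hgap e heK
    have hcn : n - 1 ≠ 1 := by omega
    by_cases hA : ∀ j, 0 < e j
    · refine ⟨{i}, (hFmem _).2 ⟨hsing_ne i, Finset.singleton_ne_empty i⟩, ?_⟩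
      refine illum_tilt hconv huncond (i := i) (σ := 1) (R := R) (η := η) (Or.inl rfl) heK (hpK i)
        (fun j => by rw [one_mul]; exact hA j) (hR e heK) hη (by linarith) ?_ ?_
      · simp [tiltDir]
      · intro j hj
        simp [tiltDir, hj, hcard1, hcn]
    by_cases hB : ∀ j, e j < 0
    · refine ⟨{i}ᶜ, (hFmem _).2 ⟨?_, hcompl_ne i⟩, ?_⟩
      · intro h
        have : i ∈ ({i} : Finset (Fin n))ᶜ := by rw [h]; exact Finset.mem_univ i
        simp at this
      rw [tiltDir_compl]
      refine illum_tilt hconv huncond (i := i) (σ := -1) (R := R) (η := η) (Or.inr rfl) heK (hpK i)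
        (fun j => by have := hB j; linarith) (hR e heK) hη (by linarith) ?_ ?_
      · simp [tiltDir]
      · intro j hj
        simp [tiltDir, hj, hcard1, hcn]
    push Not at hA hB
    obtain ⟨a, ha⟩ := hA
    obtain ⟨b, hb⟩ := hB
    refine ⟨Finset.univ.filter (fun j => e j < 0), (hFmem _).2 ⟨?_, ?_⟩, ?_⟩
    · intro h
      have h1 : b ∈ Finset.univ.filter (fun j => e j < 0) := by rw [h]; exact Finset.mem_univ b
      have h2 := (Finset.mem_filter.1 h1).2
      linarith
    · intro h
      have h1 : a ∈ Finset.univ.filter (fun j => e j < 0) :=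
        Finset.mem_filter.2 ⟨Finset.mem_univ a, lt_of_le_of_ne ha (he0 a)⟩
      rw [h] at h1
      simp at h1
    · refine illum_opposite hconv huncond heK (hle _) fun j => ?_
      rcases lt_or_gt_of_ne (he0 j) with h | h
      · exact mul_neg_of_pos_of_neg (hpos _ j (by simp [h])) h
      · exact mul_neg_of_neg_of_pos (hneg _ j (by simp [h.le])) h
end

section
/- Let B ∈ 𝒰³ and suppose there is exactly one unordered pair {i₁,i₂} of distinct indices in {1,2,3} with e_{i₁} + e_{i₂} ∈ B. Then there exist δ ∈ (0,1) and a permutation σ of the coordinates {1,2,3} such that the set obtained by applying σ to {±(1,δ,0), ±(−δ,1,0), ±(0,0,1)} illuminates B. In particular 𝕀(B) ≤ 6. -/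
open Set

lemma aux_upd {B : Set (Fin 3 → ℝ)} (hc : Convex ℝ B) (hu : Unconditional B)
    {x : Fin 3 → ℝ} (hx : x ∈ B) (i : Fin 3) (v : ℝ) (hv : |v| ≤ |x i|) :
    Function.update x i v ∈ B := by
  by_cases h0 : x i = 0
  · have : v = x i := by
      rw [h0] at hv ⊢
      simpa using hv
    rw [this]; simpa using hx
  have hr := hu x hx (fun m => if m = i then -1 else 1) (fun m => by
    by_cases h : m = i <;> simp [h])
  have hq : |v / x i| ≤ 1 := by
    rw [abs_div]; exact div_le_one_of_le₀ hv (abs_nonneg _)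
  obtain ⟨h1, h2⟩ := abs_le.1 hq
  have := hc hx hr (a := (1 + v / x i) / 2) (b := (1 - v / x i) / 2)
    (by linarith) (by linarith) (by ring)
  convert this using 1
  ext m
  by_cases h : m = i
  · subst h
    simp
    field_simp
    ring
  · simp [h]
    ring

lemma aux_mono {B : Set (Fin 3 → ℝ)} (hc : Convex ℝ B) (hu : Unconditional B)
    {x : Fin 3 → ℝ} (hx : x ∈ B) (y : Fin 3 → ℝ) (h : ∀ m, |y m| ≤ |x m|) : y ∈ B := by
  have h1 := aux_upd hc hu hx 0 (y 0) (h 0)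
  have h2 := aux_upd hc hu h1 1 (y 1) (by simpa using h 1)
  have h3 := aux_upd hc hu h2 2 (y 2) (by simpa using h 2)
  convert h3 using 1
  ext m
  fin_cases m <;> simp

lemma aux_int {B : Set (Fin 3 → ℝ)} (hc : Convex ℝ B) (hu : Unconditional B)
    {x : Fin 3 → ℝ} (hx : x ∈ B) (y : Fin 3 → ℝ) (h : ∀ m, |y m| < |x m|) :
    y ∈ interior B := by
  have ho : IsOpen {y : Fin 3 → ℝ | ∀ m, |y m| < |x m|} := by
    simp only [Set.ofPred_forall]
    exact isOpen_iInter_of_finite fun m => isOpen_lt (by fun_prop) (by fun_prop)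
  exact interior_maximal (fun z hz => aux_mono hc hu hx z fun m => (hz m).le) ho h

lemma aux_comb {B : Set (Fin 3 → ℝ)} (hc : Convex ℝ B) {p q r : Fin 3 → ℝ}
    (hp : p ∈ B) (hq : q ∈ B) (hr : r ∈ B) (a b c : ℝ) (ha : 0 ≤ a) (hb : 0 ≤ b) (h0 : 0 ≤ c)
    (h : a + b + c = 1) : a • p + b • q + c • r ∈ B := by
  have := hc.sum_mem (t := Finset.univ) (w := ![a, b, c]) (z := ![p, q, r])
    (by intro i _; fin_cases i <;> simpa) (by simpa [Fin.sum_univ_three] using h)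
    (by intro i _; fin_cases i <;> simpa)
  simpa [Fin.sum_univ_three] using this

lemma aux_abs {B : Set (Fin 3 → ℝ)} (hc : Convex ℝ B) (hu : Unconditional B)
    {x : Fin 3 → ℝ} (hx : x ∈ B) : (fun m => |x m|) ∈ B :=
  aux_mono hc hu hx _ (by simp)

/-- opposite signs: absolute value decreases -/
lemma aux_sub {a d e : ℝ} (h : a * d < 0) (he : 0 ≤ e) (h1 : e * |d| ≤ |a|) :
    |a + e * d| = |a| - e * |d| := by
  rcases mul_neg_iff.1 h with ⟨p, q⟩ | ⟨p, q⟩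
  · rw [abs_of_pos p, abs_of_neg q] at *
    rw [abs_of_nonneg] <;> linarith
  · rw [abs_of_neg p, abs_of_pos q] at *
    rw [abs_of_nonpos] <;> linarith

lemma aux_illum1 {B : Set (Fin 3 → ℝ)} (hc : Convex ℝ B) (hu : Unconditional B)
    {i j k : Fin 3} (hij : i ≠ j) (hik : i ≠ k) (hjk : j ≠ k)
    (hall : ∀ m, m = i ∨ m = j ∨ m = k) (hk : stdB k ∈ B)
    {x d : Fin 3 → ℝ} (hx : x ∈ B) (h1 : |x i| ≤ 1) (h2 : |x j| ≤ 1) (h3 : |x k| < 1)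
    (di : x i * d i < 0) (dj : x j * d j < 0) (dk : d k = 0) : Illuminates B d x := by
  have xi : 0 < |x i| := abs_pos.2 fun h => by simp [h] at di
  have xj : 0 < |x j| := abs_pos.2 fun h => by simp [h] at dj
  have pi : 0 < |d i| := abs_pos.2 fun h => by simp [h] at di
  have pj : 0 < |d j| := abs_pos.2 fun h => by simp [h] at dj
  obtain ⟨e, he, hei, hej⟩ : ∃ e : ℝ, 0 < e ∧ e * |d i| ≤ |x i| ∧ e * |d j| ≤ |x j| := by
    refine ⟨min (|x i| / |d i|) (|x j| / |d j|), by positivity, ?_, ?_⟩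
    · exact (le_div_iff₀ pi).1 (min_le_left _ _)
    · exact (le_div_iff₀ pj).1 (min_le_right _ _)
  obtain ⟨t, ht, hti, htj⟩ : ∃ t : ℝ, 0 < t ∧ t < e * |d i| ∧ t < e * |d j| := by
    have : 0 < min (e * |d i|) (e * |d j|) := by positivity
    obtain ⟨t, h, h'⟩ := exists_between this
    exact ⟨t, h, lt_of_lt_of_le h' (min_le_left _ _), lt_of_lt_of_le h' (min_le_right _ _)⟩
  refine ⟨e, he, ?_⟩
  have hz := hc (aux_abs hc hu hx) hk (a := 1 - t) (b := t) (by linarith) ht.le (by ring)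
  apply aux_int hc hu hz
  intro m
  refine lt_of_lt_of_le ?_ (le_abs_self _)
  rcases hall m with rfl | rfl | rfl
  · simp [stdB, hik, hik.symm]
    rw [aux_sub di he.le hei]
    nlinarith
  · simp [stdB, hjk, hjk.symm]
    rw [aux_sub dj he.le hej]
    nlinarith
  · simp [stdB, dk]
    nlinarith

lemma aux_illum2 {B : Set (Fin 3 → ℝ)} (hc : Convex ℝ B) (hu : Unconditional B)
    {i j k : Fin 3} (hij : i ≠ j) (hik : i ≠ k) (hjk : j ≠ k)
    (hall : ∀ m, m = i ∨ m = j ∨ m = k) (hk : stdB k ∈ B) (hs : stdB i + stdB j ∈ B)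
    {δ : ℝ} (hδ : 0 < δ) (hδ1 : δ < 1)
    {x d : Fin 3 → ℝ} (hx : x ∈ B) (h1 : |x i| = 1) (h2 : x j = 0) (h3 : |x k| < 1 - δ)
    (di : x i * d i < 0) (di1 : |d i| = 1) (dj : |d j| = δ) (dk : d k = 0) :
    Illuminates B d x := by
  refine ⟨1 / 2, by norm_num, ?_⟩
  have hz := aux_comb hc (aux_abs hc hu hx) hk hs
    (1 - (1 - δ / 2) / 2 - δ * (1 + δ / 4) / 2) ((1 - δ / 2) / 2) (δ * (1 + δ / 4) / 2)
    (by nlinarith) (by nlinarith) (by positivity) (by ring)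
  apply aux_int hc hu hz
  intro m
  refine lt_of_lt_of_le ?_ (le_abs_self _)
  have hx0 := abs_nonneg (x k)
  rcases hall m with rfl | rfl | rfl
  · have := aux_sub (e := 1 / 2) di (by norm_num) (by rw [di1, h1]; norm_num)
    simp only [Pi.add_apply, Pi.smul_apply, smul_eq_mul]
    rw [this]
    simp [stdB, hik, hik.symm, hij, hij.symm, h1, di1]
    nlinarith
  · simp [stdB, hjk, hjk.symm, hij, hij.symm, h2, dj, abs_mul]
    nlinarith
  · simp [stdB, hjk, hjk.symm, hik, hik.symm, dk]
    have : δ * (1 + δ / 4) / 2 * (1 - δ) < (1 - δ / 2) / 2 * δ := by nlinarith [mul_pos hδ hδ, mul_pos (mul_pos hδ hδ) hδ]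
    have e1 : δ * (1 + δ / 4) / 2 * |x m| ≤ δ * (1 + δ / 4) / 2 * (1 - δ) := by gcongr
    have e2 : (1 - δ / 2) / 2 * δ ≤ (1 - δ / 2) / 2 * (1 - |x m|) := by
      apply mul_le_mul_of_nonneg_left <;> linarith
    nlinarith

lemma aux_le_one {B : Set (Fin 3 → ℝ)} (hc : Convex ℝ B) (hu : Unconditional B)
    (hb : ∀ m : Fin 3, stdB m ∈ B) 
    {i j k : Fin 3} (hij : i ≠ j) (hik : i ≠ k) (hjk : j ≠ k)
    (hall : ∀ m, m = i ∨ m = j ∨ m = k) (hf : (stdB i : Fin 3 → ℝ) ∈ frontier B)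
    {x : Fin 3 → ℝ} (hx : x ∈ B) : |x i| ≤ 1 := by
  by_contra! h
  refine hf.2 ?_
  have hp : 0 < |x i| := by linarith
  obtain ⟨s, hs, hs1⟩ : ∃ s : ℝ, |x i|⁻¹ < s ∧ s < 1 := exists_between (inv_lt_one_of_one_lt₀ h)
  have hs0 : 0 < s := lt_trans (by positivity) hs
  have hm : 1 < s * |x i| := by
    rwa [inv_lt_iff_one_lt_mul₀ hp] at hs
  have hz := aux_comb hc (aux_abs hc hu hx) (hb j) (hb k) s ((1 - s) / 2) ((1 - s) / 2)
    hs0.le (by linarith) (by linarith) (by ring)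
  apply aux_int hc hu hz
  intro m
  refine lt_of_lt_of_le ?_ (le_abs_self _)
  rcases hall m with rfl | rfl | rfl
  · simpa [stdB, hij, hij.symm, hik, hik.symm] using hm
  · simp [stdB, hij, hij.symm, hjk, hjk.symm]
    positivity
  · simp [stdB, hik, hik.symm, hjk, hjk.symm]
    positivity

lemma aux_delta {B : Set (Fin 3 → ℝ)} (hcl : IsClosed B) (i k : Fin 3)
    (h : (stdB i + stdB k : Fin 3 → ℝ) ∉ B) :
    ∃ δ₀ : ℝ, 0 < δ₀ ∧ ∀ δ, 0 < δ → δ < δ₀ → (stdB i + (1 - δ) • stdB k : Fin 3 → ℝ) ∉ B := by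
  have hcont : Continuous fun δ : ℝ => (stdB i + (1 - δ) • stdB k : Fin 3 → ℝ) := by fun_prop
  have ho : IsOpen {δ : ℝ | (stdB i + (1 - δ) • stdB k : Fin 3 → ℝ) ∉ B} :=
    hcl.isOpen_compl.preimage hcont
  obtain ⟨r, hr, hb⟩ := Metric.isOpen_iff.1 ho 0 (by simpa using h)
  refine ⟨r, hr, fun δ h0 h1 => hb ?_⟩
  simp [abs_of_pos h0, h1]

lemma aux_lt {B : Set (Fin 3 → ℝ)} (hc : Convex ℝ B) (hu : Unconditional B)
    {i j k : Fin 3} (hij : i ≠ j) (hik : i ≠ k) (hjk : j ≠ k)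
    (hall : ∀ m, m = i ∨ m = j ∨ m = k) {δ : ℝ} (hδ1 : δ < 1)
    (h : (stdB i + (1 - δ) • stdB k : Fin 3 → ℝ) ∉ B)
    {x : Fin 3 → ℝ} (hx : x ∈ B) (h1 : |x i| = 1) : |x k| < 1 - δ := by
  by_contra! h'
  refine h (aux_mono hc hu hx _ fun m => ?_)
  rcases hall m with rfl | rfl | rfl
  · simp [stdB, hik, hik.symm, h1]
  · simp [stdB, hij, hij.symm, hjk, hjk.symm]
  · simp [stdB, hik, hik.symm]
    rwa [abs_of_pos (by linarith)]

lemma aux_main (B : Set (Fin 3 → ℝ)) (hB : memU B)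
    {i j k : Fin 3} (hij : i ≠ j) (hik : i ≠ k) (hjk : j ≠ k)
    (hall : ∀ m, m = i ∨ m = j ∨ m = k) (hs : (stdB i + stdB j : Fin 3 → ℝ) ∈ B)
    (hn1 : (stdB i + stdB k : Fin 3 → ℝ) ∉ B) (hn2 : (stdB j + stdB k : Fin 3 → ℝ) ∉ B) :
    ∃ δ : ℝ, 0 < δ ∧ δ < 1 ∧ ∀ x ∈ frontier B, ∃ a b c : ℝ,
      ((a = 1 ∧ b = δ ∧ c = 0) ∨ (a = -1 ∧ b = -δ ∧ c = 0) ∨ (a = -δ ∧ b = 1 ∧ c = 0) ∨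
       (a = δ ∧ b = -1 ∧ c = 0) ∨ (a = 0 ∧ b = 0 ∧ c = 1) ∨ (a = 0 ∧ b = 0 ∧ c = -1)) ∧
      ∀ d : Fin 3 → ℝ, d i = a → d j = b → d k = c → Illuminates B d x := by
  obtain ⟨⟨hc, hcomp, -⟩, hu, hf⟩ := hB
  have hcl := hcomp.isClosed
  have hb : ∀ m : Fin 3, stdB m ∈ B := fun m => hcl.frontier_subset (hf m)
  have hall2 : ∀ m, m = j ∨ m = i ∨ m = k := fun m => by have := hall m; tauto
  obtain ⟨r1, hr1, H1⟩ := aux_delta hcl i k hn1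
  obtain ⟨r2, hr2, H2⟩ := aux_delta hcl j k hn2
  obtain ⟨δ, h0, hδ⟩ := exists_between (show 0 < min 1 (min r1 r2) by positivity)
  simp only [lt_min_iff] at hδ
  obtain ⟨hδ1, hδr1, hδr2⟩ := hδ
  specialize H1 δ h0 hδr1
  specialize H2 δ h0 hδr2
  refine ⟨δ, h0, hδ1, fun x hx => ?_⟩
  have hxB := hcl.frontier_subset hx
  have l1 : |x i| ≤ 1 := aux_le_one hc hu hb hij hik hjk hall (hf i) hxB
  have l2 : |x j| ≤ 1 := aux_le_one hc hu hb hij.symm hjk hik hall2 (hf j) hxB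
  have hs' : (stdB j + stdB i : Fin 3 → ℝ) ∈ B := by rwa [add_comm]
  have A : |x k| < 1 → ∀ d : Fin 3 → ℝ, x i * d i < 0 → x j * d j < 0 → d k = 0 →
      Illuminates B d x := fun h3 d p q r =>
    aux_illum1 hc hu hij hik hjk hall (hb k) hxB l1 l2 h3 p q r
  have A1 : |x i| = 1 → |x k| < 1 - δ := aux_lt hc hu hij hik hjk hall hδ1 H1 hxB
  have A2 : |x j| = 1 → |x k| < 1 - δ := aux_lt hc hu hij.symm hjk hik hall2 hδ1 H2 hxB
  have C1 : |x i| = 1 → x j = 0 → ∀ d : Fin 3 → ℝ, x i * d i < 0 → |d i| = 1 → |d j| = δ →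
      d k = 0 → Illuminates B d x := fun p q d =>
    aux_illum2 hc hu hij hik hjk hall (hb k) hs h0 hδ1 hxB p q (A1 p)
  have C2 : |x j| = 1 → x i = 0 → ∀ d : Fin 3 → ℝ, x j * d j < 0 → |d j| = 1 → |d i| = δ →
      d k = 0 → Illuminates B d x := fun p q d =>
    aux_illum2 hc hu hij.symm hjk hik hall2 (hb k) hs' h0 hδ1 hxB p q (A2 p)
  by_cases hlt : |x i| < 1 ∧ |x j| < 1
  · -- interior of the square: use the third axis
    obtain ⟨t, ht, ht1⟩ := exists_between (show 0 < min (1 - |x i|) (1 - |x j|) by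
      have := hlt.1; have := hlt.2; simp; constructor <;> linarith)
    simp only [lt_min_iff] at ht1
    have hz := hc hs (hb k) (a := 1 - t) (b := t) (by linarith [abs_nonneg (x i)]) ht.le (by ring)
    have key : ∀ y : Fin 3 → ℝ, y i = x i → y j = x j → y k = 0 → y ∈ interior B := by
      intro y yi yj yk
      apply aux_int hc hu hz
      intro m
      refine lt_of_lt_of_le ?_ (le_abs_self _)
      rcases hall m with rfl | rfl | rfl
      · simp [stdB, hij, hij.symm, hik, hik.symm, yi]; linarith
      · simp [stdB, hij, hij.symm, hjk, hjk.symm, yj]; linarith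
      · simp [stdB, hik, hik.symm, hjk, hjk.symm, yk]; linarith
    rcases lt_trichotomy (x k) 0 with h | h | h
    · refine ⟨0, 0, 1, by simp, fun d e1 e2 e3 => ⟨-x k, by linarith, key _ ?_ ?_ ?_⟩⟩ <;>
        simp [e1, e2, e3]
    · exact absurd (key x rfl rfl h) hx.2
    · refine ⟨0, 0, -1, by simp, fun d e1 e2 e3 => ⟨x k, by linarith, key _ ?_ ?_ ?_⟩⟩ <;>
        simp [e1, e2, e3]
  have hk1 : |x k| < 1 := by
    by_cases h : |x i| < 1
    · have : |x j| = 1 := le_antisymm l2 (by by_contra! h'; exact hlt ⟨h, h'⟩)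
      linarith [A2 this]
    · linarith [A1 (le_antisymm l1 (not_lt.1 h))]
  rcases lt_trichotomy (x i) 0 with hi | hi | hi <;> rcases lt_trichotomy (x j) 0 with hj | hj | hj
  · refine ⟨1, δ, 0, by simp, fun d e1 e2 e3 => A hk1 d ?_ ?_ e3⟩ <;> rw [‹d _ = _›] <;> nlinarith
  · have hi1 : |x i| = 1 := le_antisymm l1 (by by_contra! h'; exact hlt ⟨h', by simp [hj]⟩)
    refine ⟨1, δ, 0, by simp, fun d e1 e2 e3 => C1 hi1 hj d ?_ ?_ ?_ e3⟩
    · rw [e1]; linarith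
    · simp [e1]
    · simp [e2, abs_of_pos h0]
  · refine ⟨δ, -1, 0, by simp, fun d e1 e2 e3 => A hk1 d ?_ ?_ e3⟩ <;> rw [‹d _ = _›] <;> nlinarith
  · have hj1 : |x j| = 1 := le_antisymm l2 (by by_contra! h'; exact hlt ⟨by simp [hi], h'⟩)
    refine ⟨-δ, 1, 0, by simp, fun d e1 e2 e3 => C2 hj1 hi d ?_ ?_ ?_ e3⟩
    · rw [e2]; linarith
    · simp [e2]
    · simp [e1, abs_of_pos h0]
  · exact absurd (by simp [hi, hj]) hlt
  · have hj1 : |x j| = 1 := le_antisymm l2 (by by_contra! h'; exact hlt ⟨by simp [hi], h'⟩)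
    refine ⟨δ, -1, 0, by simp, fun d e1 e2 e3 => C2 hj1 hi d ?_ ?_ ?_ e3⟩
    · rw [e2]; linarith
    · simp [e2]
    · simp [e1, abs_of_pos h0]
  · refine ⟨-δ, 1, 0, by simp, fun d e1 e2 e3 => A hk1 d ?_ ?_ e3⟩ <;> rw [‹d _ = _›] <;> nlinarith
  · have hi1 : |x i| = 1 := le_antisymm l1 (by by_contra! h'; exact hlt ⟨h', by simp [hj]⟩)
    refine ⟨-1, -δ, 0, by simp, fun d e1 e2 e3 => C1 hi1 hj d ?_ ?_ ?_ e3⟩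
    · rw [e1]; linarith
    · simp [e1]
    · simp [e2, abs_of_pos h0]
  · refine ⟨-1, -δ, 0, by simp, fun d e1 e2 e3 => A hk1 d ?_ ?_ e3⟩ <;> rw [‹d _ = _›] <;> nlinarith

lemma aux_perm : ∀ i j : Fin 3, i ≠ j → ∃ k : Fin 3, i ≠ k ∧ j ≠ k ∧
    (∀ m, m = i ∨ m = j ∨ m = k) ∧ ∃ σ : Equiv.Perm (Fin 3), σ i = 0 ∧ σ j = 1 ∧ σ k = 2 := by
  decide

/-- If `B ∈ 𝒰³` contains `e_{i₁} + e_{i₂}` for exactly one unordered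
pair of distinct indices, then some coordinate permutation of
`{±(1,δ,0), ±(-δ,1,0), ±(0,0,1)}` illuminates `B`, for a suitable `δ ∈ (0,1)`;
in particular `𝕀(B) ≤ 6`. -/
theorem stmt8 (B : Set (Fin 3 → ℝ)) (hB : memU B)
    (i₁ i₂ : Fin 3) (hne : i₁ ≠ i₂) (hmem : stdB i₁ + stdB i₂ ∈ B)
    (huniq : ∀ k l : Fin 3, k ≠ l → stdB k + stdB l ∈ B →
      (k = i₁ ∧ l = i₂) ∨ (k = i₂ ∧ l = i₁)) :
    ∃ δ : ℝ, 0 < δ ∧ δ < 1 ∧ ∃ σ : Equiv.Perm (Fin 3),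
      IlluminatesSet B ((fun d => d ∘ σ) ''
        ({![1, δ, 0], -![1, δ, 0], ![-δ, 1, 0], -![-δ, 1, 0],
          ![0, 0, 1], -![0, 0, 1]} : Set (Fin 3 → ℝ))) ∧
      illumNumber B ≤ 6 := by
  obtain ⟨k, hik, hjk, hall, σ, s0, s1, s2⟩ := aux_perm i₁ i₂ hne
  obtain ⟨δ, h0, h1, H⟩ := aux_main B hB hne hik hjk hall hmem
    (fun h => by
      rcases huniq _ _ hik h with ⟨-, h⟩ | ⟨h, -⟩
      · exact hjk h.symm
      · exact hne h)
    (fun h => by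
      rcases huniq _ _ hjk h with ⟨h, -⟩ | ⟨-, h⟩
      · exact hne h.symm
      · exact hik h.symm)
  have hI : IlluminatesSet B ((fun d => d ∘ σ) ''
        ({![1, δ, 0], -![1, δ, 0], ![-δ, 1, 0], -![-δ, 1, 0],
          ![0, 0, 1], -![0, 0, 1]} : Set (Fin 3 → ℝ))) := by
    intro x hx
    obtain ⟨a, b, c, habc, hd⟩ := H x hx
    refine ⟨![a, b, c] ∘ σ, mem_image_of_mem _ ?_, hd _ ?_ ?_ ?_⟩
    · rcases habc with ⟨rfl, rfl, rfl⟩ | ⟨rfl, rfl, rfl⟩ | ⟨rfl, rfl, rfl⟩ | ⟨rfl, rfl, rfl⟩ |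
        ⟨rfl, rfl, rfl⟩ | ⟨rfl, rfl, rfl⟩ <;> simp
    · simp [s0]
    · simp [s1]
    · simp [s2]
  refine ⟨δ, h0, h1, σ, hI, ?_⟩
  classical
  let D : Finset (Fin 3 → ℝ) := Finset.image (fun d => d ∘ σ)
    {![1, δ, 0], -![1, δ, 0], ![-δ, 1, 0], -![-δ, 1, 0], ![0, 0, 1], -![0, 0, 1]}
  have hD : D.card ≤ 6 := Finset.card_image_le.trans Finset.card_le_six
  refine le_trans (Nat.sInf_le ⟨D, rfl, ?_, ?_⟩) hD
  · intro d hd h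
    subst h
    obtain ⟨v, hv, hv0⟩ := Finset.mem_image.1 hd
    have e : ∀ m, v m = 0 := fun m => by
      have := congrFun hv0 (σ.symm m)
      simpa using this
    have e0 := e 0
    have e1 := e 1
    have e2 := e 2
    simp only [Finset.mem_insert, Finset.mem_singleton] at hv
    rcases hv with rfl | rfl | rfl | rfl | rfl | rfl <;> simp at e0 e1 e2
  · have : (D : Set (Fin 3 → ℝ)) = (fun d => d ∘ σ) ''
        ({![1, δ, 0], -![1, δ, 0], ![-δ, 1, 0], -![-δ, 1, 0],
          ![0, 0, 1], -![0, 0, 1]} : Set (Fin 3 → ℝ)) := by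
      simp only [D, Finset.coe_image, Finset.coe_insert, Finset.coe_singleton]
    rw [this]
    exact hI
end

section
/- Let n ≥ 3 and let B ∈ 𝒰^n satisfy 𝟙 − e_i ∈ B for every i ∈ {1,…,n}, but B ≠ [−1,1]^n. Then there exist δ ∈ (0,1) and a set D ⊆ G^n(δ) with D = −D and |D| = 2^n − 2 that illuminates B. In particular 𝕀(B) ≤ 2^n − 2. -/
open Set

/-- The set `G^n(δ)`: vectors with exactly one coordinate equal to `±1` and all
other coordinates equal to `±δ`. -/
def Gset (n : ℕ) (δ : ℝ) : Set (Fin n → ℝ) :=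
  {d | ∃ i : Fin n, (d i = 1 ∨ d i = -1) ∧ ∀ j, j ≠ i → d j = δ ∨ d j = -δ}


def NC {n : ℕ} (s : Fin n → Bool) : Prop := ∃ i j, s i ≠ s j

lemma exists_p (n : ℕ) (hn : 3 ≤ n) : ∃ p : (Fin n → Bool) → Fin n,
    (∀ s, p (fun i => !s i) = p s) ∧
    ∀ (t : Fin n → Bool) (z : Fin n), ∃ b, NC (Function.update t z b) ∧
      p (Function.update t z b) ≠ z := by
  classical
  let a : Fin n := ⟨0, by omega⟩
  let b : Fin n := ⟨1, by omega⟩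
  let c : Fin n := ⟨2, by omega⟩
  have hab : a ≠ b := by simp [a, b, Fin.ext_iff]
  have hac : a ≠ c := by simp [a, c, Fin.ext_iff]
  have hbc : b ≠ c := by simp [b, c, Fin.ext_iff]
  clear_value a b c
  refine ⟨fun s => if s a = s b then a else if ∀ i, i ≠ b → s i = s a then c else b, ?_, ?_⟩
  · intro s
    simp
  · intro t z
    by_cases hza : z = a
    · subst hza
      refine ⟨!t b, ⟨z, b, ?_⟩, ?_⟩
      · simp [Function.update_of_ne hab.symm]
      · simp only [Function.update_self, Function.update_of_ne hab.symm]
        split_ifs with h1 h2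
        · simp at h1
        · exact hac.symm
        · exact hab.symm
    by_cases hzb : z = b
    · subst hzb
      by_cases h : ∀ i, i ≠ z → t i = t a
      · refine ⟨!t a, ⟨z, a, ?_⟩, ?_⟩
        · simp [Function.update_of_ne hab]
        · simp only [Function.update_self, Function.update_of_ne hab]
          split_ifs with h1 h2
          · simp at h1
          · exact hbc.symm
          · exfalso; apply h2
            intro i hi
            rw [Function.update_of_ne hi]; exact h i hi
      · push Not at h
        obtain ⟨i, hi, hi2⟩ := h
        refine ⟨t a, ⟨i, a, ?_⟩, ?_⟩
        · rwa [Function.update_of_ne hi, Function.update_of_ne hab]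
        · simp [Function.update_of_ne hab, hab]
    · have hza' : a ≠ z := fun h => hza h.symm
      have hzb' : b ≠ z := fun h => hzb h.symm
      refine ⟨!t a, ⟨z, a, ?_⟩, ?_⟩
      · simp [Function.update_of_ne hza']
      · simp only [Function.update_of_ne hza', Function.update_of_ne hzb']
        split_ifs with h1 h2
        · exact hza'
        · have := h2 z hzb
          simp at this
        · exact hzb'

lemma dom {n : ℕ} {B : Set (Fin n → ℝ)} (hc : Convex ℝ B) (hu : Unconditional B)
    {w y : Fin n → ℝ} (hw : w ∈ B) (h : ∀ i, |y i| ≤ |w i|) : y ∈ B := by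
  have h1 : y ∈ Set.pi Set.univ (fun i => convexHull ℝ ({-w i, w i} : Set ℝ)) := by
    intro i _
    show y i ∈ convexHull ℝ ({-w i, w i} : Set ℝ)
    rw [convexHull_pair, segment_eq_uIcc]
    have := h i
    rw [Set.mem_uIcc]
    rcases abs_cases (w i) with h2 | h2
    · left; have := abs_le.1 this; constructor <;> linarith
    · right; have := abs_le.1 this; constructor <;> linarith
  rw [← convexHull_pi] at h1
  refine convexHull_min ?_ hc h1
  intro v hv
  have hv' : ∀ i, v i = -w i ∨ v i = w i := fun i => by simpa using hv i (Set.mem_univ i)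
  classical
  have := hu w hw (fun i => if v i = w i then 1 else -1) (fun i => by
    by_cases h : v i = w i <;> simp [h])
  convert this using 2 with i
  by_cases h : v i = w i
  · simp [h]
  · rcases hv' i with h' | h'
    · simp only [h, if_false]; linarith
    · exact absurd h' h

lemma dom_int {n : ℕ} {B : Set (Fin n → ℝ)} (hc : Convex ℝ B) (hu : Unconditional B)
    {w y : Fin n → ℝ} (hw : w ∈ B) (h : ∀ i, |y i| < w i) : y ∈ interior B := by
  rw [mem_interior]
  refine ⟨{v | ∀ i, |v i| < w i}, ?_, ?_, h⟩
  · intro v hv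
    exact dom hc hu hw (fun i => (hv i).le.trans (le_abs_self _))
  · rw [Set.ofPred_forall]
    exact isOpen_iInter_of_finite (fun i => isOpen_lt (by fun_prop) (by fun_prop))

lemma exists_eps {n : ℕ} (hn : 3 ≤ n) (x : Fin n → ℝ) (hx : ∀ i, x i ≠ 0) :
    ∃ ε : ℝ, 0 < ε ∧ ∀ i, ε ≤ |x i| := by
  haveI : Nonempty (Fin n) := ⟨⟨0, by omega⟩⟩
  obtain ⟨i, hi⟩ := Finite.exists_min (fun i => |x i|)
  exact ⟨|x i|, abs_pos.2 (hx i), hi⟩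

lemma sub_cube {n : ℕ} {B : Set (Fin n → ℝ)} (hB : memU B)
    (hall : ∀ i : Fin n, allOnes - stdB i ∈ B) {x : Fin n → ℝ} (hx : x ∈ B) (i : Fin n) :
    |x i| ≤ 1 := by
  obtain ⟨⟨hc, hk, -⟩, hu, hf⟩ := hB
  by_contra! hlt
  have hx' : (fun j => |x j|) ∈ B := dom hc hu hx (fun j => by simp)
  have key := hc hx' (hall i) (a := (|x i| + 1) / (2 * |x i|)) (b := (|x i| - 1) / (2 * |x i|))
    (by positivity) (div_nonneg (by linarith) (by positivity)) (by field_simp; ring)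
  have hb : 0 < (|x i| - 1) / (2 * |x i|) := div_pos (by linarith) (by positivity)
  have ha : 0 ≤ (|x i| + 1) / (2 * |x i|) := by positivity
  have : stdB i ∈ interior B := by
    refine dom_int hc hu key ?_
    intro j
    by_cases hj : j = i
    · subst hj
      have : (|x j| + 1) / (2 * |x j|) * |x j| = (|x j| + 1) / 2 := by field_simp
      simp [stdB, allOnes, this]
      linarith
    · simp [stdB, allOnes, hj]
      have := mul_nonneg ha (abs_nonneg (x j))
      linarith
  exact (hf i).2 this

/-- the gap constant -/
lemma exists_c {n : ℕ} {B : Set (Fin n → ℝ)} (hB : memU B)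
    (hall : ∀ i : Fin n, allOnes - stdB i ∈ B)
    (hne : B ≠ Set.Icc (fun _ => (-1 : ℝ)) (fun _ => 1)) :
    ∃ c : ℝ, 0 < c ∧ c < 1 ∧ ∀ x ∈ B, ∃ j, |x j| ≤ 1 - c := by
  have hcube := fun {x} hx i => sub_cube hB hall (x := x) hx i
  obtain ⟨⟨hc, hk, -⟩, hu, hf⟩ := hB
  have h1 : (fun _ => (1:ℝ)) ∉ B := by
    intro h1
    apply hne
    ext x
    constructor
    · intro hx
      exact ⟨fun i => (abs_le.1 (hcube hx i)).1, fun i => (abs_le.1 (hcube hx i)).2⟩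
    · rintro ⟨ha, hb⟩
      refine dom hc hu h1 (fun i => ?_)
      simpa [abs_le] using And.intro (ha i) (hb i)
  have hopen : IsOpen Bᶜ := hk.isClosed.isOpen_compl
  obtain ⟨r, hr, hball⟩ := Metric.isOpen_iff.1 hopen _ h1
  refine ⟨min (r/2) (1/2), by positivity, lt_of_le_of_lt (min_le_right _ _) (by norm_num), ?_⟩
  intro x hx
  by_contra! hlt
  set c := min (r/2) (1/2) with hcd
  have hc0 : 0 < c := by positivity
  have hcr : c ≤ r / 2 := min_le_left _ _
  have hc1 : c ≤ 1 / 2 := min_le_right _ _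
  have : (fun _ : Fin n => 1 - c) ∈ B := dom hc hu hx (fun i => by
    rw [abs_of_nonneg (by linarith)]; exact (hlt i).le)
  refine hball ?_ this
  rw [Metric.mem_ball, dist_pi_lt_iff hr]
  intro i
  rw [Real.dist_eq, show 1 - c - 1 = -c by ring, abs_neg, abs_of_pos hc0]
  linarith

/-- direction attached to a sign pattern -/
noncomputable def dir {n : ℕ} (δ : ℝ) (p : (Fin n → Bool) → Fin n) (s : Fin n → Bool) :
    Fin n → ℝ := fun i => (if s i then 1 else -1) * (if i = p s then 1 else δ)

lemma dir_true {n : ℕ} {δ : ℝ} {p : (Fin n → Bool) → Fin n} {s : Fin n → Bool} {i}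
    (h : s i = true) : dir δ p s i = if i = p s then 1 else δ := by simp [dir, h]

lemma dir_false {n : ℕ} {δ : ℝ} {p : (Fin n → Bool) → Fin n} {s : Fin n → Bool} {i}
    (h : s i = false) : dir δ p s i = -(if i = p s then 1 else δ) := by
  simp only [dir, h]; simp only [Bool.false_eq_true, if_false, neg_one_mul]

/-- Points with all coordinates nonzero are illuminated by opposite pattern. -/
lemma case_N {n : ℕ} (hn : 3 ≤ n) {B : Set (Fin n → ℝ)} (hc : Convex ℝ B)
    (hu : Unconditional B) {x : Fin n → ℝ} (hx : x ∈ B) (hx0 : ∀ i, x i ≠ 0)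
    {δ : ℝ} (h0 : 0 < δ) (h1 : δ < 1) (p : (Fin n → Bool) → Fin n) (s : Fin n → Bool)
    (hs : ∀ i, s i = true ↔ x i ≤ 0) : Illuminates B (dir δ p s) x := by
  obtain ⟨ε, he, hle⟩ := exists_eps hn x hx0
  refine ⟨ε, he, ?_⟩
  have hx' : (fun j => |x j|) ∈ B := dom hc hu hx (fun j => by simp)
  refine dom_int hc hu hx' (fun i => ?_)
  have hm : ∃ m, m = (if i = p s then 1 else δ) ∧ 0 < m ∧ m ≤ 1 := by
    refine ⟨_, rfl, ?_, ?_⟩ <;> split_ifs <;> linarith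
  obtain ⟨m, hm, hm0, hm1⟩ := hm
  have hi := hle i
  have e1 : 0 < ε * m := by positivity
  have e2 : ε * m ≤ ε := by nlinarith
  simp only [Pi.add_apply, Pi.smul_apply, smul_eq_mul]
  by_cases h : x i ≤ 0
  · rw [dir_true ((hs i).2 h), ← hm, abs_lt]
    rw [abs_of_nonpos h] at hi ⊢
    constructor <;> linarith
  · rw [dir_false (by rw [← Bool.not_eq_true, hs i]; exact h), ← hm, abs_lt]
    rw [abs_of_pos (not_le.1 h)] at hi ⊢
    constructor <;> linarith

/-- Points with a zero coordinate. -/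
lemma case_Z {n : ℕ} {B : Set (Fin n → ℝ)} (hB : memU B)
    (hall : ∀ i : Fin n, allOnes - stdB i ∈ B) {x : Fin n → ℝ} (hx : x ∈ B) {z : Fin n}
    (hz : x z = 0) {δ : ℝ} (h0 : 0 < δ) (h1 : δ < 1) (p : (Fin n → Bool) → Fin n)
    (s : Fin n → Bool) (hp : p s ≠ z) (hs : ∀ i, i ≠ z → (s i = true ↔ x i ≤ 0)) :
    Illuminates B (dir δ p s) x := by
  have hcube := sub_cube hB hall hx
  obtain ⟨⟨hc, hk, -⟩, hu, hf⟩ := hB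
  refine ⟨1/2, by norm_num, ?_⟩
  have key := hc (hall z) (hall (p s)) (a := 3/4 - δ/4) (b := 1/4 + δ/4)
    (by linarith) (by linarith) (by ring)
  refine dom_int hc hu key (fun i => ?_)
  simp only [Pi.add_apply, Pi.smul_apply, smul_eq_mul, Pi.sub_apply, allOnes, stdB]
  by_cases hiz : i = z
  · subst hiz
    have : |dir δ p s i| = δ := by
      cases h : s i
      · rw [dir_false h, if_neg hp.symm, abs_neg, abs_of_pos h0]
      · rw [dir_true h, if_neg hp.symm, abs_of_pos h0]
    rw [hz, zero_add, abs_mul, this]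
    simp [hp.symm]
    linarith
  · have hm : ∃ m, m = (if i = p s then 1 else δ) ∧ 0 < m ∧ m ≤ 1 := by
      refine ⟨_, rfl, ?_, ?_⟩ <;> split_ifs <;> linarith
    obtain ⟨m, hm, hm0, hm1⟩ := hm
    have hb : |x i + 1/2 * dir δ p s i| ≤ 1 - m / 2 := by
      have := abs_le.1 (hcube i)
      by_cases h : x i ≤ 0
      · rw [dir_true ((hs i hiz).2 h), ← hm, abs_le]
        constructor <;> linarith
      · rw [dir_false (by rw [← Bool.not_eq_true, hs i hiz]; exact h), ← hm, abs_le]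
        constructor <;> linarith
    refine lt_of_le_of_lt hb ?_
    by_cases hip : i = p s
    · subst hip
      simp at hm
      simp [hiz, hm]
      linarith
    · simp [hiz, hip]
      linarith

/-- The core estimate for the constant pattern, positive orthant. -/
lemma case_pos {n : ℕ} (hn : 3 ≤ n) {B : Set (Fin n → ℝ)} (hB : memU B)
    (hall : ∀ i : Fin n, allOnes - stdB i ∈ B) {x : Fin n → ℝ} (hx : x ∈ B)
    (hpos : ∀ i, 0 < x i) {c : ℝ} (hc0 : 0 < c) (hc1 : c < 1) {j k : Fin n}
    (hj : x j ≤ 1 - c) (hkj : k ≠ j) (d : Fin n → ℝ) (hdj : d j = c / 2) (hdk : d k = -1)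
    (hd : ∀ i, i ≠ j → i ≠ k → d i = -(c/2)) : Illuminates B d x := by
  have hcube := sub_cube hB hall hx
  obtain ⟨⟨hc, hk, -⟩, hu, hf⟩ := hB
  obtain ⟨ε, he, hle⟩ := exists_eps hn x (fun i => (hpos i).ne')
  have hle1 : ε ≤ 1 := (hle j).trans (hcube j)
  refine ⟨ε, he, ?_⟩
  have key := hc hx (hall k) (a := 1 - 3/4 * ε) (b := 3/4 * ε)
    (by linarith) (by linarith) (by ring)
  refine dom_int hc hu key (fun i => ?_)
  simp only [Pi.add_apply, Pi.smul_apply, smul_eq_mul, Pi.sub_apply, allOnes, stdB]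
  have hxi := hle i
  have hx1 := hcube i
  rw [abs_of_pos (hpos i)] at hxi hx1
  have hxp := hpos i
  have hec : 0 < ε * c := by positivity
  have hec1 : ε * c ≤ ε := by nlinarith
  by_cases hij : i = j
  · subst hij
    rw [hdj]
    simp [hkj.symm]
    rw [abs_lt]
    have : ε * c ≤ ε * (1 - x i) := mul_le_mul_of_nonneg_left (by linarith) he.le
    constructor <;> nlinarith
  by_cases hik : i = k
  · subst hik
    rw [hdk]
    simp
    rw [abs_of_nonneg (by linarith)]
    nlinarith
  · rw [hd i hij hik]
    simp [hik]
    rw [abs_of_nonneg (by linarith)]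
    nlinarith

lemma neg_mem_B {n : ℕ} {B : Set (Fin n → ℝ)} (hc : Convex ℝ B) (hu : Unconditional B)
    {x : Fin n → ℝ} (hx : x ∈ B) : -x ∈ B := dom hc hu hx (fun i => by simp)

lemma illum_neg {n : ℕ} {B : Set (Fin n → ℝ)} (hc : Convex ℝ B) (hu : Unconditional B)
    {d x : Fin n → ℝ} (h : Illuminates B (-d) (-x)) : Illuminates B d x := by
  obtain ⟨ε, he, h⟩ := h
  refine ⟨ε, he, ?_⟩
  have hB : -B = B := by
    ext v
    rw [Set.mem_neg]
    exact ⟨fun h => by simpa using neg_mem_B hc hu h, neg_mem_B hc hu⟩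
  have h2 : -(x + ε • d) ∈ interior B := by
    convert h using 1
    simp [add_comm]
  have h3 : interior B = -interior B := by
    conv_lhs => rw [← hB]
    exact ((Homeomorph.neg (Fin n → ℝ)).preimage_interior B).symm
  rw [h3]
  exact h2

/-- If `B ∈ 𝒰^n`, `n ≥ 3`, contains `𝟙 - e_i` for every `i` but is
not the cube `[-1,1]^n`, then there are `δ ∈ (0,1)` and a symmetric subset of
`G^n(δ)` of cardinality `2^n - 2` illuminating `B`; in particular
`𝕀(B) ≤ 2^n - 2`. -/
theorem stmt10 (n : ℕ) (hn : 3 ≤ n) (B : Set (Fin n → ℝ)) (hB : memU B)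
    (hall : ∀ i : Fin n, allOnes - stdB i ∈ B)
    (hne : B ≠ Set.Icc (fun _ => (-1 : ℝ)) (fun _ => 1)) :
    ∃ δ : ℝ, 0 < δ ∧ δ < 1 ∧ ∃ D : Finset (Fin n → ℝ),
      ↑D ⊆ Gset n δ ∧ (∀ d ∈ D, -d ∈ D) ∧ D.card = 2 ^ n - 2 ∧
      IlluminatesSet B ↑D ∧ illumNumber B ≤ 2 ^ n - 2 := by
  classical
  obtain ⟨c, hc0, hc1, hgap⟩ := exists_c hB hall hne
  obtain ⟨p, hpneg, hp⟩ := exists_p n hn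
  have hB' := hB
  obtain ⟨⟨hc, hk, -⟩, hu, hf⟩ := hB'
  have hd0 : 0 < c / 2 := by linarith
  have hd1 : c / 2 < 1 := by linarith
  let S : Finset (Fin n → Bool) := Finset.univ \ {fun _ => true, fun _ => false}
  let D : Finset (Fin n → ℝ) := S.image (dir (c/2) p)
  have hS : ∀ s, NC s → s ∈ S := by
    rintro s ⟨i, j, hij⟩
    simp only [S, Finset.mem_sdiff, Finset.mem_univ, true_and, Finset.mem_insert,
      Finset.mem_singleton, not_or]
    constructor <;> (rintro rfl; exact hij rfl)
  have hneg : ∀ s, dir (c/2) p (fun i => !s i) = -dir (c/2) p s := by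
    intro s
    ext i
    rw [Pi.neg_apply]
    cases h : s i
    · rw [dir_false h, dir_true (by simp [h]), hpneg, neg_neg]
    · rw [dir_true h, dir_false (by simp [h]), hpneg]
  have hinj : Function.Injective (dir (c/2) p) := by
    intro s t hst
    ext i
    have h := congrFun hst i
    have hm1 : 0 < (if i = p s then (1:ℝ) else c/2) := by split_ifs <;> linarith
    have hm2 : 0 < (if i = p t then (1:ℝ) else c/2) := by split_ifs <;> linarith
    cases hs : s i <;> cases ht : t i
    · rfl
    · rw [dir_false hs, dir_true ht] at h; linarith
    · rw [dir_true hs, dir_false ht] at h; linarith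
    · rfl
  have hG : (↑D : Set (Fin n → ℝ)) ⊆ Gset n (c/2) := by
    intro d hd
    obtain ⟨s, -, rfl⟩ := Finset.mem_image.1 (Finset.mem_coe.1 hd)
    refine ⟨p s, ?_, ?_⟩
    · cases h : s (p s) <;> simp [dir, h]
    · intro j hj
      cases h : s j <;> simp [dir, h, hj]
  have hcard : D.card = 2 ^ n - 2 := by
    rw [Finset.card_image_of_injective _ hinj, Finset.card_sdiff_of_subset (Finset.subset_univ _),
      Finset.card_pair]
    · simp
    · intro h
      have := congrFun h ⟨0, by omega⟩
      simp at this
  have hill : IlluminatesSet B ↑D := by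
    intro x hxf
    have hx : x ∈ B := hk.isClosed.frontier_subset hxf
    by_cases hz : ∃ z, x z = 0
    · obtain ⟨z, hz⟩ := hz
      obtain ⟨b, hb1, hb2⟩ := hp (fun i => decide (x i ≤ 0)) z
      refine ⟨_, Finset.mem_coe.2 (Finset.mem_image_of_mem _ (hS _ hb1)), ?_⟩
      refine case_Z hB hall hx hz hd0 hd1 p _ hb2 (fun i hi => ?_)
      rw [Function.update_of_ne hi]
      simp
    push Not at hz
    by_cases hs : NC (fun i => decide (x i ≤ 0))
    · refine ⟨_, Finset.mem_coe.2 (Finset.mem_image_of_mem _ (hS _ hs)), ?_⟩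
      exact case_N hn hc hu hx hz hd0 hd1 p _ (fun i => by simp)
    -- constant sign pattern
    obtain ⟨j, hj⟩ := hgap x hx
    have main : ∀ y ∈ B, (∀ i, 0 < y i) → |y j| ≤ 1 - c →
        ∃ s ∈ S, Illuminates B (dir (c/2) p s) y := by
      intro y hy hy0 hyj
      obtain ⟨b, hb1, hb2⟩ := hp (fun _ => false) j
      have hb : b = true := by
        by_contra hb
        rw [Bool.not_eq_true] at hb
        subst hb
        obtain ⟨i, k, hik⟩ := hb1
        apply hik
        simp [Function.update_apply]
      subst hb
      refine ⟨_, hS _ hb1, ?_⟩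
      rw [abs_of_pos (hy0 j)] at hyj
      refine case_pos hn hB hall hy hy0 hc0 hc1 hyj hb2 _ ?_ ?_ ?_
      · rw [dir_true (by simp), if_neg hb2.symm]
      · rw [dir_false (by rw [Function.update_of_ne hb2]), if_pos rfl]
      · intro i hi hik
        rw [dir_false (by rw [Function.update_of_ne hi]), if_neg hik]
    by_cases hsg : x j ≤ 0
    · have hall0 : ∀ i, 0 < (-x) i := by
        intro i
        by_contra hcon
        have : ¬ x i ≤ 0 := fun h => hcon (by
          have := lt_of_le_of_ne h (hz i)
          simpa using this)
        exact hs ⟨i, j, by simp [this, hsg]⟩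
      obtain ⟨s, hsS, hsi⟩ := main (-x) (neg_mem_B hc hu hx) hall0 (by simpa using hj)
      have hs' : (fun i => !s i) ∈ S := by
        simp only [S, Finset.mem_sdiff, Finset.mem_univ, true_and, Finset.mem_insert,
          Finset.mem_singleton, not_or] at hsS ⊢
        constructor
        · intro h; apply hsS.2; ext i; simpa using congrFun h i
        · intro h; apply hsS.1; ext i; simpa using congrFun h i
      refine ⟨_, Finset.mem_coe.2 (Finset.mem_image_of_mem _ hs'), ?_⟩
      apply illum_neg hc hu
      rw [hneg, neg_neg]
      exact hsi
    · have hall0 : ∀ i, 0 < x i := by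
        intro i
        by_contra hcon
        have : x i ≤ 0 := not_lt.1 hcon
        exact hs ⟨i, j, by simp [this, not_le.1 hsg]⟩
      obtain ⟨s, hsS, hsi⟩ := main x hx hall0 hj
      exact ⟨_, Finset.mem_coe.2 (Finset.mem_image_of_mem _ hsS), hsi⟩
  refine ⟨c/2, hd0, hd1, D, hG, ?_, hcard, hill, ?_⟩
  · intro d hd
    obtain ⟨s, hsS, rfl⟩ := Finset.mem_image.1 hd
    rw [← hneg]
    refine Finset.mem_image_of_mem _ ?_
    simp only [S, Finset.mem_sdiff, Finset.mem_univ, true_and, Finset.mem_insert,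
      Finset.mem_singleton, not_or] at hsS ⊢
    constructor
    · intro h; apply hsS.2; ext i; simpa using congrFun h i
    · intro h; apply hsS.1; ext i; simpa using congrFun h i
  · refine Nat.sInf_le ⟨D, hcard, ?_, hill⟩
    intro d hd h
    obtain ⟨i, hi, -⟩ := hG (Finset.mem_coe.2 hd)
    rw [h] at hi
    simp at hi
end
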